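/- Let a = (a_n)_{n≥1} be a sequence of positive integers and let (p_n/q_n)_{n≥1} denote the convergents of α = [0; a₁, a₂, …]. Assume the sequence (q_ℓ^{1/ℓ})_{ℓ≥1} is bounded. If there exists a positive rational number w such that a satisfies Condition (*)_w, then α is transcendental. -/

import Mathlib

open Filter Topology

/-- Numerators of the convergents of `[0; a 1, a 2, ...]`. -/
def cfNum (a : ℕ → ℕ) : ℕ → ℕ
  | 0 => 0
  | 1 => 1
  | n + 2 => a (n + 2) * cfNum a (n + 1) + cfNum a n

/-- Denominators of the convergents of `[0; a 1, a 2, ...]`. -/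
def cfDen (a : ℕ → ℕ) : ℕ → ℕ
  | 0 => 1
  | 1 => a 1
  | n + 2 => a (n + 2) * cfDen a (n + 1) + cfDen a n

/-- The infinite word `a 1, a 2, a 3, ...` is eventually periodic. -/
def EventuallyPeriodic (a : ℕ → ℕ) : Prop :=
  ∃ n₀ T : ℕ, 0 < T ∧ ∀ n, n₀ ≤ n → a (n + T) = a n

/-- The finite word `L` is a prefix of the infinite word `a 1, a 2, a 3, ...`. -/
def IsPrefixOfSeq (L : List ℕ) (a : ℕ → ℕ) : Prop :=
  ∀ i, i < L.length → L.getD i 0 = a (i + 1)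

/-- Condition `(*)_w`: the word `a 1 a 2 ...` is not eventually periodic and begins in
arbitrarily long quasi-palindromes `Uₙ Vₙ Ūₙ` with `|Vₙ|/|Uₙ| ≤ w` and `|Uₙ|` increasing. -/
def ConditionStar (w : ℚ) (a : ℕ → ℕ) : Prop :=
  ¬ EventuallyPeriodic a ∧
    ∃ U V : ℕ → List ℕ,
      (∀ n, 1 ≤ n → IsPrefixOfSeq (U n ++ V n ++ (U n).reverse) a) ∧
      (∀ n, 1 ≤ n → ((V n).length : ℚ) ≤ w * (U n).length) ∧
      StrictMono (fun n => (U n).length)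


section

open MvPolynomial

/-- A submultiplicative seminorm. -/
structure SN (R : Type*) [CommRing R] where
  ν : R → ℝ
  nonneg : ∀ x, 0 ≤ ν x
  zero : ν 0 = 0
  one : ν 1 ≤ 1
  add_le : ∀ x y, ν (x + y) ≤ ν x + ν y
  mul_le : ∀ x y, ν (x * y) ≤ ν x * ν y

/-- weight of a monomial -/
noncomputable def monW {σ : Type*} (ρ : σ → ℝ) (J : σ →₀ ℕ) : ℝ := J.prod fun i k => ρ i ^ k

/-- weighted l1 norm -/
noncomputable def wL1 {σ R : Type*} [CommRing R] (n : SN R) (ρ : σ → ℝ)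
    (F : MvPolynomial σ R) : ℝ :=
  ∑ J ∈ F.support, n.ν (F.coeff J) * monW ρ J

section wL1
variable {σ τ R : Type*} [CommRing R] (n : SN R) {ρ : σ → ℝ}

lemma monW_add (J K : σ →₀ ℕ) : monW ρ (J + K) = monW ρ J * monW ρ K := by
  classical
  unfold monW
  rw [Finsupp.prod_add_index]
  · simp
  · intros; rw [pow_add]

lemma monW_zero : monW ρ 0 = 1 := by simp [monW]

lemma monW_single (i : σ) (k : ℕ) : monW ρ (Finsupp.single i k) = ρ i ^ k := by
  simp [monW]

lemma monW_nonneg (hρ : ∀ i, 0 ≤ ρ i) (J : σ →₀ ℕ) : 0 ≤ monW ρ J :=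
  Finset.prod_nonneg fun i _ => pow_nonneg (hρ i) _

lemma monW_one (J : σ →₀ ℕ) : monW (fun _ => (1:ℝ)) J = 1 := by simp [monW, Finsupp.prod]

lemma wL1_of_subset (F : MvPolynomial σ R) (s : Finset (σ →₀ ℕ)) (h : F.support ⊆ s) :
    wL1 n ρ F = ∑ J ∈ s, n.ν (F.coeff J) * monW ρ J := by
  unfold wL1
  apply Finset.sum_subset h
  intro J _ hJ
  rw [MvPolynomial.notMem_support_iff.mp hJ, n.zero, zero_mul]

lemma wL1_nonneg (hρ : ∀ i, 0 ≤ ρ i) (F : MvPolynomial σ R) : 0 ≤ wL1 n ρ F :=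
  Finset.sum_nonneg fun J _ => mul_nonneg (n.nonneg _) (monW_nonneg hρ J)

lemma wL1_zero : wL1 n ρ (0 : MvPolynomial σ R) = 0 := by simp [wL1]

lemma wL1_add (hρ : ∀ i, 0 ≤ ρ i) (F G : MvPolynomial σ R) :
    wL1 n ρ (F + G) ≤ wL1 n ρ F + wL1 n ρ G := by
  classical
  rw [wL1_of_subset n (F + G) (F.support ∪ G.support) MvPolynomial.support_add,
    wL1_of_subset n F (F.support ∪ G.support) Finset.subset_union_left,
    wL1_of_subset n G (F.support ∪ G.support) Finset.subset_union_right, ← Finset.sum_add_distrib]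
  apply Finset.sum_le_sum
  intro J _
  rw [← add_mul, coeff_add]
  exact mul_le_mul_of_nonneg_right (n.add_le _ _) (monW_nonneg hρ J)

lemma wL1_sum (hρ : ∀ i, 0 ≤ ρ i) {ι : Type*} (s : Finset ι) (f : ι → MvPolynomial σ R) :
    wL1 n ρ (∑ i ∈ s, f i) ≤ ∑ i ∈ s, wL1 n ρ (f i) := by
  classical
  induction s using Finset.induction_on with
  | empty => simp [wL1_zero]
  | insert a s ha ih =>
    rw [Finset.sum_insert ha, Finset.sum_insert ha]
    exact (wL1_add n hρ _ _).trans (by linarith)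

lemma wL1_monomial (J : σ →₀ ℕ) (c : R) :
    wL1 n ρ (monomial J c) = n.ν c * monW ρ J := by
  classical
  rw [wL1_of_subset n _ {J} MvPolynomial.support_monomial_subset]
  simp

lemma wL1_C (c : R) : wL1 n ρ (C c) = n.ν c := by
  rw [← monomial_zero', wL1_monomial, monW_zero, mul_one]

lemma wL1_X (hρ : ∀ i, 0 ≤ ρ i) (i : σ) : wL1 n ρ (X i) ≤ ρ i := by
  rw [X, wL1_monomial, monW_single, pow_one]
  exact mul_le_of_le_one_left (hρ i) n.one

lemma wL1_one : wL1 n ρ (1 : MvPolynomial σ R) ≤ 1 := by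
  rw [← C_1, wL1_C]; exact n.one

lemma wL1_mul (hρ : ∀ i, 0 ≤ ρ i) (F G : MvPolynomial σ R) :
    wL1 n ρ (F * G) ≤ wL1 n ρ F * wL1 n ρ G := by
  classical
  have h : F * G = ∑ J ∈ F.support, ∑ K ∈ G.support,
      monomial (J + K) (F.coeff J * G.coeff K) := by
    conv_lhs => rw [F.as_sum, G.as_sum, Finset.sum_mul_sum]
    simp [monomial_mul]
  rw [h]
  refine (wL1_sum n hρ _ _).trans ?_
  rw [wL1, wL1, Finset.sum_mul_sum]
  apply Finset.sum_le_sum; intro J _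
  refine (wL1_sum n hρ _ _).trans ?_
  apply Finset.sum_le_sum; intro K _
  rw [wL1_monomial, monW_add]
  calc _ ≤ (n.ν (F.coeff J) * n.ν (G.coeff K)) * (monW ρ J * monW ρ K) :=
        mul_le_mul_of_nonneg_right (n.mul_le _ _)
          (mul_nonneg (monW_nonneg hρ J) (monW_nonneg hρ K))
    _ = _ := by ring

lemma wL1_pow (hρ : ∀ i, 0 ≤ ρ i) (F : MvPolynomial σ R) (k : ℕ) :
    wL1 n ρ (F ^ k) ≤ wL1 n ρ F ^ k := by
  induction k with
  | zero => simpa using wL1_one n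
  | succ k ih =>
    rw [pow_succ, pow_succ]
    exact (wL1_mul n hρ _ _).trans (mul_le_mul_of_nonneg_right ih (wL1_nonneg n hρ _))

lemma wL1_prod (hρ : ∀ i, 0 ≤ ρ i) {ι : Type*} (s : Finset ι) (f : ι → MvPolynomial σ R) :
    wL1 n ρ (∏ i ∈ s, f i) ≤ ∏ i ∈ s, wL1 n ρ (f i) := by
  classical
  induction s using Finset.induction_on with
  | empty => simpa using wL1_one n
  | insert a s ha ih =>
    rw [Finset.prod_insert ha, Finset.prod_insert ha]
    exact (wL1_mul n hρ _ _).trans (mul_le_mul_of_nonneg_left ih (wL1_nonneg n hρ _))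

lemma monW_mono {ρ' : σ → ℝ} (hρ : ∀ i, 0 ≤ ρ i) (h : ∀ i, ρ i ≤ ρ' i) (J : σ →₀ ℕ) :
    monW ρ J ≤ monW ρ' J := by
  unfold monW Finsupp.prod
  exact Finset.prod_le_prod (fun i _ => pow_nonneg (hρ i) _)
    (fun i _ => pow_le_pow_left₀ (hρ i) (h i) _)

lemma wL1_mono {ρ' : σ → ℝ} (hρ : ∀ i, 0 ≤ ρ i) (h : ∀ i, ρ i ≤ ρ' i) (F : MvPolynomial σ R) :
    wL1 n ρ F ≤ wL1 n ρ' F :=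
  Finset.sum_le_sum fun J _ => mul_le_mul_of_nonneg_left (monW_mono hρ h J) (n.nonneg _)

lemma wL1_bind (hρ : ∀ i, 0 ≤ ρ i) (f : τ → MvPolynomial σ R) (F : MvPolynomial τ R) :
    wL1 n ρ (bind₁ f F) ≤ wL1 n (fun i => wL1 n ρ (f i)) F := by
  conv_lhs => rw [F.as_sum, map_sum]
  refine (wL1_sum n hρ _ _).trans ?_
  apply Finset.sum_le_sum; intro J _
  rw [bind₁_monomial]
  refine (wL1_mul n hρ _ _).trans ?_
  rw [wL1_C]
  refine mul_le_mul_of_nonneg_left ?_ (n.nonneg _)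
  refine (wL1_prod n hρ _ _).trans ?_
  unfold monW Finsupp.prod
  exact Finset.prod_le_prod (fun i _ => wL1_nonneg n hρ _) (fun i _ => wL1_pow n hρ _ _)

lemma wL1_coeff (hρ : ∀ i, 0 ≤ ρ i) (F : MvPolynomial σ R) (J : σ →₀ ℕ) :
    n.ν (F.coeff J) * monW ρ J ≤ wL1 n ρ F := by
  classical
  rw [wL1_of_subset n F (insert J F.support) (Finset.subset_insert _ _)]
  exact Finset.single_le_sum (f := fun J => n.ν (F.coeff J) * monW ρ J)
    (fun J _ => mul_nonneg (n.nonneg _) (monW_nonneg hρ J)) (Finset.mem_insert_self _ _)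

end wL1

/-- absolute value on the reals -/
noncomputable def absSN : SN ℝ where
  ν := fun x => |x|
  nonneg := abs_nonneg
  zero := abs_zero
  one := by simp
  add_le := abs_add_le
  mul_le := fun x y => (abs_mul x y).le

/-- plain l1 norm over the reals -/
noncomputable def L1 {σ : Type*} (F : MvPolynomial σ ℝ) : ℝ := wL1 absSN (fun _ => 1) F

/-- integer coefficients -/
def IntCoef {σ : Type*} (F : MvPolynomial σ ℝ) : Prop := ∀ J, ∃ z : ℤ, F.coeff J = z

lemma intCoef_iff {σ : Type*} (F : MvPolynomial σ ℝ) :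
    IntCoef F ↔ ∃ G : MvPolynomial σ ℤ, map (Int.castRingHom ℝ) G = F := by
  classical
  constructor
  · intro h
    choose z hz using h
    refine ⟨∑ J ∈ F.support, monomial J (z J), ?_⟩
    rw [map_sum]
    conv_rhs => rw [F.as_sum]
    apply Finset.sum_congr rfl
    intro J _
    rw [map_monomial, hz]; simp
  · rintro ⟨G, rfl⟩ J
    exact ⟨G.coeff J, by simp [coeff_map]⟩

end

section
open MvPolynomial

section hasse
variable {m : ℕ}

/-- product of binomials -/
def mchoose (K I : Fin m →₀ ℕ) : ℕ := ∏ h, (K h).choose (I h)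

/-- Hasse derivative -/
noncomputable def hasse (I : Fin m →₀ ℕ) : MvPolynomial (Fin m) ℝ →ₗ[ℝ] MvPolynomial (Fin m) ℝ :=
  (basisMonomials (Fin m) ℝ).constr ℝ (fun K => monomial (K - I) (mchoose K I : ℝ))

lemma hasse_monomial (I K : Fin m →₀ ℕ) (c : ℝ) :
    hasse I (monomial K c) = monomial (K - I) (c * mchoose K I) := by
  have h : (monomial K c : MvPolynomial (Fin m) ℝ) = c • (basisMonomials (Fin m) ℝ K) := by
    simp [smul_monomial]
  rw [h, map_smul, hasse, Module.Basis.constr_basis, smul_monomial, smul_eq_mul]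

lemma mchoose_eq_zero {K I : Fin m →₀ ℕ} (h : ¬ I ≤ K) : mchoose K I = 0 := by
  rw [Finsupp.le_def] at h
  push Not at h
  obtain ⟨i, hi⟩ := h
  exact Finset.prod_eq_zero (Finset.mem_univ i) (Nat.choose_eq_zero_of_lt hi)

lemma coeff_hasse (I K : Fin m →₀ ℕ) (F : MvPolynomial (Fin m) ℝ) :
    coeff K (hasse I F) = coeff (K + I) F * mchoose (K + I) I := by
  classical
  induction F using MvPolynomial.induction_on' with
  | monomial L c =>
    rw [hasse_monomial, coeff_monomial, coeff_monomial]
    by_cases h : L = K + I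
    · subst h; simp
    · rw [if_neg h, zero_mul]
      split_ifs with h2
      · have : ¬ I ≤ L := by
          intro h3; apply h; rw [← h2, tsub_add_cancel_of_le h3]
        rw [mchoose_eq_zero this]; simp
      · rfl
  | add p q hp hq => rw [map_add, coeff_add, hp, hq, coeff_add]; ring

lemma hasse_zero (F : MvPolynomial (Fin m) ℝ) : hasse 0 F = F := by
  ext K; rw [coeff_hasse]; simp [mchoose]

lemma pderiv_hasse (I : Fin m →₀ ℕ) (h : Fin m) (F : MvPolynomial (Fin m) ℝ) :
    pderiv h (hasse I F) = C ((I h : ℝ) + 1) * hasse (I + Finsupp.single h 1) F := by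
  classical
  ext K
  rw [coeff_pderiv, coeff_C_mul, coeff_hasse, coeff_hasse]
  have e : K + Finsupp.single h 1 + I = K + (I + Finsupp.single h 1) := by
    rw [add_assoc, add_comm (Finsupp.single h 1)]
  rw [e]
  have key : (mchoose (K + (I + Finsupp.single h 1)) I) * (K h + 1) =
      (I h + 1) * mchoose (K + (I + Finsupp.single h 1)) (I + Finsupp.single h 1) := by
    unfold mchoose
    rw [← Finset.mul_prod_erase _ _ (Finset.mem_univ h),
      ← Finset.mul_prod_erase _ (fun x => ((K + (I + Finsupp.single h 1) : Fin m →₀ ℕ) x).choose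
        ((I + Finsupp.single h 1 : Fin m →₀ ℕ) x)) (Finset.mem_univ h)]
    have : ∏ x ∈ Finset.univ.erase h, ((K + (I + Finsupp.single h 1) : Fin m →₀ ℕ) x).choose (I x) =
      ∏ x ∈ Finset.univ.erase h, ((K + (I + Finsupp.single h 1) : Fin m →₀ ℕ) x).choose
        ((I + Finsupp.single h 1 : Fin m →₀ ℕ) x) := by
      apply Finset.prod_congr rfl
      intro x hx
      have : x ≠ h := Finset.ne_of_mem_erase hx
      simp [Finsupp.single_apply, this.symm]
    rw [this]
    have h2 := Nat.choose_succ_right_eq (K h + (I h + 1)) (I h)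
    have h3 : K h + (I h + 1) - I h = K h + 1 := by omega
    rw [h3] at h2
    simp only [Finsupp.add_apply, Finsupp.single_eq_same]
    rw [mul_right_comm, ← h2]; ring
  have key' : ((mchoose (K + (I + Finsupp.single h 1)) I : ℕ) : ℝ) * (K h + 1) =
      (I h + 1) * (mchoose (K + (I + Finsupp.single h 1)) (I + Finsupp.single h 1) : ℕ) := by
    exact_mod_cast key
  rw [mul_assoc, key']; ring

end hasse

lemma coeff_X_mul_pderiv {m : ℕ} (h : Fin m) (F : MvPolynomial (Fin m) ℝ) (n : Fin m →₀ ℕ) :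
    coeff n (X h * pderiv h F) = n h * coeff n F := by
  classical
  rw [coeff_X_mul']
  split_ifs with hs
  · rw [coeff_pderiv]
    have h1 : 1 ≤ n h := Nat.one_le_iff_ne_zero.mpr (by simpa using hs)
    have h2 : n - Finsupp.single h 1 + Finsupp.single h 1 = n :=
      tsub_add_cancel_of_le (by simpa using h1)
    rw [h2]
    have h3 : (n - Finsupp.single h 1 : Fin m →₀ ℕ) h = n h - 1 := by simp
    rw [h3, Nat.cast_sub h1]; push_cast; ring
  · have : n h = 0 := by simpa using hs
    rw [this]; simp

lemma prop_of_pderiv {m : ℕ} (F G : MvPolynomial (Fin m) ℝ) (hG : G ≠ 0)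
    (h : ∀ i, G * pderiv i F = F * pderiv i G) : ∃ c : ℝ, F = C c * G := by
  classical
  set M : MonomialOrder (Fin m) := MonomialOrder.lex with hM
  set g := M.degree G
  have hg : coeff g G ≠ 0 := by
    have := M.leadingCoeff_ne_zero_iff.mpr hG
    exact this
  set c := coeff g F / coeff g G
  refine ⟨c, ?_⟩
  by_contra hne
  set F' := F - C c * G with hF'
  have hF'0 : F' ≠ 0 := sub_ne_zero.mpr hne
  have hc : coeff g F' = 0 := by
    simp only [hF', coeff_sub, coeff_C_mul, c]; field_simp; ring
  have heq : ∀ i, G * (X i * pderiv i F') = F' * (X i * pderiv i G) := by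
    intro i
    have : pderiv i F' = pderiv i F - C c * pderiv i G := by
      simp [hF']
    rw [this, hF']
    linear_combination X i * h i
  set n := M.degree F' with hn
  have hfn : coeff n F' ≠ 0 := M.leadingCoeff_ne_zero_iff.mpr hF'0
  have hdeg : ∀ (i : Fin m) (H : MvPolynomial (Fin m) ℝ),
      M.toSyn (M.degree (X i * pderiv i H)) ≤ M.toSyn (M.degree H) := by
    intro i H
    rw [M.degree_le_iff]
    intro b hb
    apply M.le_degree
    rw [mem_support_iff] at hb ⊢
    rw [coeff_X_mul_pderiv] at hb
    exact right_ne_zero_of_mul hb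
  have hng : n = g := by
    ext i
    have h1 := congrArg (coeff (g + n)) (heq i)
    rw [M.coeff_mul_of_add_of_degree_le le_rfl (hdeg i F'), add_comm g n,
      M.coeff_mul_of_add_of_degree_le le_rfl (hdeg i G), coeff_X_mul_pderiv, coeff_X_mul_pderiv] at h1
    have h2 : ((n i : ℝ) - g i) * (coeff g G * coeff n F') = 0 := by linear_combination h1
    have h3 := (mul_eq_zero.mp h2).resolve_right (mul_ne_zero hg hfn)
    exact_mod_cast sub_eq_zero.mp h3
  rw [hng] at hfn
  exact hfn hc

theorem genWronskian {m : ℕ} (l : ℕ) (φ : Fin l → MvPolynomial (Fin m) ℝ)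
    (hφ : LinearIndependent ℝ φ) :
    ∃ I : Fin l → (Fin m →₀ ℕ), (∀ i, (I i).degree ≤ i) ∧
      (Matrix.of fun i j => hasse (I i) (φ j)).det ≠ 0 := by
  classical
  induction l with
  | zero => exact ⟨fun i => i.elim0, fun i => i.elim0, by simp⟩
  | succ l ih =>
    obtain ⟨I, hI, hdet⟩ := ih (fun j => φ j.castSucc)
      (hφ.comp _ (Fin.castSucc_injective l))
    by_contra hcon
    push Not at hcon
    set A : Matrix (Fin l) (Fin (l+1)) (MvPolynomial (Fin m) ℝ) :=
      Matrix.of fun i j => hasse (I i) (φ j) with hA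
    set Δ : Fin (l+1) → MvPolynomial (Fin m) ℝ := fun j =>
      (-1) ^ (l + (j : ℕ)) * (A.submatrix id j.succAbove).det with hΔ
    have hrel : ∀ J : Fin m →₀ ℕ, J.degree ≤ l → ∑ j, hasse J (φ j) * Δ j = 0 := by
      intro J hJ
      have h1 := hcon (Fin.snoc I J) (by
        intro i
        refine Fin.lastCases ?_ (fun i => ?_) i
        · simpa using hJ
        · simpa using hI i)
      rw [Matrix.det_succ_row _ (Fin.last l)] at h1
      rw [← h1]
      apply Finset.sum_congr rfl
      intro j _
      have : (Matrix.of fun i j => hasse ((Fin.snoc I J : Fin (l+1) → (Fin m →₀ ℕ)) i) (φ j)).submatrix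
          (Fin.last l).succAbove j.succAbove = A.submatrix id j.succAbove := by
        ext i k : 2
        simp [hA]
      rw [this]
      simp [hΔ]; ring
    have hlast : Δ (Fin.last l) = (Matrix.of fun i j => hasse (I i) (φ (Fin.castSucc j))).det := by
      simp only [hΔ, Fin.val_last]
      rw [← two_mul, pow_mul]
      simp only [even_two, Even.neg_pow, one_pow, one_mul]
      congr 1
      ext i j : 2
      simp [hA]
    have hΔ0 : Δ (Fin.last l) ≠ 0 := by rw [hlast]; exact hdet
    have hz : ∀ h j, Δ (Fin.last l) * pderiv h (Δ j) = Δ j * pderiv h (Δ (Fin.last l)) := by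
      intro h
      have hd : ∀ i, ∑ j, hasse (I i) (φ j) * pderiv h (Δ j) = 0 := by
        intro i
        have h1 := congrArg (pderiv h) (hrel (I i) ((hI i).trans i.2.le))
        have h2 := hrel (I i + Finsupp.single h 1) (by
          rw [map_add, Finsupp.degree_single]; have := hI i; have := i.2; omega)
        rw [map_sum, map_zero] at h1
        simp only [pderiv_mul, pderiv_hasse, Finset.sum_add_distrib, mul_assoc, ← Finset.mul_sum] at h1
        rw [h2, mul_zero, zero_add] at h1
        exact h1
      set z : Fin (l+1) → MvPolynomial (Fin m) ℝ := fun j =>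
        Δ (Fin.last l) * pderiv h (Δ j) - Δ j * pderiv h (Δ (Fin.last l)) with hz
      have hzl : z (Fin.last l) = 0 := by simp [hz]
      have hmv : (Matrix.of fun i j => hasse (I i) (φ (Fin.castSucc j))).mulVec
          (fun j => z j.castSucc) = 0 := by
        ext1 i
        simp only [Matrix.mulVec, dotProduct, Matrix.of_apply, Pi.zero_apply]
        have h3 : ∑ j, hasse (I i) (φ j) * z j = 0 := by
          simp only [hz, mul_sub, Finset.sum_sub_distrib]
          have e1 : ∑ j, hasse (I i) (φ j) * (Δ (Fin.last l) * pderiv h (Δ j)) =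
            Δ (Fin.last l) * ∑ j, hasse (I i) (φ j) * pderiv h (Δ j) := by
            rw [Finset.mul_sum]; exact Finset.sum_congr rfl fun j _ => by ring
          have e2 : ∑ j, hasse (I i) (φ j) * (Δ j * pderiv h (Δ (Fin.last l))) =
            (∑ j, hasse (I i) (φ j) * Δ j) * pderiv h (Δ (Fin.last l)) := by
            rw [Finset.sum_mul]; exact Finset.sum_congr rfl fun j _ => by ring
          rw [e1, e2, hd, hrel _ ((hI i).trans i.2.le)]; simp
        rw [Fin.sum_univ_castSucc, hzl, mul_zero, add_zero] at h3
        exact h3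
      have h4 := Matrix.eq_zero_of_mulVec_eq_zero hdet hmv
      intro j
      refine Fin.lastCases ?_ (fun j => ?_) j
      · rfl
      · exact sub_eq_zero.mp (congrFun h4 j)
    have hc : ∀ j, ∃ c : ℝ, Δ j = C c * Δ (Fin.last l) := fun j =>
      prop_of_pderiv _ _ hΔ0 (fun h => hz h j)
    choose c hc using hc
    have h5 := hrel 0 (by simp)
    have h6 : (∑ j, c j • φ j) * Δ (Fin.last l) = 0 := by
      rw [← h5, Finset.sum_mul]
      apply Finset.sum_congr rfl
      intro j _
      rw [hc j, hasse_zero, smul_eq_C_mul]; ring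
    have h7 := (mul_eq_zero.mp h6).resolve_right hΔ0
    have h8 := Fintype.linearIndependent_iff.mp hφ c h7 (Fin.last l)
    have h9 := hc (Fin.last l)
    rw [h8] at h9
    simp at h9
    exact hΔ0 h9

end

section
open MvPolynomial

/-- translation of the variables -/
noncomputable def shiftP {m : ℕ} (ξ : Fin m → ℝ) :
    MvPolynomial (Fin m) ℝ →ₐ[ℝ] MvPolynomial (Fin m) ℝ := aeval (fun h => X h + C (ξ h))

/-- weight of an exponent -/
noncomputable def wtJ {m : ℕ} (r : Fin m → ℕ) (J : Fin m →₀ ℕ) : ℝ := ∑ h, (J h : ℝ) / r h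

/-- vanishing to weighted order -/
def Vanish {m : ℕ} (r : Fin m → ℕ) (θ : ℝ) (F : MvPolynomial (Fin m) ℝ) : Prop :=
  ∀ J, wtJ r J < θ → coeff J F = 0

lemma pderiv_shift {m : ℕ} (ξ : Fin m → ℝ) (h : Fin m) (F : MvPolynomial (Fin m) ℝ) :
    pderiv h (shiftP ξ F) = shiftP ξ (pderiv h F) := by
  classical
  induction F using MvPolynomial.induction_on with
  | C a => simp [shiftP]
  | add p q hp hq => simp [hp, hq]
  | mul_X p n hp =>
    rw [map_mul, pderiv_mul, hp, pderiv_mul, map_add, map_mul, map_mul]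
    congr 2
    simp only [shiftP, aeval_X, map_add, pderiv_C, add_zero, pderiv_X]
    by_cases hh : n = h
    · subst hh; simp
    · simp [hh]

lemma hasse_shift {m : ℕ} (ξ : Fin m → ℝ) (I : Fin m →₀ ℕ) (F : MvPolynomial (Fin m) ℝ) :
    hasse I (shiftP ξ F) = shiftP ξ (hasse I F) := by
  classical
  induction hn : I.degree generalizing I with
  | zero =>
    have : I = 0 := (Finsupp.degree_eq_zero_iff I).mp hn
    subst this; simp [hasse_zero]
  | succ n ih =>
    have : I ≠ 0 := by rintro rfl; simp at hn
    obtain ⟨h, hh⟩ := Finsupp.ne_iff.mp this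
    have h1 : I - Finsupp.single h 1 + Finsupp.single h 1 = I :=
      tsub_add_cancel_of_le (by simpa using Nat.one_le_iff_ne_zero.mpr hh)
    set I' := I - Finsupp.single h 1
    have h2 : I'.degree = n := by
      have := congrArg Finsupp.degree h1
      rw [map_add, Finsupp.degree_single] at this; omega
    have h3 := congrArg (pderiv h) (ih I' h2)
    rw [pderiv_shift, pderiv_hasse, pderiv_hasse, map_mul, h1] at h3
    have h4 : (C ((I' h : ℝ) + 1) : MvPolynomial (Fin m) ℝ) ≠ 0 := by
      rw [Ne, C_eq_zero]; positivity
    have h5 : shiftP ξ (C ((I' h : ℝ) + 1)) = C ((I' h : ℝ) + 1) := by simp [shiftP]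
    rw [h5] at h3
    exact mul_left_cancel₀ h4 h3

lemma shift_injective {m : ℕ} (ξ : Fin m → ℝ) : Function.Injective (shiftP ξ) := by
  have : (shiftP (-ξ)).comp (shiftP ξ) = AlgHom.id ℝ _ := by
    ext i : 1; simp [shiftP]
  intro x y hxy
  have h := congrArg (shiftP (-ξ)) hxy
  rw [← AlgHom.comp_apply, ← AlgHom.comp_apply, this] at h
  exact h

/-- external product -/
noncomputable def tens {m : ℕ} (φ : MvPolynomial (Fin m) ℝ) (ψ : MvPolynomial (Fin 1) ℝ) :
    MvPolynomial (Fin (m+1)) ℝ :=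
  rename Fin.succ φ * rename (fun _ : Fin 1 => (0 : Fin (m+1))) ψ

lemma coeff_tens {m : ℕ} (φ : MvPolynomial (Fin m) ℝ) (ψ : MvPolynomial (Fin 1) ℝ)
    (k : ℕ) (J : Fin m →₀ ℕ) :
    coeff (J.cons k) (tens φ ψ) = coeff J φ * coeff (Finsupp.single 0 k) ψ := by
  classical
  induction φ using MvPolynomial.induction_on' with
  | add p q hp hq => 
    have : tens (p + q) ψ = tens p ψ + tens q ψ := by simp [tens, add_mul]
    rw [this, coeff_add, hp, hq, coeff_add, add_mul]
  | monomial A c =>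
    induction ψ using MvPolynomial.induction_on' with
    | add p q hp hq =>
      have : tens (monomial A c) (p + q) = tens (monomial A c) p + tens (monomial A c) q := by
        simp [tens, mul_add]
      rw [this, coeff_add, hp, hq, coeff_add, mul_add]
    | monomial B d =>
      have h0 : A.mapDomain Fin.succ + B.mapDomain (fun _ : Fin 1 => (0 : Fin (m+1))) = A.cons (B 0) := by
        have hB : B = Finsupp.single 0 (B 0) := by
          ext; simp
        ext i
        refine Fin.cases ?_ (fun i => ?_) i
        · rw [hB]
          simp only [Finsupp.mapDomain_single, Finsupp.add_apply, Finsupp.single_eq_same,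
            Finsupp.cons_zero]
          rw [Finsupp.mapDomain_of_notMem_range]
          · simp
          · simp
        · rw [hB]
          simp only [Finsupp.mapDomain_single, Finsupp.add_apply, Finsupp.cons_succ]
          rw [Finsupp.mapDomain_apply (Fin.succ_injective m)]
          simp [Fin.succ_ne_zero]
      unfold tens
      rw [rename_monomial, rename_monomial, monomial_mul, h0, coeff_monomial, coeff_monomial,
        coeff_monomial]
      have e1 : A.cons (B 0) = J.cons k ↔ A = J ∧ B = Finsupp.single 0 k := by
        constructor
        · intro h
          have h1 := congrArg Finsupp.tail h
          have h2 := DFunLike.congr_fun h 0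
          rw [Finsupp.tail_cons, Finsupp.tail_cons] at h1
          rw [Finsupp.cons_zero, Finsupp.cons_zero] at h2
          refine ⟨h1, ?_⟩
          ext; simpa using h2
        · rintro ⟨rfl, rfl⟩; simp
      by_cases hA : A = J
      · by_cases hB : B = Finsupp.single 0 k
        · rw [if_pos (e1.mpr ⟨hA, hB⟩), if_pos hA, if_pos hB]
        · rw [if_neg (fun h => hB (e1.mp h).2), if_neg hB, mul_zero]
      · rw [if_neg (fun h => hA (e1.mp h).1), if_neg hA, zero_mul]

lemma ext_cons {m : ℕ} {F G : MvPolynomial (Fin (m+1)) ℝ}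
    (h : ∀ k (J : Fin m →₀ ℕ), coeff (J.cons k) F = coeff (J.cons k) G) : F = G := by
  ext J
  have := h (J 0) J.tail
  rwa [Finsupp.cons_tail] at this

lemma cons_add_cons {m : ℕ} (J I : Fin m →₀ ℕ) (k l : ℕ) :
    J.cons k + I.cons l = (J + I).cons (k + l) := by
  ext i
  refine Fin.cases ?_ (fun i => ?_) i <;> simp

lemma mchoose_cons {m : ℕ} (J I : Fin m →₀ ℕ) (k l : ℕ) :
    mchoose (J.cons k) (I.cons l) = k.choose l * mchoose J I := by
  unfold mchoose; rw [Fin.prod_univ_succ]; simp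

lemma hasse_tens {m : ℕ} (φ : MvPolynomial (Fin m) ℝ) (ψ : MvPolynomial (Fin 1) ℝ)
    (l : ℕ) (I : Fin m →₀ ℕ) :
    hasse (I.cons l) (tens φ ψ) = tens (hasse I φ) (hasse (Finsupp.single 0 l) ψ) := by
  apply ext_cons
  intro k J
  rw [coeff_hasse, cons_add_cons, coeff_tens, coeff_tens, coeff_hasse, coeff_hasse, mchoose_cons,
    ← Finsupp.single_add]
  have : mchoose (Finsupp.single (0 : Fin 1) (k + l)) (Finsupp.single (0 : Fin 1) l) = (k+l).choose l := by
    simp [mchoose]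
  rw [this]; push_cast; ring

lemma shift_tens {m : ℕ} (ξ : Fin (m+1) → ℝ) (φ : MvPolynomial (Fin m) ℝ)
    (ψ : MvPolynomial (Fin 1) ℝ) :
    shiftP ξ (tens φ ψ) = tens (shiftP (fun h => ξ h.succ) φ) (shiftP (fun _ => ξ 0) ψ) := by
  unfold tens
  rw [map_mul]
  have h1 : (shiftP ξ).comp (rename Fin.succ) =
      (rename Fin.succ).comp (shiftP (fun h => ξ h.succ)) := by
    ext i : 1; simp [shiftP]
  have h2 : (shiftP ξ).comp (rename (fun _ : Fin 1 => (0 : Fin (m+1)))) =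
      (rename (fun _ : Fin 1 => (0 : Fin (m+1)))).comp (shiftP (fun _ => ξ 0)) := by
    ext i : 1; simp [shiftP]
  rw [← AlgHom.comp_apply, h1, ← AlgHom.comp_apply, h2]; rfl

lemma exists_rep {m : ℕ} (P : MvPolynomial (Fin (m+1)) ℝ) (r : ℕ) (hr : degreeOf 0 P ≤ r) :
    ∃ (φ : Fin (r+1) → MvPolynomial (Fin m) ℝ) (ψ : Fin (r+1) → MvPolynomial (Fin 1) ℝ),
      P = ∑ j, tens (φ j) (ψ j) := by
  classical
  refine ⟨fun j => (finSuccEquiv ℝ m P).coeff j, fun j => monomial (Finsupp.single 0 (j:ℕ)) 1, ?_⟩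
  apply ext_cons
  intro k J
  rw [coeff_sum]
  simp only [coeff_tens, coeff_monomial, finSuccEquiv_coeff_coeff]
  by_cases hk : k < r + 1
  · rw [Finset.sum_eq_single (⟨k, hk⟩ : Fin (r+1))]
    · simp
    · intro b _ hb
      rw [if_neg, mul_zero]
      intro h
      have := DFunLike.congr_fun h 0
      simp at this
      exact hb (Fin.ext this)
    · simp
  · have h0 : coeff (J.cons k) P = 0 := by
      by_contra hne
      have h2 := (degreeOf_le_iff.mp hr) (J.cons k) (mem_support_iff.mpr hne)
      simp at h2; omega
    rw [h0]; symm
    apply Finset.sum_eq_zero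
    intro b _
    rw [if_neg, mul_zero]
    intro h
    have := DFunLike.congr_fun h 0
    simp at this
    have := b.2; omega

/-- representability with `l` terms -/
def TRep {m : ℕ} (P : MvPolynomial (Fin (m+1)) ℝ) (l : ℕ) : Prop :=
  ∃ (φ : Fin l → MvPolynomial (Fin m) ℝ) (ψ : Fin l → MvPolynomial (Fin 1) ℝ),
      P = ∑ j, tens (φ j) (ψ j)

lemma tens_add_left {m : ℕ} (a b : MvPolynomial (Fin m) ℝ) (ψ : MvPolynomial (Fin 1) ℝ) :
    tens (a + b) ψ = tens a ψ + tens b ψ := by simp [tens, add_mul]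
lemma tens_add_right {m : ℕ} (a : MvPolynomial (Fin m) ℝ) (ψ ψ' : MvPolynomial (Fin 1) ℝ) :
    tens a (ψ + ψ') = tens a ψ + tens a ψ' := by simp [tens, mul_add]
lemma tens_smul_left {m : ℕ} (c : ℝ) (a : MvPolynomial (Fin m) ℝ) (ψ : MvPolynomial (Fin 1) ℝ) :
    tens (c • a) ψ = c • tens a ψ := by simp [tens]
lemma tens_smul_right {m : ℕ} (c : ℝ) (a : MvPolynomial (Fin m) ℝ) (ψ : MvPolynomial (Fin 1) ℝ) :
    tens a (c • ψ) = c • tens a ψ := by simp [tens]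
lemma tens_sum_left {m : ℕ} {ι : Type*} (s : Finset ι) (a : ι → MvPolynomial (Fin m) ℝ)
    (ψ : MvPolynomial (Fin 1) ℝ) :
    tens (∑ i ∈ s, a i) ψ = ∑ i ∈ s, tens (a i) ψ := by simp [tens, Finset.sum_mul]
lemma tens_sum_right {m : ℕ} {ι : Type*} (s : Finset ι) (a : MvPolynomial (Fin m) ℝ)
    (ψ : ι → MvPolynomial (Fin 1) ℝ) :
    tens a (∑ i ∈ s, ψ i) = ∑ i ∈ s, tens a (ψ i) := by simp [tens, Finset.mul_sum]

lemma solve_dep {V : Type*} [AddCommGroup V] [Module ℝ V] {l : ℕ} (φ : Fin (l+1) → V)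
    (h : ¬ LinearIndependent ℝ φ) : ∃ (i : Fin (l+1)) (c : Fin l → ℝ),
      φ i = ∑ j, c j • φ (i.succAbove j) := by
  rw [Fintype.linearIndependent_iff] at h
  push Not at h
  obtain ⟨g, hg, i, hi⟩ := h
  refine ⟨i, fun j => - (g (i.succAbove j) / g i), ?_⟩
  rw [Fin.sum_univ_succAbove _ i] at hg
  have h1 : g i • φ i = - ∑ j, g (i.succAbove j) • φ (i.succAbove j) := eq_neg_of_add_eq_zero_left hg
  have h2 : φ i = (g i)⁻¹ • (g i • φ i) := by rw [smul_smul, inv_mul_cancel₀ hi, one_smul]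
  rw [h2, h1, smul_neg, Finset.smul_sum, ← Finset.sum_neg_distrib]
  apply Finset.sum_congr rfl
  intro j _
  rw [smul_smul, neg_smul, div_eq_inv_mul]

lemma min_rep {m : ℕ} (P : MvPolynomial (Fin (m+1)) ℝ) (hP : P ≠ 0) (r : ℕ)
    (hr : degreeOf 0 P ≤ r) : ∃ l, 1 ≤ l ∧ l ≤ r + 1 ∧ 
    ∃ (φ : Fin l → MvPolynomial (Fin m) ℝ) (ψ : Fin l → MvPolynomial (Fin 1) ℝ),
      P = ∑ j, tens (φ j) (ψ j) ∧ LinearIndependent ℝ φ ∧ LinearIndependent ℝ ψ := by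
  classical
  have hex : ∃ l, TRep P l := ⟨r + 1, exists_rep P r hr⟩
  obtain ⟨φ, ψ, h⟩ := Nat.find_spec hex
  have hmin : ∀ l, TRep P l → Nat.find hex ≤ l := fun l hl => Nat.find_min' hex hl
  have hle := hmin _ (exists_rep P r hr)
  generalize Nat.find hex = l at *
  have h1 : 1 ≤ l := by
    rcases Nat.eq_zero_or_pos l with rfl | h2
    · simp at h; exact absurd h hP
    · exact h2
  obtain ⟨l, rfl⟩ : ∃ l', l = l' + 1 := ⟨l - 1, by omega⟩
  refine ⟨l + 1, h1, hle, φ, ψ, h, ?_, ?_⟩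
  · by_contra hd
    obtain ⟨i, c, hc⟩ := solve_dep φ hd
    have : TRep P l := by
      refine ⟨fun j => φ (i.succAbove j), fun j => c j • ψ i + ψ (i.succAbove j), ?_⟩
      rw [h, Fin.sum_univ_succAbove _ i, hc, tens_sum_left, ← Finset.sum_add_distrib]
      apply Finset.sum_congr rfl
      intro j _
      rw [tens_add_right, tens_smul_left, tens_smul_right]
    have := hmin _ this
    omega
  · by_contra hd
    obtain ⟨i, c, hc⟩ := solve_dep ψ hd
    have : TRep P l := by
      refine ⟨fun j => c j • φ i + φ (i.succAbove j), fun j => ψ (i.succAbove j), ?_⟩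
      rw [h, Fin.sum_univ_succAbove _ i, hc, tens_sum_right, ← Finset.sum_add_distrib]
      apply Finset.sum_congr rfl
      intro j _
      rw [tens_add_left, tens_smul_left, tens_smul_right]
    have := hmin _ this
    omega

end

section
open MvPolynomial

/-- to univariate polynomials -/
noncomputable def toUni (R : Type*) [CommRing R] : MvPolynomial (Fin 1) R →ₐ[R] Polynomial R :=
  aeval (fun _ => Polynomial.X)

lemma toUni_coeff {R : Type*} [CommRing R] (F : MvPolynomial (Fin 1) R) (k : ℕ) :
    (toUni R F).coeff k = coeff (Finsupp.single 0 k) F := by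
  classical
  induction F using MvPolynomial.induction_on' with
  | add p q hp hq => rw [map_add, Polynomial.coeff_add, hp, hq, coeff_add]
  | monomial B d =>
    have hB : B = Finsupp.single 0 (B 0) := by ext; simp
    rw [hB, toUni, aeval_monomial, coeff_monomial]
    simp only [Finsupp.prod_single_index, pow_zero, Polynomial.algebraMap_eq,
      Polynomial.coeff_C_mul, Polynomial.coeff_X_pow]
    by_cases h : k = B 0
    · subst h; simp
    · rw [if_neg h, if_neg]
      · simp
      · intro h2
        have := DFunLike.congr_fun h2 0
        simp at this
        exact h this.symm

lemma order_uni (V : MvPolynomial (Fin 1) ℝ) (hV : V ≠ 0) (hintC : IntCoef V)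
    (p : ℤ) (q : ℕ) (hq : 0 < q) (hpq : IsCoprime p (q : ℤ)) :
    ∃ k, coeff (Finsupp.single 0 k) (shiftP (fun _ => (p : ℝ) / q) V) ≠ 0 ∧ (q : ℝ) ^ k ≤ L1 V := by
  classical
  obtain ⟨G, hG⟩ := (intCoef_iff V).mp hintC
  set f := toUni ℤ G with hf
  have hfV : f.map (Int.castRingHom ℝ) = toUni ℝ V := by
    ext k
    rw [Polynomial.coeff_map, hf, toUni_coeff, toUni_coeff, ← hG, coeff_map]
  have hsh : toUni ℝ (shiftP (fun _ => (p : ℝ) / q) V) =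
      (toUni ℝ V).comp (Polynomial.X + Polynomial.C ((p : ℝ)/q)) := by
    have : (toUni ℝ).comp (shiftP (fun _ => (p : ℝ) / q)) =
        (Polynomial.aeval (Polynomial.X + Polynomial.C ((p : ℝ)/q))).comp (toUni ℝ) := by
      ext i : 1; simp [toUni, shiftP]
    have h2 := DFunLike.congr_fun this V
    rw [AlgHom.comp_apply, AlgHom.comp_apply] at h2
    rw [h2, Polynomial.comp, Polynomial.aeval_def]; rfl
  have hVu : toUni ℝ V ≠ 0 := by
    intro h
    apply hV
    ext J
    have hJ : J = Finsupp.single 0 (J 0) := by ext; simp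
    rw [hJ, ← toUni_coeff, h]; simp
  have hne : toUni ℝ (shiftP (fun _ => (p : ℝ) / q) V) ≠ 0 := by
    rw [hsh]
    intro h
    apply hVu
    have := congrArg (fun g => Polynomial.comp g (Polynomial.X - Polynomial.C ((p : ℝ)/q))) h
    simpa [Polynomial.comp_assoc] using this
  set T := toUni ℝ (shiftP (fun _ => (p : ℝ) / q) V) with hT
  refine ⟨T.natTrailingDegree, ?_, ?_⟩
  · rw [← toUni_coeff]
    exact fun h => hne (Polynomial.trailingCoeff_eq_zero.mp h)
  set k := T.natTrailingDegree with hk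
  have hdvd : Polynomial.X ^ k ∣ T := by
    rw [Polynomial.X_pow_dvd_iff]
    intro d hd
    exact Polynomial.coeff_eq_zero_of_lt_natTrailingDegree hd
  have hq0 : (q : ℝ) ≠ 0 := by positivity
  have hdvd2 : ((Polynomial.C (q:ℤ) * Polynomial.X - Polynomial.C p) ^ k).map (Int.castRingHom ℝ) ∣
      f.map (Int.castRingHom ℝ) := by
    rw [hfV]
    obtain ⟨S, hS⟩ := hdvd
    have h1 := congrArg (fun g => Polynomial.comp g (Polynomial.X - Polynomial.C ((p : ℝ)/q))) hS
    simp only [hsh, Polynomial.comp_assoc, Polynomial.mul_comp, Polynomial.pow_comp,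
      Polynomial.X_comp, Polynomial.add_comp, Polynomial.C_comp, sub_add_cancel,
      Polynomial.comp_X] at h1
    have h2 : (((Polynomial.C (q:ℤ) * Polynomial.X - Polynomial.C p) ^ k).map (Int.castRingHom ℝ)) =
        Polynomial.C ((q:ℝ)^k) * (Polynomial.X - Polynomial.C ((p : ℝ)/q)) ^ k := by
      rw [Polynomial.C_pow, ← mul_pow, mul_sub, ← Polynomial.C_mul, mul_div_cancel₀ _ hq0]
      simp
    rw [h2, h1]
    refine ⟨Polynomial.C (((q:ℝ)^k)⁻¹) * S.comp (Polynomial.X - Polynomial.C ((p : ℝ)/q)), ?_⟩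
    have h3 : (Polynomial.C ((q:ℝ)^k) * Polynomial.C (((q:ℝ)^k)⁻¹) : Polynomial ℝ) = 1 := by
      rw [← Polynomial.C_mul, mul_inv_cancel₀ (pow_ne_zero _ hq0), Polynomial.C_1]
    linear_combination (-((Polynomial.X - Polynomial.C ((p : ℝ)/q)) ^ k * S.comp (Polynomial.X - Polynomial.C ((p : ℝ)/q)))) * h3
  have hprim : (Polynomial.C (q:ℤ) * Polynomial.X - Polynomial.C p).IsPrimitive := by
    intro c hc
    rw [Polynomial.C_dvd_iff_dvd_coeff] at hc
    have h0 := hc 0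
    have h1 := hc 1
    simp only [Polynomial.coeff_sub, Polynomial.coeff_C_mul, Polynomial.coeff_X, Polynomial.coeff_C] at h0 h1
    norm_num at h0 h1
    exact hpq.isUnit_of_dvd' h0 h1
  have hprimk : ((Polynomial.C (q:ℤ) * Polynomial.X - Polynomial.C p) ^ k).IsPrimitive := by
    clear_value k
    clear hdvd2 hdvd hk
    induction k with
    | zero => rw [pow_zero]; exact Polynomial.isPrimitive_one
    | succ k ih => rw [pow_succ]; exact ih.mul hprim
  have hcast : ∀ g : Polynomial ℤ, g.map (Int.castRingHom ℝ) =
      (g.map (Int.castRingHom ℚ)).map (algebraMap ℚ ℝ) := by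
    intro g; rw [Polynomial.map_map]; congr 1
  rw [hcast, hcast, Polynomial.map_dvd_map', ← Polynomial.IsPrimitive.Int.dvd_iff_map_cast_dvd_map_cast _ _ hprimk] at hdvd2
  obtain ⟨S, hS⟩ := hdvd2
  have hf0 : f ≠ 0 := by
    intro h; apply hVu; rw [← hfV, h]; simp
  have hlead : f.leadingCoeff = (q:ℤ)^k * S.leadingCoeff := by
    rw [hS, Polynomial.leadingCoeff_mul, Polynomial.leadingCoeff_pow]
    congr 2
    rw [sub_eq_add_neg, ← Polynomial.C_neg]
    exact Polynomial.leadingCoeff_linear (by exact_mod_cast hq.ne')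
  have hS0 : S.leadingCoeff ≠ 0 := by
    intro h; rw [h, mul_zero] at hlead
    exact hf0 (Polynomial.leadingCoeff_eq_zero.mp hlead)
  have h5 : (q:ℝ)^k ≤ |(f.leadingCoeff : ℝ)| := by
    rw [hlead]; push_cast; rw [abs_mul, abs_of_nonneg (by positivity : (0:ℝ) ≤ (q:ℝ)^k)]
    have : (1:ℝ) ≤ |(S.leadingCoeff : ℝ)| := by exact_mod_cast Int.one_le_abs hS0
    exact le_mul_of_one_le_right (by positivity) this
  refine h5.trans ?_
  have h6 := wL1_coeff absSN (ρ := fun _ : Fin 1 => (1:ℝ)) (fun _ => zero_le_one) V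
    (Finsupp.single 0 f.natDegree)
  rw [monW_one, mul_one, ← toUni_coeff, ← hfV, Polynomial.coeff_map] at h6
  exact h6

section detb
variable {m l : ℕ} (M : Matrix (Fin l) (Fin l) (MvPolynomial (Fin m) ℝ))

lemma intCoef_det (h : ∀ i j, IntCoef (M i j)) : IntCoef M.det := by
  choose G hG using fun i j => (intCoef_iff (M i j)).mp (h i j)
  rw [intCoef_iff]
  refine ⟨(Matrix.of G).det, ?_⟩
  rw [RingHom.map_det]
  congr 1
  ext i j : 2
  simp [hG]

lemma sign_eq_C (s : Equiv.Perm (Fin l)) :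
    (((Equiv.Perm.sign s : ℤˣ) : ℤ) : MvPolynomial (Fin m) ℝ) = C (((Equiv.Perm.sign s : ℤˣ) : ℤ) : ℝ) := by
  simp

lemma L1_det (B : ℝ) (h : ∀ i j, L1 (M i j) ≤ B) : L1 M.det ≤ (l.factorial : ℝ) * B ^ l := by
  rw [Matrix.det_apply', L1]
  have h1 : ∀ _ : Fin m, (0:ℝ) ≤ 1 := fun _ => zero_le_one
  refine (wL1_sum absSN h1 _ _).trans ?_
  have : ∀ s ∈ (Finset.univ : Finset (Equiv.Perm (Fin l))),
      wL1 absSN (fun _ => 1) ((((Equiv.Perm.sign s : ℤˣ) : ℤ) : MvPolynomial (Fin m) ℝ) * ∏ i, M (s i) i) ≤ B ^ l := by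
    intro s _
    refine (wL1_mul absSN h1 _ _).trans ?_
    have e : wL1 absSN (fun _ => 1) (((Equiv.Perm.sign s : ℤˣ) : ℤ) : MvPolynomial (Fin m) ℝ) = 1 := by
      rw [sign_eq_C, wL1_C]
      simp only [absSN]
      rcases Int.units_eq_one_or (Equiv.Perm.sign s) with h | h <;> rw [h] <;> simp
    rw [e, one_mul]
    refine (wL1_prod absSN h1 _ _).trans ?_
    refine (Finset.prod_le_prod (fun i _ => wL1_nonneg absSN h1 _) (fun i _ => h (s i) i)).trans ?_
    simp
  refine (Finset.sum_le_sum this).trans ?_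
  simp [Fintype.card_perm]

lemma degreeOf_det (i : Fin m) (r : ℕ) (h : ∀ a b, degreeOf i (M a b) ≤ r) :
    degreeOf i M.det ≤ l * r := by
  rw [Matrix.det_apply']
  refine (degreeOf_sum_le _ _ _).trans ?_
  apply Finset.sup_le
  intro s _
  rw [sign_eq_C]
  refine (degreeOf_C_mul_le _ _ _).trans ((degreeOf_prod_le _ _ _).trans ?_)
  refine (Finset.sum_le_sum (fun j _ => h (s j) j)).trans ?_
  simp

lemma wtJ_add (r : Fin m → ℕ) (J K : Fin m →₀ ℕ) : wtJ r (J + K) = wtJ r J + wtJ r K := by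
  simp [wtJ, add_div, Finset.sum_add_distrib]

lemma wtJ_nonneg (r : Fin m → ℕ) (J : Fin m →₀ ℕ) : 0 ≤ wtJ r J :=
  Finset.sum_nonneg fun i _ => by positivity

lemma vanish_mul {r : Fin m → ℕ} {a b : ℝ} {F G : MvPolynomial (Fin m) ℝ}
    (hF : Vanish r a F) (hG : Vanish r b G) : Vanish r (a + b) (F * G) := by
  classical
  intro J hJ
  rw [coeff_mul]
  apply Finset.sum_eq_zero
  rintro ⟨A, B⟩ hAB
  have hAB : A + B = J := by simpa using hAB
  rw [← hAB, wtJ_add] at hJ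
  rcases lt_or_ge (wtJ r A) a with h | h
  · simp [hF A h]
  · simp [hG B (by linarith)]

lemma vanish_prod {r : Fin m → ℕ} {ι : Type*} (s : Finset ι) (a : ι → ℝ) (F : ι → MvPolynomial (Fin m) ℝ)
    (hF : ∀ i ∈ s, Vanish r (a i) (F i)) : Vanish r (∑ i ∈ s, a i) (∏ i ∈ s, F i) := by
  classical
  induction s using Finset.induction_on with
  | empty => intro J hJ; simp at hJ; exact absurd hJ (not_lt.mpr (wtJ_nonneg r J))
  | insert i s hi ih =>
    rw [Finset.sum_insert hi, Finset.prod_insert hi]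
    exact vanish_mul (hF i (Finset.mem_insert_self _ _)) (ih fun j hj => hF j (Finset.mem_insert_of_mem hj))

lemma vanish_det {r : Fin m → ℕ} (a : Fin l → ℝ) (h : ∀ i j, Vanish r (a j) (M i j)) :
    Vanish r (∑ j, a j) M.det := by
  intro J hJ
  rw [Matrix.det_apply', coeff_sum]
  apply Finset.sum_eq_zero
  intro s _
  rw [sign_eq_C, coeff_C_mul, vanish_prod Finset.univ a (fun i => M (s i) i) (fun i _ => h _ i) J hJ, mul_zero]

lemma vanish_hasse {r : Fin m → ℕ} {a : ℝ} {F : MvPolynomial (Fin m) ℝ} (I : Fin m →₀ ℕ)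
    (hF : Vanish r a F) : Vanish r (a - wtJ r I) (hasse I F) := by
  intro J hJ
  rw [coeff_hasse, hF (J + I) (by rw [wtJ_add]; linarith), zero_mul]

lemma vanish_max {r : Fin m → ℕ} {a b : ℝ} {F : MvPolynomial (Fin m) ℝ}
    (hF : Vanish r a F) (h : b ≤ a) : Vanish r (max 0 b) F := by
  intro J hJ
  rcases lt_max_iff.mp hJ with h1 | h1
  · exact absurd h1 (not_lt.mpr (wtJ_nonneg r J))
  · exact hF J (by linarith)

lemma intCoef_hasse (I : Fin m →₀ ℕ) {F : MvPolynomial (Fin m) ℝ} (hF : IntCoef F) :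
    IntCoef (hasse I F) := by
  intro J
  obtain ⟨z, hz⟩ := hF (J + I)
  exact ⟨z * mchoose (J + I) I, by rw [coeff_hasse, hz]; push_cast; ring⟩

lemma degreeOf_hasse (I : Fin m →₀ ℕ) (F : MvPolynomial (Fin m) ℝ) (i : Fin m) (r : ℕ)
    (h : degreeOf i F ≤ r) : degreeOf i (hasse I F) ≤ r := by
  rw [degreeOf_le_iff] at h ⊢
  intro J hJ
  rw [mem_support_iff, coeff_hasse] at hJ
  have := h (J + I) (mem_support_iff.mpr (left_ne_zero_of_mul hJ))
  simp at this; omega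

lemma L1_hasse (I : Fin m →₀ ℕ) (F : MvPolynomial (Fin m) ℝ) (r : Fin m → ℕ)
    (h : ∀ i, degreeOf i F ≤ r i) : L1 (hasse I F) ≤ 2 ^ (∑ i, r i) * L1 F := by
  classical
  have h1 : ∀ _ : Fin m, (0:ℝ) ≤ 1 := fun _ => zero_le_one
  conv_lhs => rw [F.as_sum, map_sum]
  refine (wL1_sum absSN h1 _ _).trans ?_
  rw [L1, wL1, Finset.mul_sum]
  apply Finset.sum_le_sum
  intro J hJ
  rw [hasse_monomial, wL1_monomial, monW_one, monW_one, mul_one, mul_one]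
  simp only [absSN]
  rw [abs_mul, mul_comm, Nat.abs_cast]
  apply mul_le_mul_of_nonneg_right _ (abs_nonneg _)
  have : mchoose J I ≤ 2 ^ (∑ i, r i) := by
    unfold mchoose
    rw [← Finset.prod_pow_eq_pow_sum]
    apply Finset.prod_le_prod' 
    intro i _
    exact (Nat.choose_le_two_pow _ _).trans (Nat.pow_le_pow_right (by norm_num) (degreeOf_le_iff.mp (h i) J hJ))
  exact_mod_cast this

end detb

end

section
open MvPolynomial

lemma L1_slice {σ τ : Type*} (F : MvPolynomial σ ℝ) (W : MvPolynomial τ ℝ)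
    (g : (σ →₀ ℕ) → (τ →₀ ℕ)) (hg : Function.Injective g) (h : ∀ J, coeff J F = coeff (g J) W) :
    L1 F ≤ L1 W := by
  classical
  have e1 : L1 F = ∑ J ∈ F.support, |coeff J F| := by
    unfold L1 wL1; simp [monW_one, absSN]
  have e2 : L1 W = ∑ J ∈ W.support, |coeff J W| := by
    unfold L1 wL1; simp [monW_one, absSN]
  rw [e1, e2]
  calc _ = ∑ J ∈ F.support.image g, |coeff J W| := by
        rw [Finset.sum_image (fun a _ b _ hab => hg hab)]
        exact Finset.sum_congr rfl fun J _ => by rw [h]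
    _ ≤ _ := by
        apply Finset.sum_le_sum_of_subset_of_nonneg
        · intro J hJ
          obtain ⟨K, hK, rfl⟩ := Finset.mem_image.mp hJ
          rw [mem_support_iff] at hK ⊢
          rwa [← h]
        · intros; positivity

lemma sum_max_bound (e : ℝ) (he : 0 < e) (he1 : e ≤ 1) (r l : ℕ) (hr : 1 ≤ r) (hl : l ≤ r + 1) (K : Fin l → ℕ)
    (hK : ∀ k, K k ≤ k) : (l : ℝ) * (e ^ 2 / 8) ≤ ∑ k, max 0 (e - (K k : ℝ) / r) := by
  classical
  have hr0 : (0:ℝ) < r := by exact_mod_cast hr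
  set s := Finset.univ.filter (fun k : Fin l => (k : ℝ) ≤ e * r / 2) with hs
  have h1 : ∀ k ∈ s, e / 2 ≤ max 0 (e - (K k : ℝ) / r) := by
    intro k hk
    apply le_max_of_le_right
    have h2 : (k : ℝ) ≤ e * r / 2 := (Finset.mem_filter.mp hk).2
    have h3 : (K k : ℝ) ≤ k := by exact_mod_cast hK k
    have : (K k : ℝ) / r ≤ e / 2 := by rw [div_le_iff₀ hr0]; linarith
    linarith
  have h2 : (l : ℝ) * e / 4 ≤ s.card := by
    by_cases hc : (l : ℝ) ≤ e * r / 2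
    · have : s = Finset.univ := by
        apply Finset.filter_true_of_mem
        intro k _
        have : (k : ℝ) ≤ l := by exact_mod_cast k.2.le
        linarith
      rw [this]; simp
      have : (0:ℝ) ≤ l := by positivity
      nlinarith
    · push Not at hc
      have hsub : (Finset.univ : Finset (Fin (⌊e * r / 2⌋₊ + 1))).card ≤ s.card := by
        have hfl : ⌊e * r / 2⌋₊ < l := by
          rw [Nat.floor_lt (by positivity)]; exact hc
        apply Finset.card_le_card_of_injOn (fun k => (⟨k.1, by have := k.2; omega⟩ : Fin l))
        · intro k _
          simp only [hs, Finset.coe_filter, Finset.mem_univ, true_and, Set.mem_ofPred_eq]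
          have : k.1 ≤ ⌊e * r / 2⌋₊ := by have := k.2; omega
          exact (Nat.le_floor_iff (by positivity)).mp this
        · intro a _ b _ hab
          simpa [Fin.ext_iff] using hab
      simp only [Finset.card_univ, Fintype.card_fin] at hsub
      have h4 : ((⌊e * r / 2⌋₊ + 1 : ℕ) : ℝ) ≤ s.card := by exact_mod_cast hsub
      have h5 := Nat.lt_floor_add_one (e * r / 2)
      push_cast at h4
      have h6 : (l : ℝ) ≤ 2 * r := by
        have : (l : ℝ) ≤ r + 1 := by exact_mod_cast hl
        have : (1:ℝ) ≤ r := by exact_mod_cast hr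
        linarith
      nlinarith
  calc (l : ℝ) * (e ^ 2 / 8) = (l * e / 4) * (e / 2) := by ring
    _ ≤ s.card * (e / 2) := by apply mul_le_mul_of_nonneg_right h2; positivity
    _ = ∑ k ∈ s, e / 2 := by simp
    _ ≤ ∑ k ∈ s, max 0 (e - (K k : ℝ) / r) := Finset.sum_le_sum h1
    _ ≤ _ := Finset.sum_le_sum_of_subset_of_nonneg (Finset.subset_univ _) (fun _ _ _ => le_max_left _ _)

/-- the statement of Roth's lemma in `m` variables -/
def RLProp (m : ℕ) (ε ω C0 : ℝ) : Prop :=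
  ∀ (r : Fin m → ℕ) (p : Fin m → ℤ) (q : Fin m → ℕ) (Z : ℝ) (P : MvPolynomial (Fin m) ℝ),
    (∀ h, 1 ≤ r h) → (∀ i j, i < j → (r i : ℝ) ≤ ω * r j) → (∀ h, 0 < q h) →
    (∀ h, IsCoprime (p h) (q h : ℤ)) → (∀ h, Z ≤ (q h : ℝ) ^ (r h)) → C0 ^ (∑ h, r h) ≤ Z →
    P ≠ 0 → IntCoef P → (∀ h, degreeOf h P ≤ r h) → L1 P ≤ Z ^ ω →
    ¬ Vanish r ε (shiftP (fun h => (p h : ℝ) / q h) P)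

lemma roth_step (m : ℕ) (ε : ℝ) (hε : 0 < ε) (hε1 : ε ≤ 1) (ω' C0' : ℝ) (hω' : 0 < ω') (hω'1 : ω' ≤ 1)
    (hC0' : 2 ≤ C0') (ih : RLProp m (ε ^ 2 / 100) ω' C0') :
    RLProp (m+1) ε (min (ω'/2) (ε^2/400)) (max C0' ((4:ℝ) ^ (1 / (min (ω'/2) (ε^2/400))))) := by
  classical
  set ω := min (ω'/2) (ε^2/400) with hωdef
  have hω : 0 < ω := by rw [hωdef]; positivity
  have hωa : 2 * ω ≤ ω' := by have := min_le_left (ω'/2) (ε^2/400); linarith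
  have hωb : ω ≤ ε^2/400 := min_le_right _ _
  set C0 := max C0' ((4:ℝ) ^ (1 / ω)) with hC0
  intro r p q Z P hr hrr hq hpq hZ hCZ hP hintC hdeg hL1 hvan
  have hC0pos : 1 ≤ C0 := le_trans (by linarith) (le_max_left _ _)
  have hC02 : 2 ≤ C0 := le_trans hC0' (le_max_left _ _)
  have hZ1 : 1 ≤ Z := le_trans (one_le_pow₀ hC0pos) hCZ
  have hZ0 : 0 < Z := by linarith
  have h4 : (4:ℝ) ^ (∑ h, r h) ≤ Z ^ ω := by
    have h1 : (4:ℝ) ≤ C0 ^ ω := by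
      calc (4:ℝ) = ((4:ℝ) ^ (1/ω)) ^ ω := by
            rw [← Real.rpow_mul (by norm_num), one_div, inv_mul_cancel₀ hω.ne', Real.rpow_one]
        _ ≤ C0 ^ ω := Real.rpow_le_rpow (by positivity) (le_max_right _ _) hω.le
    calc (4:ℝ) ^ (∑ h, r h) ≤ (C0 ^ ω) ^ (∑ h, r h) := pow_le_pow_left₀ (by norm_num) h1 _
      _ = (C0 ^ (∑ h, r h)) ^ ω := by
          rw [← Real.rpow_natCast, ← Real.rpow_mul (by linarith), mul_comm, Real.rpow_mul (by linarith), Real.rpow_natCast]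
      _ ≤ Z ^ ω := Real.rpow_le_rpow (by positivity) hCZ hω.le
  obtain ⟨l, hl1, hl, φ, ψ, hPrep, hφ, hψ⟩ := min_rep P hP (r 0) (hdeg 0)
  obtain ⟨I, hI, hU⟩ := genWronskian l φ hφ
  obtain ⟨K, hK, hV⟩ := genWronskian l ψ hψ
  set U := (Matrix.of fun i j => hasse (I i) (φ j)).det with hUdef
  set V := (Matrix.of fun i j => hasse (K i) (ψ j)).det with hVdef
  set M : Matrix (Fin l) (Fin l) (MvPolynomial (Fin (m+1)) ℝ) :=
    Matrix.of fun i k => hasse ((I i).cons (K k 0)) P with hM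
  set W := M.det with hW
  have hKs : ∀ k, K k = Finsupp.single 0 (K k 0) := by intro k; ext; simp
  have hK' : ∀ k, K k 0 ≤ k := by
    intro k
    have := hK k
    rw [hKs k, Finsupp.degree_single] at this
    exact this
  have hWUV : W = tens U V := by
    have h1 : M = (((Matrix.of fun i j => hasse (I i) (φ j))).map (rename Fin.succ : MvPolynomial (Fin m) ℝ →ₐ[ℝ] MvPolynomial (Fin (m+1)) ℝ)) *
       (((Matrix.of fun i j => hasse (K i) (ψ j))).map (rename (fun _ : Fin 1 => (0 : Fin (m+1))) : MvPolynomial (Fin 1) ℝ →ₐ[ℝ] MvPolynomial (Fin (m+1)) ℝ)).transpose := by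
      ext i k : 2
      rw [Matrix.mul_apply]
      simp only [hM, Matrix.of_apply, Matrix.map_apply, Matrix.transpose_apply]
      rw [hPrep, map_sum]
      congr 1
      apply Finset.sum_congr rfl
      intro j _
      rw [hasse_tens, tens]
      rw [← hKs k]
    rw [hW, h1, Matrix.det_mul, Matrix.det_transpose, ← AlgHom.mapMatrix_apply, ← AlgHom.mapMatrix_apply,
      ← AlgHom.map_det, ← AlgHom.map_det, tens]
  have hWint : IntCoef W := intCoef_det _ fun i k => intCoef_hasse _ hintC
  have hWdeg : ∀ i, degreeOf i W ≤ l * r i := fun i =>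
    degreeOf_det _ i _ fun a b => degreeOf_hasse _ _ _ _ (hdeg i)
  have hsumr : r 0 ≤ ∑ h, r h := Finset.single_le_sum (f := r) (fun _ _ => Nat.zero_le _) (Finset.mem_univ 0)
  have hWL1 : L1 W ≤ (Z ^ l) ^ (2 * ω) := by
    have h1 : L1 W ≤ (l.factorial : ℝ) * (2 ^ (∑ i, r i) * L1 P) ^ l :=
      L1_det M _ fun i j => L1_hasse _ _ _ hdeg
    have h2 : (l.factorial : ℝ) ≤ (2 ^ (∑ i, r i)) ^ l := by
      have h3 : l ≤ 2 ^ (∑ i, r i) :=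
        hl.trans ((Nat.lt_two_pow_self (n := r 0)).trans_le (Nat.pow_le_pow_right (by norm_num) hsumr))
      have : l.factorial ≤ (2 ^ (∑ i, r i)) ^ l := (Nat.factorial_le_pow l).trans (Nat.pow_le_pow_left h3 l)
      exact_mod_cast this
    have h0 : 0 ≤ L1 P := wL1_nonneg _ (fun _ => zero_le_one) _
    calc L1 W ≤ (2 ^ (∑ i, r i)) ^ l * (2 ^ (∑ i, r i) * L1 P) ^ l :=
          h1.trans (mul_le_mul_of_nonneg_right h2 (by positivity))
      _ = (4 ^ (∑ i, r i) * L1 P) ^ l := by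
          rw [← mul_pow, ← mul_assoc, ← mul_pow]; norm_num
      _ ≤ (Z ^ ω * Z ^ ω) ^ l := by
          apply pow_le_pow_left₀ (by positivity)
          exact mul_le_mul h4 hL1 h0 (by positivity)
      _ = (Z ^ l) ^ (2 * ω) := by
          rw [← Real.rpow_add hZ0, ← Real.rpow_natCast, ← Real.rpow_mul hZ0.le, ← Real.rpow_natCast,
            ← Real.rpow_mul hZ0.le]
          congr 1; ring
  -- the factor U
  obtain ⟨k0, hk0⟩ : ∃ k, coeff (Finsupp.single 0 k) V ≠ 0 := by
    obtain ⟨J, hJ⟩ := MvPolynomial.ne_zero_iff.mp hV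
    refine ⟨J 0, ?_⟩
    have : Finsupp.single 0 (J 0) = J := by ext; simp
    rwa [this]
  obtain ⟨J0, hJ0⟩ := MvPolynomial.ne_zero_iff.mp hU
  set v0 := coeff (Finsupp.single 0 k0) V
  set u0 := coeff J0 U
  have hU'c : ∀ J, coeff J (C v0 * U) = coeff (J.cons k0) W := by
    intro J; rw [hWUV, coeff_tens, coeff_C_mul]; ring
  have hV'c : ∀ J : Fin 1 →₀ ℕ, coeff J (C u0 * V) = coeff (J0.cons (J 0)) W := by
    intro J
    have hJ : Finsupp.single 0 (J 0) = J := by ext; simp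
    rw [hWUV, coeff_tens, coeff_C_mul, hJ]
  have hU'L : L1 (C v0 * U) ≤ (Z ^ l) ^ (2 * ω) := by
    refine (L1_slice _ W (fun J => J.cons k0) ?_ hU'c).trans hWL1
    intro a b hab
    have := congrArg Finsupp.tail hab
    simpa using this
  have hV'L : L1 (C u0 * V) ≤ (Z ^ l) ^ (2 * ω) := by
    refine (L1_slice _ W (fun J => J0.cons (J 0)) ?_ hV'c).trans hWL1
    intro a b hab
    have := DFunLike.congr_fun hab 0
    simp at this
    ext; simpa using this
  have hZl : 1 ≤ Z ^ l := one_le_pow₀ hZ1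
  have hU' := ih (fun h => l * r h.succ) (fun h => p h.succ) (fun h => q h.succ) (Z ^ l) (C v0 * U)
    (fun h => Nat.one_le_iff_ne_zero.mpr (Nat.mul_ne_zero (by omega) (by have := hr h.succ; omega)))
    (by
      intro i j hij
      have := hrr i.succ j.succ (Fin.succ_lt_succ_iff.mpr hij)
      push_cast
      have h3 : (r i.succ : ℝ) ≤ ω' * r j.succ := this.trans (mul_le_mul_of_nonneg_right (by linarith) (by positivity))
      have h5 : (0:ℝ) ≤ l := by positivity
      nlinarith)
    (fun h => hq _) (fun h => hpq _)
    (by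
      intro h
      rw [mul_comm l, pow_mul]
      exact pow_le_pow_left₀ hZ0.le (hZ _) _)
    (by
      rw [← Finset.mul_sum, mul_comm l, pow_mul]
      apply pow_le_pow_left₀ (by positivity)
      refine le_trans ?_ hCZ
      refine (pow_le_pow_left₀ (by linarith) (le_max_left _ _) _).trans (pow_le_pow_right₀ hC0pos ?_)
      rw [Fin.sum_univ_succ]; omega)
    (mul_ne_zero (by rwa [Ne, C_eq_zero]) hU)
    (by intro J; rw [hU'c]; exact hWint _)
    (by
      intro h
      rw [degreeOf_le_iff]
      intro J hJ
      rw [mem_support_iff, hU'c] at hJ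
      have := degreeOf_le_iff.mp (hWdeg h.succ) _ (mem_support_iff.mpr hJ)
      simpa using this)
    (hU'L.trans (Real.rpow_le_rpow_of_exponent_le hZl hωa))
  unfold Vanish at hU'
  push Not at hU'
  obtain ⟨J', hJ'w, hJ'c⟩ := hU'
  rw [map_mul] at hJ'c
  have hJ'c : coeff J' (shiftP (fun h => (p h.succ : ℝ) / q h.succ) U) ≠ 0 := by
    intro h; apply hJ'c
    have : shiftP (fun h => (p h.succ : ℝ) / q h.succ) (C v0) = C v0 := by simp [shiftP]
    rw [this, coeff_C_mul, h, mul_zero]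
  -- the factor V
  obtain ⟨k, hkc, hkq⟩ := order_uni (C u0 * V) (mul_ne_zero (by rwa [Ne, C_eq_zero]) hV)
    (by intro J; rw [hV'c]; exact hWint _) (p 0) (q 0) (hq 0) (hpq 0)
  rw [map_mul] at hkc
  have hkc : coeff (Finsupp.single 0 k) (shiftP (fun _ => (p 0 : ℝ) / q 0) V) ≠ 0 := by
    intro h; apply hkc
    have : shiftP (fun _ : Fin 1 => (p 0 : ℝ) / q 0) (C u0) = C u0 := by simp [shiftP]
    rw [this, coeff_C_mul, h, mul_zero]
  have hr0 : (0:ℝ) < r 0 := by exact_mod_cast hr 0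
  have hl0 : (0:ℝ) < l := by exact_mod_cast hl1
  have hkb : (k : ℝ) / r 0 ≤ l * (2 * ω) := by
    have hq1 : (1:ℝ) < q 0 := by
      by_contra hcon
      push Not at hcon
      have h1 : (q 0 : ℝ) ^ r 0 ≤ 1 := pow_le_one₀ (by positivity) hcon
      have h2 : (2:ℝ) ≤ C0 ^ (∑ h, r h) := 
        hC02.trans (le_self_pow₀ hC0pos (by have := hr 0; omega))
      have := hZ 0
      linarith
    have h1 : (q 0 : ℝ) ^ (k : ℝ) ≤ (q 0 : ℝ) ^ ((r 0 : ℝ) * (l * (2 * ω))) := by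
      rw [Real.rpow_natCast]
      calc (q 0 : ℝ) ^ k ≤ (Z ^ l) ^ (2 * ω) := hkq.trans hV'L
        _ ≤ (((q 0 : ℝ) ^ r 0) ^ l) ^ (2 * ω) := by
            apply Real.rpow_le_rpow (by positivity) _ (by positivity)
            exact pow_le_pow_left₀ hZ0.le (hZ 0) _
        _ = _ := by
            rw [← pow_mul, ← Real.rpow_natCast, ← Real.rpow_mul (by positivity)]
            congr 1; push_cast; ring
    have h2 := (Real.rpow_le_rpow_left_iff hq1).mp h1
    rw [div_le_iff₀ hr0]; linarith
  -- vanishing of W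
  have hWv : Vanish r (∑ k, max 0 ((ε - ω) - (K k 0 : ℝ) / r 0)) (shiftP (fun h => (p h : ℝ) / q h) W) := by
    rw [hW, AlgHom.map_det]
    apply vanish_det
    intro i k
    simp only [AlgHom.mapMatrix_apply, Matrix.map_apply, hM, Matrix.of_apply]
    rw [← hasse_shift]
    refine vanish_max (vanish_hasse _ hvan) ?_
    have h1 : wtJ r ((I i).cons (K k 0)) = (K k 0 : ℝ) / r 0 + ∑ h, (I i h : ℝ) / r h.succ := by
      unfold wtJ; rw [Fin.sum_univ_succ]; simp
    have h2 : ∑ h, (I i h : ℝ) / r h.succ ≤ ω := by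
      have h3 : ∀ h ∈ (Finset.univ : Finset (Fin m)), (I i h : ℝ) / r h.succ ≤ (I i h : ℝ) * (ω / r 0) := by
        intro h _
        have := hrr 0 h.succ (Fin.succ_pos h)
        have hrh : (0:ℝ) < r h.succ := by exact_mod_cast hr h.succ
        rw [div_eq_mul_inv]
        apply mul_le_mul_of_nonneg_left _ (by positivity)
        rw [inv_eq_one_div, div_le_div_iff₀ hrh hr0]; linarith
      refine (Finset.sum_le_sum h3).trans ?_
      rw [← Finset.sum_mul]
      have h5 : ∑ h, (I i h : ℝ) ≤ r 0 := by
        have h6 : ∑ h, I i h = (I i).degree := by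
          rw [Finsupp.degree_eq_sum]
        have h7 := hI i
        have h8 := i.2
        rw [← Nat.cast_sum, h6]
        exact_mod_cast (by omega : (I i).degree ≤ r 0)
      calc _ ≤ (r 0 : ℝ) * (ω / r 0) := mul_le_mul_of_nonneg_right h5 (by positivity)
        _ = ω := by field_simp
    rw [h1]; linarith
  have hεω : ε / 2 ≤ ε - ω := by nlinarith
  have hsum := sum_max_bound (ε - ω) (by linarith) (by linarith) (r 0) l (hr 0) hl (fun k => K k 0) hK'
  have hcoef := hWv (J'.cons k) (by
    have h1 : wtJ r (J'.cons k) = (k : ℝ) / r 0 + ∑ h, (J' h : ℝ) / r h.succ := by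
      unfold wtJ; rw [Fin.sum_univ_succ]; simp
    have h2 : ∑ h, (J' h : ℝ) / r h.succ < l * (ε^2/100) := by
      have : ∑ h, (J' h : ℝ) / r h.succ = l * wtJ (fun h => l * r h.succ) J' := by
        unfold wtJ
        rw [Finset.mul_sum]
        apply Finset.sum_congr rfl
        intro h _
        push_cast
        field_simp
      rw [this]
      exact mul_lt_mul_of_pos_left hJ'w hl0
    rw [h1]
    have h3 : (l:ℝ) * (2 * ω) ≤ l * (ε^2/200) := by
      apply mul_le_mul_of_nonneg_left _ hl0.le; linarith
    have h5 : (l:ℝ) * (ε^2/32) ≤ l * ((ε-ω)^2/8) := by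
      apply mul_le_mul_of_nonneg_left _ hl0.le; nlinarith
    have h6 : 0 < (l:ℝ) * ε^2 := by positivity
    nlinarith)
  rw [hWUV, shift_tens, coeff_tens] at hcoef
  exact (mul_ne_zero hJ'c hkc) hcoef

theorem roth_lemma (m : ℕ) : ∀ ε : ℝ, 0 < ε → ε ≤ 1 → ∃ ω C0 : ℝ, 0 < ω ∧ ω ≤ 1 ∧ 2 ≤ C0 ∧
    RLProp m ε ω C0 := by
  induction m with
  | zero =>
    intro ε hε _
    refine ⟨1, 2, one_pos, le_rfl, le_rfl, ?_⟩
    intro r p q Z P _ _ _ _ _ _ hP _ _ _ hv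
    apply hP
    apply shift_injective (fun h => (p h : ℝ) / q h)
    rw [map_zero]
    ext J
    rw [coeff_zero]
    exact hv J (by simpa [wtJ] using hε)
  | succ m ih =>
    intro ε hε hε1
    obtain ⟨ω', C0', h1, h2, h3, h4⟩ := ih (ε^2/100) (by positivity) (by nlinarith)
    refine ⟨_, _, ?_, ?_, ?_, roth_step m ε hε hε1 ω' C0' h1 h2 h3 h4⟩
    · positivity
    · exact (min_le_left _ _).trans (by linarith)
    · exact h3.trans (le_max_left _ _)

end

section
open MvPolynomial

/-- linear substitution in blocks -/
noncomputable def subY {m N : ℕ} (Y : Fin m → Matrix (Fin N) (Fin N) ℝ) :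
    MvPolynomial (Fin m × Fin N) ℝ →ₐ[ℝ] MvPolynomial (Fin m × Fin N) ℝ :=
  bind₁ (fun x => ∑ k, C (Y x.1 k x.2) * X (x.1, k))

/-- block homogeneity -/
def BlockHom {m N : ℕ} (r : Fin m → ℕ) (P : MvPolynomial (Fin m × Fin N) ℝ) : Prop :=
  ∀ E ∈ P.support, ∀ h, ∑ i, E (h, i) = r h

section blocks
variable {m N : ℕ} (i0 i1 : Fin m → Fin N)

/-- the remaining exponents -/
noncomputable def restE (E : Fin m × Fin N →₀ ℕ) : Fin m × Fin N →₀ ℕ :=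
  by classical exact E.filter (fun x => x.2 ≠ i0 x.1 ∧ x.2 ≠ i1 x.1)

/-- one exponent per block -/
noncomputable def projE (E : Fin m × Fin N →₀ ℕ) : Fin m →₀ ℕ :=
  Finsupp.equivFunOnFinite.symm (fun h => E (h, i0 h))

lemma projE_apply (E : Fin m × Fin N →₀ ℕ) (h : Fin m) : projE i0 E h = E (h, i0 h) := rfl

lemma E_ext (hne : ∀ h, i0 h ≠ i1 h) (E E' : Fin m × Fin N →₀ ℕ)
    (hs : ∀ h, ∑ i, E (h, i) = ∑ i, E' (h, i)) (h1 : restE i0 i1 E = restE i0 i1 E')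
    (h2 : projE i0 E = projE i0 E') : E = E' := by
  classical
  have h3 : ∀ x : Fin m × Fin N, x.2 ≠ i1 x.1 → E x = E' x := by
    rintro ⟨h, i⟩ hx
    by_cases h0 : i = i0 h
    · subst h0; exact DFunLike.congr_fun h2 h
    · have := DFunLike.congr_fun h1 (h, i)
      simp only [restE] at this
      rw [Finsupp.filter_apply_pos, Finsupp.filter_apply_pos] at this
      · exact this
      · exact ⟨h0, hx⟩
      · exact ⟨h0, hx⟩
  ext ⟨h, i⟩
  by_cases hi : i = i1 h
  · subst hi
    have := hs h
    rw [← Finset.add_sum_erase _ _ (Finset.mem_univ (i1 h)),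
      ← Finset.add_sum_erase _ (fun i => E' (h, i)) (Finset.mem_univ (i1 h))] at this
    have h4 : ∑ x ∈ Finset.univ.erase (i1 h), E (h, x) = ∑ x ∈ Finset.univ.erase (i1 h), E' (h, x) :=
      Finset.sum_congr rfl fun x hx => h3 (h, x) (Finset.ne_of_mem_erase hx)
    omega
  · exact h3 (h, i) hi

lemma monomial_eq_prod {σ R : Type*} [Fintype σ] [CommRing R] (E : σ →₀ ℕ) :
    (monomial E 1 : MvPolynomial σ R) = ∏ x, X x ^ E x := by
  rw [monomial_eq, C_1, one_mul, Finsupp.prod_fintype]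
  simp

theorem blocks (k0 : Fin N) (ε ω C0 Z : ℝ) (RL : RLProp m ε ω C0) (r : Fin m → ℕ)
    (P : MvPolynomial (Fin m × Fin N) ℝ) (hP : P ≠ 0) (hintC : IntCoef P) (hhom : BlockHom r P)
    (mm : Fin m → Fin N → ℤ) (hne : ∀ h, i0 h ≠ i1 h) (hm0 : ∀ h, mm h (i0 h) ≠ 0)
    (Y : Fin m → Matrix (Fin N) (Fin N) ℝ) (hdet : ∀ h, (Y h).det ≠ 0)
    (hYk : ∀ h i, Y h k0 i = if i = i0 h then 1 else 0)
    (hY : ∀ h k, k ≠ k0 → ∑ i, Y h k i * (mm h i : ℝ) = 0)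
    (p : Fin m → ℤ) (q : Fin m → ℕ)
    (hpq : ∀ h, (p h : ℝ) / q h = - (mm h (i1 h) : ℝ) / mm h (i0 h))
    (hr : ∀ h, 1 ≤ r h) (hrr : ∀ i j, i < j → (r i : ℝ) ≤ ω * r j) (hq : ∀ h, 0 < q h)
    (hcop : ∀ h, IsCoprime (p h) (q h : ℤ)) (hZ : ∀ h, Z ≤ (q h : ℝ) ^ (r h))
    (hCZ : C0 ^ (∑ h, r h) ≤ Z) (hL1 : L1 P ≤ Z ^ ω) :
    ∃ E, coeff E (subY Y P) ≠ 0 ∧ ∑ h, (E (h, k0) : ℝ) / r h < ε := by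
  classical
  obtain ⟨E0, hE0, hmin⟩ := Finset.exists_min_image P.support (fun E => (restE i0 i1 E).degree)
    (support_nonempty.mpr hP)
  set I := restE i0 i1 E0 with hI
  set s := P.support.filter (fun E => restE i0 i1 E = I) with hs
  set PI : MvPolynomial (Fin m) ℝ := ∑ E ∈ s, monomial (projE i0 E) (coeff E P) with hPI
  have hPI0 : PI ≠ 0 := by
    rw [MvPolynomial.ne_zero_iff]
    refine ⟨projE i0 E0, ?_⟩
    rw [hPI, coeff_sum, Finset.sum_eq_single E0]
    · rw [coeff_monomial, if_pos rfl]; exact mem_support_iff.mp hE0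
    · intro E hE hne'
      rw [coeff_monomial, if_neg]
      intro h
      rw [hs, Finset.mem_filter] at hE
      apply hne'
      apply E_ext i0 i1 hne E E0 _ hE.2 h
      intro h; rw [hhom E hE.1, hhom E0 hE0]
    · intro h
      exact absurd (by rw [hs]; exact Finset.mem_filter.mpr ⟨hE0, hI.symm⟩) h
  have hPIint : IntCoef PI := by
    rw [intCoef_iff]
    choose z hz using hintC
    refine ⟨∑ E ∈ s, monomial (projE i0 E) (z E), ?_⟩
    rw [map_sum, hPI]
    apply Finset.sum_congr rfl
    intro E _
    rw [map_monomial, hz]; simp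
  have hPIdeg : ∀ h, degreeOf h PI ≤ r h := by
    intro h
    refine (degreeOf_sum_le _ _ _).trans ?_
    apply Finset.sup_le
    intro E hE
    rw [degreeOf_le_iff]
    intro J hJ
    have := support_monomial_subset hJ
    rw [Finset.mem_singleton] at this
    rw [this, projE_apply, ← hhom E (Finset.mem_filter.mp hE).1 h]
    exact Finset.single_le_sum (f := fun i => E (h, i)) (fun _ _ => Nat.zero_le _) (Finset.mem_univ _)
  have hPIL : L1 PI ≤ L1 P := by
    refine (wL1_sum absSN (fun _ => zero_le_one) _ _).trans ?_
    rw [L1, wL1]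
    refine le_trans ?_ (Finset.sum_le_sum_of_subset_of_nonneg
      (show s ⊆ P.support by rw [hs]; exact Finset.filter_subset _ _)
      (fun J _ _ => mul_nonneg (absSN.nonneg _) (monW_nonneg (fun _ => zero_le_one) J)))
    apply Finset.sum_le_sum
    intro E _
    rw [wL1_monomial, monW_one, monW_one]
  have hcon := RL r p q Z PI hr hrr hq hcop hZ hCZ hPI0 hPIint hPIdeg (hPIL.trans hL1)
  unfold Vanish at hcon
  push Not at hcon
  obtain ⟨J, hJw, hJc⟩ := hcon
  -- the substitution
  let S := MvPolynomial (Fin m) ℝ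
  let T := MvPolynomial (Fin m × Fin N) S
  let u : Fin m → T := fun h => C (X h + C ((p h : ℝ) / q h)) -
    ∑ i ∈ Finset.univ.filter (fun i => i ≠ i0 h ∧ i ≠ i1 h),
      C (C ((mm h i : ℝ) / mm h (i0 h))) * X (h, i)
  let v : Fin m × Fin N → T := fun x =>
    if x.2 = i0 x.1 then u x.1 else if x.2 = i1 x.1 then 1 else X x
  let κ : MvPolynomial (Fin m × Fin N) ℝ →ₐ[ℝ] T := aeval v
  have hκ : ∀ (E : Fin m × Fin N →₀ ℕ) (c : ℝ), κ (monomial E c) =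
      (C (C c) * ∏ h, u h ^ (projE i0 E h)) * monomial (restE i0 i1 E) 1 := by
    intro E c
    simp only [κ]
    rw [aeval_monomial, Finsupp.prod_fintype _ _ (by simp), mul_assoc]
    congr 1
    have e1 : ∀ x : Fin m × Fin N, v x ^ E x =
        (if x.2 = i0 x.1 then u x.1 ^ E x else 1) * X x ^ (restE i0 i1 E x) := by
      intro x
      simp only [v, restE]
      by_cases h1 : x.2 = i0 x.1
      · rw [if_pos h1, if_pos h1, Finsupp.filter_apply_neg _ _ (by simp [h1])]; simp
      · rw [if_neg h1, if_neg h1]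
        by_cases h2 : x.2 = i1 x.1
        · rw [if_pos h2, Finsupp.filter_apply_neg _ _ (by simp [h2])]; simp
        · rw [if_neg h2, Finsupp.filter_apply_pos _ _ ⟨h1, h2⟩, one_mul]
    rw [Finset.prod_congr rfl (fun x _ => e1 x), Finset.prod_mul_distrib, monomial_eq_prod]
    congr 1
    rw [Fintype.prod_prod_type]
    apply Finset.prod_congr rfl
    intro h _
    simp only [projE_apply]
    rw [Finset.prod_ite_eq' Finset.univ (i0 h) (fun i => u h ^ E (h, i))]
    simp
  have hucc : ∀ h, constantCoeff (u h) = X h + C ((p h : ℝ) / q h) := by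
    intro h
    simp only [u]
    rw [map_sub, map_sum]
    simp
  have hcoefI : coeff I (κ P) = shiftP (fun h => (p h : ℝ) / q h) PI := by
    have h1 : κ P = ∑ E ∈ P.support, κ (monomial E (coeff E P)) := by
      conv_lhs => rw [P.as_sum, map_sum]
    rw [h1, coeff_sum, hPI, map_sum, hs, Finset.sum_filter]
    apply Finset.sum_congr rfl
    intro E hE
    rw [hκ, coeff_mul_monomial', mul_one]
    have h2 := hmin E hE
    by_cases hle : restE i0 i1 E ≤ I
    · have heq : restE i0 i1 E = I := by
        obtain ⟨D, hD⟩ := exists_add_of_le hle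
        have h3 := congrArg Finsupp.degree hD
        rw [map_add] at h3
        have h4 : D.degree = 0 := by omega
        rw [(Finsupp.degree_eq_zero_iff D).mp h4, add_zero] at hD
        exact hD.symm
      rw [if_pos hle, if_pos heq, heq, tsub_self]
      have h5 : ∀ F : T, coeff 0 F = constantCoeff F := fun F => rfl
      rw [h5, map_mul, map_prod]
      simp only [map_pow, hucc, constantCoeff_C]
      rw [shiftP, aeval_monomial, Finsupp.prod_fintype _ _ (by simp)]
      rfl
    · rw [if_neg hle, if_neg]
      intro h; exact hle h.le
  -- the other factorization
  let b : Fin m × Fin N → T := fun x => ∑ i, C (C ((Y x.1)⁻¹ i x.2)) * v (x.1, i)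
  let ρ : MvPolynomial (Fin m × Fin N) ℝ →ₐ[ℝ] T := aeval b
  have hρκ : ρ.comp (subY Y) = κ := by
    apply algHom_ext
    rintro ⟨h, i⟩
    rw [AlgHom.comp_apply, subY, bind₁_X_right, map_sum]
    simp only [κ, aeval_X]
    have h1 : ∀ k, ρ (C (Y h k i) * X (h, k)) = ∑ j, C (C ((Y h)⁻¹ j k * Y h k i)) * v (h, j) := by
      intro k
      have hC : ρ (C (Y h k i)) = (C (C (Y h k i)) : T) := by
        simp only [ρ]; rw [aeval_C]; rfl
      have hX : ρ (X (h, k)) = b (h, k) := aeval_X _ _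
      rw [map_mul, hC, hX]
      show _ * (∑ i, C (C ((Y h)⁻¹ i k)) * v (h, i)) = _
      rw [Finset.mul_sum]
      apply Finset.sum_congr rfl
      intro j _
      simp only [map_mul]
      ring
    simp only [h1]
    rw [Finset.sum_comm]
    simp only [← Finset.sum_mul, ← map_sum]
    have h2 : ∀ j, ∑ k, (Y h)⁻¹ j k * Y h k i = (1 : Matrix (Fin N) (Fin N) ℝ) j i := by
      intro j
      rw [← Matrix.mul_apply, Matrix.nonsing_inv_mul _ (isUnit_iff_ne_zero.mpr (hdet h))]
    simp only [h2]
    rw [Finset.sum_eq_single i]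
    · simp
    · intro j _ hj; rw [Matrix.one_apply_ne hj]; simp
    · simp
  have hb0 : ∀ h, b (h, k0) = C (X h) := by
    intro h
    have hmne : (mm h (i0 h) : ℝ) ≠ 0 := by exact_mod_cast hm0 h
    -- inverse column
    have h1 : ∀ i, (Y h)⁻¹ i k0 = (mm h i : ℝ) / mm h (i0 h) := by
      have h2 : (Y h).mulVec (fun i => (mm h i : ℝ) / mm h (i0 h)) = Pi.single k0 1 := by
        ext k
        simp only [Matrix.mulVec, dotProduct]
        by_cases hk : k = k0
        · subst hk
          simp [hYk, hmne]
        · have := hY h k hk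
          simp only [mul_div_assoc', ← Finset.sum_div, this]
          simp [hk]
      have h3 := congrArg ((Y h)⁻¹.mulVec) h2
      rw [Matrix.mulVec_mulVec, Matrix.nonsing_inv_mul _ (isUnit_iff_ne_zero.mpr (hdet h)), Matrix.one_mulVec] at h3
      intro i
      have h4 := congrFun h3 i
      rw [Matrix.mulVec_single_one] at h4
      exact h4.symm
    simp only [b, h1]
    rw [← Finset.add_sum_erase _ _ (Finset.mem_univ (i0 h)),
      ← Finset.add_sum_erase _ _ (Finset.mem_erase.mpr ⟨(hne h).symm, Finset.mem_univ (i1 h)⟩)]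
    have h5 : (Finset.univ.erase (i0 h)).erase (i1 h) =
        Finset.univ.filter (fun i => i ≠ i0 h ∧ i ≠ i1 h) := by
      ext i; simp [and_comm]
    rw [h5]
    have h6 : ∑ x ∈ Finset.univ.filter (fun i => i ≠ i0 h ∧ i ≠ i1 h),
        C (C ((mm h x : ℝ) / mm h (i0 h))) * v (h, x) = 
        ∑ x ∈ Finset.univ.filter (fun i => i ≠ i0 h ∧ i ≠ i1 h),
        (C (C ((mm h x : ℝ) / mm h (i0 h))) * X (h, x) : T) := by
      apply Finset.sum_congr rfl
      intro i hi
      have := (Finset.mem_filter.mp hi).2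
      simp only [v]
      rw [if_neg this.1, if_neg this.2]
    rw [h6]
    have h7 : v (h, i0 h) = u h := by simp [v]
    have h8 : v (h, i1 h) = 1 := by simp [v, (hne h).symm]
    rw [h7, h8, div_self hmne]
    simp only [u]
    have h9 : (mm h (i1 h) : ℝ) / mm h (i0 h) = - ((p h : ℝ) / q h) := by
      rw [hpq]; ring
    rw [h9]
    simp only [map_add, map_neg, map_one]
    ring
  -- conclusion
  have hcJ : coeff J (coeff I (ρ (subY Y P))) ≠ 0 := by
    rw [← AlgHom.comp_apply, hρκ, hcoefI]; exact hJc
  have hexp : ρ (subY Y P) = ∑ E ∈ (subY Y P).support, ρ (monomial E (coeff E (subY Y P))) := by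
    conv_lhs => rw [(subY Y P).as_sum, map_sum]
  rw [hexp, coeff_sum, coeff_sum] at hcJ
  obtain ⟨E, hE, hne0⟩ := Finset.exists_ne_zero_of_sum_ne_zero hcJ
  refine ⟨E, mem_support_iff.mp hE, lt_of_le_of_lt ?_ hJw⟩
  unfold wtJ
  apply Finset.sum_le_sum
  intro h _
  have hle : projE (fun _ => k0) E ≤ J := by
    by_contra hnle
    apply hne0
    have hfac : ρ (monomial E (coeff E (subY Y P))) =
        C (monomial (projE (fun _ => k0) E) 1) *
          (C (C (coeff E (subY Y P))) * ∏ h, ∏ i ∈ Finset.univ.erase k0, b (h, i) ^ E (h, i)) := by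
      simp only [ρ]
      have hal : (algebraMap ℝ T) (coeff E (subY Y P)) = C (C (coeff E (subY Y P))) := rfl
      rw [aeval_monomial, Finsupp.prod_fintype _ _ (by simp), monomial_eq_prod, map_prod,
        Fintype.prod_prod_type, hal, mul_left_comm, ← Finset.prod_mul_distrib]
      congr 1
      apply Finset.prod_congr rfl
      intro h _
      rw [← Finset.mul_prod_erase _ _ (Finset.mem_univ k0), hb0, map_pow]
      rfl
    rw [hfac, coeff_C_mul, coeff_monomial_mul', if_neg hnle]
  have := hle h
  rw [projE_apply] at this
  have h2 : (E (h, k0) : ℝ) ≤ J h := by exact_mod_cast this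
  gcongr

end blocks

end

section
open MvPolynomial

lemma siegel_simple {κ β : Type} [Fintype κ] [Fintype β] [DecidableEq β] (A : Matrix κ β ℤ) (H : ℝ)
    (hH : 1 ≤ H)
    (hA : ∀ i j, |(A i j : ℝ)| ≤ H) (hc : 2 * Fintype.card κ ≤ Fintype.card β)
    (hb : 0 < Fintype.card β) :
    ∃ t : β → ℤ, t ≠ 0 ∧ A.mulVec t = 0 ∧ ∀ j, |(t j : ℝ)| ≤ Fintype.card β * H := by
  have hb1 : (1:ℝ) ≤ Fintype.card β := by exact_mod_cast hb
  rcases Nat.eq_zero_or_pos (Fintype.card κ) with h0 | h0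
  · obtain ⟨j0⟩ := Fintype.card_pos_iff.mp hb
    refine ⟨Pi.single j0 1, by simp, ?_, ?_⟩
    · have := Fintype.card_eq_zero_iff.mp h0
      exact Subsingleton.elim _ _
    · intro j
      have : |((Pi.single j0 1 : β → ℤ) j : ℝ)| ≤ 1 := by
        by_cases h : j = j0
        · subst h; simp
        · simp [h]
      nlinarith
  · obtain ⟨t, ht, htA, htn⟩ := Int.Matrix.exists_ne_zero_int_vec_norm_le A (by omega) h0
    refine ⟨t, ht, htA, fun j => ?_⟩
    have h1 : |(t j : ℝ)| ≤ ‖t‖ := by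
      have := norm_le_pi_norm t j
      rwa [Int.norm_eq_abs] at this
    refine h1.trans (htn.trans ?_)
    have hA' : max 1 ((Matrix.seminormedAddCommGroup : SeminormedAddCommGroup (Matrix κ β ℤ)).toNorm.norm A) ≤ H := by
      apply max_le hH
      rw [Matrix.norm_le_iff (by linarith)]
      intro i j
      rw [Int.norm_eq_abs]; exact hA i j
    have hca : (2:ℝ) * Fintype.card κ ≤ Fintype.card β := by exact_mod_cast hc
    have hk : (1:ℝ) ≤ Fintype.card κ := by exact_mod_cast h0
    calc _ ≤ (Fintype.card β * H : ℝ) ^ ((Fintype.card κ : ℝ) / (Fintype.card β - Fintype.card κ)) := by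
            apply Real.rpow_le_rpow (by positivity)
            · gcongr
            · apply div_nonneg <;> linarith
      _ ≤ (Fintype.card β * H : ℝ) ^ (1:ℝ) := by
            apply Real.rpow_le_rpow_of_exponent_le (by nlinarith)
            rw [div_le_one] <;> linarith
      _ = _ := Real.rpow_one _

section
attribute [local instance] Matrix.linftyOpNormedRing
lemma exists_matSN {d : ℕ} (A : Matrix (Fin d) (Fin d) ℤ) :
    ∃ n : SN (Polynomial ℤ), ∀ p i j, |((Polynomial.aeval A p i j : ℤ) : ℝ)| ≤ n.ν p := by
  let f : Polynomial ℤ →+* Matrix (Fin d) (Fin d) ℝ :=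
    ((Int.castRingHom ℝ).mapMatrix).comp (Polynomial.aeval A : Polynomial ℤ →ₐ[ℤ] _).toRingHom
  refine ⟨⟨fun p => ‖f p‖, fun _ => norm_nonneg _, by simp, ?_, ?_, ?_⟩, ?_⟩
  · rw [map_one]
    rw [Matrix.linfty_opNorm_def]
    have : ((Finset.univ : Finset (Fin d)).sup fun i => ∑ j, ‖(1 : Matrix (Fin d) (Fin d) ℝ) i j‖₊) ≤ 1 := by
      apply Finset.sup_le
      intro i _
      rw [Finset.sum_eq_single i] <;> simp +contextual [Matrix.one_apply]
      intro b hb h; exact absurd h.symm hb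
    exact_mod_cast this
  · intro x y; rw [map_add]; exact norm_add_le _ _
  · intro x y; rw [map_mul]; exact norm_mul_le _ _
  · intro p i j
    show _ ≤ ‖f p‖
    rw [Matrix.linfty_opNorm_def]
    have h1 : ‖f p i j‖₊ ≤ (Finset.univ : Finset (Fin d)).sup fun i => ∑ j, ‖f p i j‖₊ := by
      refine le_trans ?_ (Finset.le_sup (Finset.mem_univ i))
      exact Finset.single_le_sum (f := fun j => ‖f p i j‖₊) (fun _ _ => bot_le) (Finset.mem_univ j)
    have h2 : f p i j = ((Polynomial.aeval A p i j : ℤ) : ℝ) := rfl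
    rw [← h2, ← Real.norm_eq_abs]
    exact_mod_cast h1
end

/-- second moment bound -/
lemma cheb {m : ℕ} {T : Type} [DecidableEq T] (t : Fin m → Finset T) (y : Fin m → T → ℝ) (K lam : ℝ)
    (hy : ∀ h, ∀ f ∈ t h, |y h f| ≤ K) (h0 : ∀ h, ∑ f ∈ t h, y h f = 0) (hl : 0 < lam) :
    (((Fintype.piFinset t).filter (fun e => lam < ∑ h, y h (e h))).card : ℝ) * lam ^ 2 ≤
      m * K ^ 2 * (Fintype.piFinset t).card := by
  have orth : ∀ h h', h ≠ h' → ∑ e ∈ Fintype.piFinset t, y h (e h) * y h' (e h') = 0 := by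
    intro h h' hne
    have := Finset.prod_univ_sum t (fun x j => (if x = h then y h j else 1) * (if x = h' then y h' j else 1))
    have e1 : ∀ e : Fin m → T, ∏ x, ((if x = h then y h (e x) else 1) * (if x = h' then y h' (e x) else 1))
        = y h (e h) * y h' (e h') := by
      intro e
      rw [Finset.prod_mul_distrib]; simp
    simp only [e1] at this
    rw [← this]
    apply Finset.prod_eq_zero (Finset.mem_univ h)
    simp [hne, h0]
  have total : ∑ e ∈ Fintype.piFinset t, (∑ h, y h (e h)) ^ 2 ≤ m * K ^ 2 * (Fintype.piFinset t).card := by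
    have e2 : ∀ e : Fin m → T, (∑ h, y h (e h)) ^ 2 = ∑ h, ∑ h', y h (e h) * y h' (e h') := by
      intro e; rw [sq, Finset.sum_mul_sum]
    simp only [e2]
    rw [Finset.sum_comm]
    have e3 : ∀ h, ∑ e ∈ Fintype.piFinset t, ∑ h', y h (e h) * y h' (e h') ≤ K ^ 2 * (Fintype.piFinset t).card := by
      intro h
      rw [Finset.sum_comm, Finset.sum_eq_single h]
      · calc _ ≤ ∑ e ∈ Fintype.piFinset t, K ^ 2 := by
              apply Finset.sum_le_sum
              intro e he
              have := hy h (e h) (Fintype.mem_piFinset.mp he h)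
              rw [← sq]
              exact sq_le_sq' (by linarith [neg_abs_le (y h (e h))]) ((le_abs_self _).trans this)
          _ = _ := by rw [Finset.sum_const, nsmul_eq_mul]; ring
      · intro h' _ hne; exact orth h h' hne.symm
      · simp
    calc _ ≤ ∑ h : Fin m, K ^ 2 * ((Fintype.piFinset t).card : ℝ) := Finset.sum_le_sum fun h _ => e3 h
      _ = _ := by simp; ring
  refine le_trans ?_ total
  calc _ = ∑ e ∈ (Fintype.piFinset t).filter (fun e => lam < ∑ h, y h (e h)), lam ^ 2 := by
          rw [Finset.sum_const, nsmul_eq_mul]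
    _ ≤ ∑ e ∈ (Fintype.piFinset t).filter (fun e => lam < ∑ h, y h (e h)), (∑ h, y h (e h)) ^ 2 := by
          apply Finset.sum_le_sum
          intro e he
          have := (Finset.mem_filter.mp he).2
          gcongr
    _ ≤ _ := Finset.sum_le_sum_of_subset_of_nonneg (Finset.filter_subset _ _) fun _ _ _ => sq_nonneg _

lemma mean_piAntidiag (N r : ℕ) (i : Fin N) :
    (N : ℝ) * ∑ f ∈ Finset.piAntidiag (Finset.univ : Finset (Fin N)) r, (f i : ℝ) =
      r * (Finset.piAntidiag (Finset.univ : Finset (Fin N)) r).card := by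
  have sym : ∀ j, ∑ f ∈ Finset.piAntidiag (Finset.univ : Finset (Fin N)) r, (f j : ℝ) =
      ∑ f ∈ Finset.piAntidiag (Finset.univ : Finset (Fin N)) r, (f i : ℝ) := by
    intro j
    apply Finset.sum_bij' (fun f _ => f ∘ Equiv.swap i j) (fun f _ => f ∘ Equiv.swap i j)
    · intro f hf
      simp only [Finset.mem_piAntidiag, Finset.mem_univ, implies_true, and_true] at hf ⊢
      rw [← hf]
      exact Equiv.sum_comp (Equiv.swap i j) f
    · intro f hf
      simp only [Finset.mem_piAntidiag, Finset.mem_univ, implies_true, and_true] at hf ⊢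
      rw [← hf]
      exact Equiv.sum_comp (Equiv.swap i j) f
    · intro f _; ext x; simp
    · intro f _; ext x; simp
    · intro f _; simp
  calc _ = ∑ j : Fin N, ∑ f ∈ Finset.piAntidiag (Finset.univ : Finset (Fin N)) r, (f j : ℝ) := by
          simp [sym]
    _ = ∑ f ∈ Finset.piAntidiag (Finset.univ : Finset (Fin N)) r, (r : ℝ) := by
          rw [Finset.sum_comm]
          apply Finset.sum_congr rfl
          intro f hf
          simp only [Finset.mem_piAntidiag, Finset.mem_univ, implies_true, and_true] at hf
          rw [← hf]; push_cast; rfl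
    _ = _ := by rw [Finset.sum_const, nsmul_eq_mul]; ring

lemma card_piAntidiag_le (N r : ℕ) :
    (Finset.piAntidiag (Finset.univ : Finset (Fin N)) r).card ≤ 2 ^ (N * r) := by
  have : Finset.piAntidiag (Finset.univ : Finset (Fin N)) r ⊆ Fintype.piFinset (fun _ => Finset.range (r + 1)) := by
    intro f hf
    simp only [Finset.mem_piAntidiag, Finset.mem_univ, implies_true, and_true] at hf
    rw [Fintype.mem_piFinset]
    intro i
    rw [Finset.mem_range, Nat.lt_succ_iff, ← hf]
    exact Finset.single_le_sum (fun _ _ => Nat.zero_le _) (Finset.mem_univ i)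
  refine (Finset.card_le_card this).trans ?_
  simp only [Fintype.card_piFinset, Finset.card_range, Finset.prod_const, Finset.card_univ, Fintype.card_fin]
  rw [mul_comm, pow_mul]
  exact Nat.pow_le_pow_left Nat.lt_two_pow_self _

/-- few bad exponents -/
lemma bad_count {m N : ℕ} (hN : 0 < N) (r : Fin m → ℕ) (hr : ∀ h, 1 ≤ r h) (c : Fin m → Fin N → ℝ) (Cw δ : ℝ)
    (hδ : 0 < δ) (hm : 0 < m)
    (hc : ∀ h i, |c h i| ≤ Cw) (hs : ∀ h, ∑ i, c h i ≤ -δ) :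
    (((Fintype.piFinset fun h => Finset.piAntidiag (Finset.univ : Finset (Fin N)) (r h)).filter
      (fun e => -δ * m / (2 * N) < ∑ h, ∑ i, c h i * (e h i : ℝ) / r h)).card : ℝ) * (δ ^ 2 * m)
      ≤ 16 * Cw ^ 2 * N ^ 2 *
        (Fintype.piFinset fun h => Finset.piAntidiag (Finset.univ : Finset (Fin N)) (r h)).card := by
  have hN' : (0:ℝ) < N := by exact_mod_cast hN
  have hm' : (0:ℝ) < m := by exact_mod_cast hm
  have hCw : 0 ≤ Cw := (abs_nonneg _).trans (hc ⟨0, hm⟩ ⟨0, hN⟩)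
  have hr' : ∀ h, (0:ℝ) < r h := fun h => by exact_mod_cast hr h
  have hsl : ∀ h, |(∑ i, c h i) / N| ≤ Cw := by
    intro h
    rw [abs_div, abs_of_pos hN', div_le_iff₀ hN']
    calc _ ≤ ∑ i, |c h i| := Finset.abs_sum_le_sum_abs _ _
      _ ≤ ∑ i : Fin N, Cw := Finset.sum_le_sum fun i _ => hc h i
      _ = _ := by simp; ring
  have key := cheb (fun h => Finset.piAntidiag (Finset.univ : Finset (Fin N)) (r h))
    (fun h f => ∑ i, c h i * (f i : ℝ) / r h - (∑ i, c h i) / N) (2 * Cw) (δ * m / (2 * N)) ?_ ?_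
    (by positivity)
  · set Ω := Fintype.piFinset fun h => Finset.piAntidiag (Finset.univ : Finset (Fin N)) (r h)
    have hsub : Ω.filter (fun e => -δ * m / (2 * N) < ∑ h, ∑ i, c h i * (e h i : ℝ) / r h) ⊆
      Ω.filter (fun e => δ * m / (2 * N) < ∑ h, (∑ i, c h i * (e h i : ℝ) / r h - (∑ i, c h i) / N)) := by
      intro e he
      rw [Finset.mem_filter] at he ⊢
      refine ⟨he.1, ?_⟩
      rw [Finset.sum_sub_distrib]
      have : ∑ h : Fin m, (∑ i, c h i) / N ≤ ∑ h : Fin m, (-δ) / N :=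
        Finset.sum_le_sum fun h _ => by have := hs h; gcongr
      rw [Finset.sum_const, Finset.card_univ, Fintype.card_fin, nsmul_eq_mul] at this
      have h2 := he.2
      have h3 : -δ * m / (2 * N) = δ * m / (2 * N) + m * (-δ / N) := by field_simp; ring
      linarith
    have hcard := Finset.card_le_card hsub
    have hcard' : ((Ω.filter (fun e => -δ * m / (2 * N) < ∑ h, ∑ i, c h i * (e h i : ℝ) / r h)).card : ℝ) ≤
      ((Ω.filter (fun e => δ * m / (2 * N) < ∑ h, (∑ i, c h i * (e h i : ℝ) / r h - (∑ i, c h i) / N))).card : ℝ) := by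
      exact_mod_cast hcard
    have h4 : δ ^ 2 * m = (δ * m / (2 * N)) ^ 2 * (4 * N ^ 2 / m) := by field_simp; norm_num
    calc _ ≤ ((Ω.filter (fun e => δ * m / (2 * N) < ∑ h, (∑ i, c h i * (e h i : ℝ) / r h - (∑ i, c h i) / N))).card : ℝ) * (δ ^ 2 * m) := by gcongr
      _ = (((Ω.filter (fun e => δ * m / (2 * N) < ∑ h, (∑ i, c h i * (e h i : ℝ) / r h - (∑ i, c h i) / N))).card : ℝ) * (δ * m / (2 * N)) ^ 2) * (4 * N ^ 2 / m) := by rw [h4]; ring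
      _ ≤ (m * (2 * Cw) ^ 2 * Ω.card) * (4 * N ^ 2 / m) := by gcongr
      _ = _ := by field_simp; ring
  · intro h f hf
    simp only [Finset.mem_piAntidiag, Finset.mem_univ, implies_true, and_true] at hf
    have : |∑ i, c h i * (f i : ℝ) / r h| ≤ Cw := by
      calc _ ≤ ∑ i, |c h i * (f i : ℝ) / r h| := Finset.abs_sum_le_sum_abs _ _
        _ ≤ ∑ i, Cw * (f i : ℝ) / r h := by
            apply Finset.sum_le_sum
            intro i _
            rw [abs_div, abs_mul, abs_of_pos (hr' h), Nat.abs_cast]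
            have := hc h i
            have := hr' h
            gcongr
        _ = Cw := by
            rw [← Finset.sum_div, ← Finset.mul_sum, div_eq_iff (hr' h).ne', ← Nat.cast_sum, hf]
    calc _ ≤ |∑ i, c h i * (f i : ℝ) / r h| + |(∑ i, c h i) / N| := abs_sub _ _
      _ ≤ _ := by linarith [hsl h]
  · intro h
    rw [Finset.sum_sub_distrib, Finset.sum_comm, Finset.sum_const, nsmul_eq_mul, sub_eq_zero]
    have : ∀ i, ∑ f ∈ Finset.piAntidiag (Finset.univ : Finset (Fin N)) (r h), c h i * (f i : ℝ) / r h =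
        c h i * ((Finset.piAntidiag (Finset.univ : Finset (Fin N)) (r h)).card / N) := by
      intro i
      rw [← Finset.sum_div, ← Finset.mul_sum]
      have h1 := mean_piAntidiag N (r h) i
      have h2 := hr' h
      field_simp
      linear_combination (c h i) * h1
    simp only [this]
    rw [← Finset.sum_mul]; ring

end

section
open MvPolynomial

lemma vec_eval {d : ℕ} (A : Matrix (Fin d) (Fin d) ℤ) (θ : ℝ) (v : Fin d → ℝ)
    (hv : ∀ j, ∑ i, v i * (A i j : ℝ) = θ * v j) (p : Polynomial ℤ) :
    ∀ j, ∑ i, v i * ((Polynomial.aeval A p i j : ℤ) : ℝ) = Polynomial.aeval θ p * v j := by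
  induction p using Polynomial.induction_on' with
  | add p q hp hq =>
    intro j
    simp only [map_add, Matrix.add_apply, Int.cast_add, mul_add, Finset.sum_add_distrib, hp, hq, add_mul]
  | monomial n a =>
    have hpow : ∀ n : ℕ, ∀ j, ∑ i, v i * (((A ^ n) i j : ℤ) : ℝ) = θ ^ n * v j := by
      intro n
      induction n with
      | zero =>
        intro j
        simp [Matrix.one_apply]
      | succ n ih =>
        intro j
        simp only [pow_succ, Matrix.mul_apply, Int.cast_sum, Int.cast_mul, Finset.mul_sum]
        rw [Finset.sum_comm]
        simp only [← mul_assoc, ← Finset.sum_mul, ih]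
        simp only [mul_assoc, ← Finset.mul_sum, hv]
    intro j
    simp only [Polynomial.aeval_monomial]
    have h1 : ∀ i, (((algebraMap ℤ (Matrix (Fin d) (Fin d) ℤ)) a * A ^ n) i j) = a * (A ^ n) i j := by
      intro i
      rw [← Algebra.smul_def]; simp
    simp only [h1, Int.cast_mul]
    have h2 : ∀ i, v i * ((a:ℝ) * (((A ^ n) i j : ℤ) : ℝ)) = a * (v i * (((A ^ n) i j : ℤ) : ℝ)) := fun i => by ring
    simp only [h2, ← Finset.mul_sum, hpow]
    simp [mul_assoc]

/-- blockwise linear substitution with the same matrix in each block -/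
noncomputable def subL {R : Type*} [CommRing R] {m N : ℕ} (L : Fin N → Fin N → R) :
    MvPolynomial (Fin m × Fin N) R →ₐ[R] MvPolynomial (Fin m × Fin N) R :=
  bind₁ (fun x => ∑ k, C (L x.2 k) * X (x.1, k))

/-- exponent vector from a function -/
noncomputable def toE {m N : ℕ} (e : Fin m → Fin N → ℕ) : Fin m × Fin N →₀ ℕ :=
  Finsupp.equivFunOnFinite.symm (fun x => e x.1 x.2)

lemma toE_apply {m N : ℕ} (e : Fin m → Fin N → ℕ) (h : Fin m) (i : Fin N) : toE e (h, i) = e h i := rfl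

lemma toE_inj {m N : ℕ} : Function.Injective (toE : (Fin m → Fin N → ℕ) → _) := by
  intro e e' h
  funext x y
  exact DFunLike.congr_fun h (x, y)

lemma toE_curry {m N : ℕ} (E : Fin m × Fin N →₀ ℕ) : toE (fun h i => E (h, i)) = E := by
  ext ⟨h, i⟩; rfl

/-- block weight -/
def bW {m N : ℕ} : Fin m × Fin N → (Fin m → ℕ) := fun x => Pi.single x.1 1

lemma weight_bW {m N : ℕ} (E : Fin m × Fin N →₀ ℕ) (h : Fin m) :
    Finsupp.weight bW E h = ∑ i, E (h, i) := by
  rw [Finsupp.weight_apply, Finsupp.sum_fintype _ _ (by simp), Fintype.sum_prod_type]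
  simp [bW, Finset.sum_apply, Pi.single_apply]

lemma subL_hom {R : Type*} [CommRing R] {m N : ℕ} (L : Fin N → Fin N → R) (E E' : Fin m × Fin N →₀ ℕ)
    (hE : coeff E' (subL L (monomial E 1)) ≠ 0) (h : Fin m) : ∑ i, E' (h, i) = ∑ i, E (h, i) := by
  have hw : IsWeightedHomogeneous bW (subL L (monomial E 1)) (Finsupp.weight bW E) := by
    rw [subL, bind₁_monomial, C_1, one_mul, Finsupp.weight_apply]
    apply IsWeightedHomogeneous.prod
    intro x _
    apply IsWeightedHomogeneous.pow
    apply IsWeightedHomogeneous.sum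
    intro k _
    have := (isWeightedHomogeneous_C (R := R) (bW : Fin m × Fin N → _) (L x.2 k)).mul
      (isWeightedHomogeneous_X R bW (x.1, k))
    rw [zero_add] at this
    exact this
  rw [← weight_bW, ← weight_bW, hw hE]

lemma wL1_subL {R : Type*} [CommRing R] (n : SN R) {m N : ℕ} (L : Fin N → Fin N → R) (B : ℝ)
    (hB : ∀ i, ∑ k, n.ν (L i k) ≤ B) (E : Fin m × Fin N →₀ ℕ) :
    wL1 n (fun _ => 1) (subL L (monomial E 1)) ≤ B ^ (∑ h, ∑ i, E (h, i)) := by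
  have h1 : (0:ℝ) ≤ 1 := zero_le_one
  refine (wL1_bind n (fun _ => h1) _ _).trans ?_
  rw [wL1_monomial]
  have h2 : ∀ x : Fin m × Fin N, wL1 n (fun _ => (1:ℝ)) (∑ k, C (L x.2 k) * X (x.1, k)) ≤ B := by
    intro x
    refine (wL1_sum n (fun _ => h1) _ _).trans (le_trans ?_ (hB x.2))
    apply Finset.sum_le_sum
    intro k _
    refine (wL1_mul n (fun _ => h1) _ _).trans ?_
    rw [wL1_C]
    have : wL1 n (fun _ => (1:ℝ)) (X (x.1, k) : MvPolynomial (Fin m × Fin N) R) ≤ 1 := wL1_X n (fun _ => h1) _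
    nlinarith [n.nonneg (L x.2 k)]
  have h3 : monW (fun x : Fin m × Fin N => wL1 n (fun _ => (1:ℝ)) (∑ k, C (L x.2 k) * X (x.1, k))) E ≤
      monW (fun _ => B) E := monW_mono (fun x => wL1_nonneg n (fun _ => h1) _) h2 E
  have h4 : monW (fun _ => B) E = B ^ (∑ h, ∑ i, E (h, i)) := by
    rw [monW, Finsupp.prod_fintype _ _ (by simp), Fintype.prod_prod_type]
    simp only [Finset.prod_pow_eq_pow_sum]
  rw [← h4]
  have h5 := monW_nonneg (ρ := (fun x : Fin m × Fin N => wL1 n (fun _ => (1:ℝ)) (∑ k, C (L x.2 k) * X (x.1, k)))) (fun x => wL1_nonneg n (fun _ => h1) _) E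
  nlinarith [n.one]

end

section
open MvPolynomial

lemma map_subL {R S : Type*} [CommRing R] [CommRing S] {m N : ℕ} (f : R →+* S) (L : Fin N → Fin N → R)
    (F : MvPolynomial (Fin m × Fin N) R) : map f (subL L F) = subL (fun i j => f (L i j)) (map f F) := by
  rw [subL, subL, map_bind₁]
  congr 2
  funext x
  simp

theorem aux_poly {N d : ℕ} (hN : 0 < N) (β : Fin N → Fin N → Polynomial ℤ) (A : Matrix (Fin d) (Fin d) ℤ)
    (θ : ℝ) (v : Fin d → ℝ) (e0 : Fin d) (hv : ∀ j, ∑ i, v i * (A i j : ℝ) = θ * v j) (hv0 : v e0 = 1) :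
    ∃ B : ℝ, 1 ≤ B ∧ ∀ δ Cw : ℝ, 0 < δ → ∃ m : ℕ, 0 < m ∧ ∀ (r : Fin m → ℕ) (c : Fin m → Fin N → ℝ),
      (∀ h, 1 ≤ r h) → (∀ h i, |c h i| ≤ Cw) → (∀ h, ∑ i, c h i ≤ -δ) →
      ∃ P : MvPolynomial (Fin m × Fin N) ℝ, P ≠ 0 ∧ IntCoef P ∧ BlockHom r P ∧ L1 P ≤ B ^ (∑ h, r h) ∧
        ∀ E, coeff E (subL (fun i j => Polynomial.aeval θ (β i j)) P) ≠ 0 →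
          (∀ h, ∑ i, E (h, i) = r h) ∧ ∑ h, ∑ i, c h i * (E (h, i) : ℝ) / r h ≤ -δ * m / (2 * N) := by
  classical
  obtain ⟨n, hn⟩ := exists_matSN A
  set B0 : ℝ := 1 + ∑ i, ∑ k, n.ν (β i k) with hB0
  have hB01 : 1 ≤ B0 := by
    have : 0 ≤ ∑ i, ∑ k, n.ν (β i k) := Finset.sum_nonneg fun i _ => Finset.sum_nonneg fun k _ => n.nonneg _
    linarith
  have hB0i : ∀ i, ∑ k, n.ν (β i k) ≤ B0 := by
    intro i
    have := Finset.single_le_sum (f := fun i => ∑ k, n.ν (β i k))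
      (fun i _ => Finset.sum_nonneg fun k _ => n.nonneg _) (Finset.mem_univ i)
    linarith
  refine ⟨4 ^ N * B0, ?_, ?_⟩
  · have : (1:ℝ) ≤ 4 ^ N := one_le_pow₀ (by norm_num)
    nlinarith
  intro δ Cw hδ
  obtain ⟨m, hm⟩ := exists_nat_gt (32 * d * Cw ^ 2 * N ^ 2 / δ ^ 2)
  have hm0 : 0 < m := by
    have : (0:ℝ) ≤ 32 * d * Cw ^ 2 * N ^ 2 / δ ^ 2 := by positivity
    exact_mod_cast this.trans_lt hm
  refine ⟨m, hm0, ?_⟩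
  intro r c hr hc hs
  set Ω := Fintype.piFinset fun h => Finset.piAntidiag (Finset.univ : Finset (Fin N)) (r h) with hΩ
  set bad := Ω.filter (fun e => -δ * m / (2 * N) < ∑ h, ∑ i, c h i * (e h i : ℝ) / r h) with hbad
  have hmemΩ : ∀ e, e ∈ Ω ↔ ∀ h, ∑ i, e h i = r h := by
    intro e; rw [hΩ, Fintype.mem_piFinset]; simp
  have hΩpos : 0 < Ω.card := by
    rw [Finset.card_pos]
    refine ⟨fun h i => if i = ⟨0, hN⟩ then r h else 0, ?_⟩
    rw [hmemΩ]; simp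
  have hΩle : (Ω.card : ℝ) ≤ (2 ^ N) ^ (∑ h, r h) := by
    have : Ω.card ≤ ∏ h, 2 ^ (N * r h) := by
      rw [hΩ, Fintype.card_piFinset]
      exact Finset.prod_le_prod' fun h _ => card_piAntidiag_le N (r h)
    rw [Finset.prod_pow_eq_pow_sum, ← Finset.mul_sum, pow_mul] at this
    exact_mod_cast this
  have hcount := bad_count hN r hr c Cw δ hδ hm0 hc hs
  rw [← hΩ, ← hbad] at hcount
  have hcard : 2 * Fintype.card (bad × Fin d) ≤ Fintype.card Ω := by
    rw [Fintype.card_prod, Fintype.card_coe, Fintype.card_coe, Fintype.card_fin]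
    rw [div_lt_iff₀ (by positivity)] at hm
    have h1 : (2 * (bad.card * d) : ℝ) * (δ ^ 2 * m) ≤ Ω.card * (δ ^ 2 * m) := by
      have hd : (0:ℝ) ≤ d := Nat.cast_nonneg d
      have hΩ0 : (0:ℝ) ≤ Ω.card := Nat.cast_nonneg _
      calc _ = 2 * d * (bad.card * (δ ^ 2 * m)) := by ring
        _ ≤ 2 * d * (16 * Cw ^ 2 * N ^ 2 * Ω.card) := by gcongr
        _ = Ω.card * (32 * d * Cw ^ 2 * N ^ 2) := by ring
        _ ≤ Ω.card * (m * δ ^ 2) := by gcongr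
        _ = _ := by ring
    have h2 := le_of_mul_le_mul_right h1 (by have : (0:ℝ) < m := by exact_mod_cast hm0
                                             positivity)
    exact_mod_cast h2
  let Rn := ∑ h, r h
  let cc : (Fin m → Fin N → ℕ) → (Fin m → Fin N → ℕ) → Polynomial ℤ := fun e' e =>
    coeff (toE e') (subL β (monomial (toE e) 1))
  have hcc : ∀ e' e, e ∈ Ω → n.ν (cc e' e) ≤ B0 ^ Rn := by
    intro e' e he
    have h1 := wL1_coeff n (ρ := fun _ => (1:ℝ)) (fun _ => zero_le_one) (subL β (monomial (toE e) 1)) (toE e')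
    rw [monW_one, mul_one] at h1
    refine h1.trans ((wL1_subL n β B0 hB0i _).trans (le_of_eq ?_))
    congr 1
    apply Finset.sum_congr rfl
    intro h _
    exact (hmemΩ e).mp he h
  obtain ⟨t, ht0, htA, htb⟩ := siegel_simple (κ := bad × Fin d) (β := Ω)
    (fun x e => Polynomial.aeval A (cc x.1 e) x.2 e0) (B0 ^ Rn) (one_le_pow₀ hB01)
    (fun x e => (hn _ _ _).trans (hcc _ _ e.2)) hcard (by rw [Fintype.card_coe]; exact hΩpos)
  rw [Fintype.card_coe] at htb
  let P : MvPolynomial (Fin m × Fin N) ℝ := ∑ e : Ω, monomial (toE e.1) (t e : ℝ)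
  have hPc : ∀ e : Ω, coeff (toE e.1) P = t e := by
    intro e
    simp only [P]
    rw [coeff_sum, Finset.sum_eq_single e]
    · simp
    · intro e' _ hne
      rw [coeff_monomial, if_neg]
      intro h; exact hne (Subtype.ext (toE_inj h))
    · simp
  refine ⟨P, ?_, ?_, ?_, ?_, ?_⟩
  · intro h
    apply ht0
    funext e
    have := hPc e
    rw [h, coeff_zero] at this
    exact_mod_cast this.symm
  · rw [intCoef_iff]
    refine ⟨∑ e : Ω, monomial (toE e.1) (t e), ?_⟩
    simp [P, map_sum, map_monomial]
  · intro E hE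
    have h1 := mem_support_iff.mp hE
    simp only [P] at h1
    rw [coeff_sum] at h1
    obtain ⟨e, _, he⟩ := Finset.exists_ne_zero_of_sum_ne_zero h1
    rw [coeff_monomial] at he
    have : toE e.1 = E := by by_contra h; rw [if_neg h] at he; exact he rfl
    rw [← this]
    exact (hmemΩ e.1).mp e.2
  · have h1 : L1 P ≤ ∑ e : Ω, L1 (monomial (toE e.1) (t e : ℝ)) :=
      wL1_sum absSN (fun _ => zero_le_one) _ _
    refine h1.trans ?_
    have h2 : ∀ e : Ω, L1 (monomial (toE e.1) (t e : ℝ)) ≤ Ω.card * B0 ^ Rn := by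
      intro e
      rw [L1, wL1_monomial, monW_one, mul_one]
      exact htb e
    calc _ ≤ ∑ e : Ω, (Ω.card * B0 ^ Rn : ℝ) := Finset.sum_le_sum fun e _ => h2 e
      _ = Ω.card * (Ω.card * B0 ^ Rn) := by simp
      _ ≤ (2 ^ N) ^ Rn * ((2 ^ N) ^ Rn * B0 ^ Rn) := by gcongr
      _ = _ := by rw [← mul_pow, ← mul_pow, ← mul_assoc, ← mul_pow]; norm_num; rfl
  · intro E hE
    have hexp : ∀ E', coeff E' (subL (fun i j => Polynomial.aeval θ (β i j)) P) =
        ∑ e : Ω, (t e : ℝ) * Polynomial.aeval θ (coeff E' (subL β (monomial (toE e.1) 1))) := by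
      intro E'
      simp only [P]
      rw [map_sum, coeff_sum]
      apply Finset.sum_congr rfl
      intro e _
      have h1 : (monomial (toE e.1) (t e : ℝ)) = C (t e : ℝ) * monomial (toE e.1) 1 := by
        rw [C_mul_monomial, mul_one]
      have h2 : subL (fun i j => Polynomial.aeval θ (β i j)) (monomial (toE e.1) (1:ℝ)) =
          map (Polynomial.aeval θ : Polynomial ℤ →ₐ[ℤ] ℝ).toRingHom (subL β (monomial (toE e.1) 1)) := by
        rw [map_subL, map_monomial]; simp
      have h3 : subL (fun i j => Polynomial.aeval θ (β i j)) (C (t e : ℝ) : MvPolynomial (Fin m × Fin N) ℝ) = C (t e : ℝ) := by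
        rw [subL, bind₁_C_right]
      rw [h1, map_mul, h3, coeff_C_mul, h2, coeff_map]
      rfl
    have hblk : ∀ h, ∑ i, E (h, i) = r h := by
      rw [hexp] at hE
      obtain ⟨e, _, he⟩ := Finset.exists_ne_zero_of_sum_ne_zero hE
      intro h
      rw [subL_hom β (toE e.1) E ?_ h]
      · exact (hmemΩ e.1).mp e.2 h
      · intro h0; rw [h0] at he; simp at he
    refine ⟨hblk, ?_⟩
    by_contra hlt
    push Not at hlt
    apply hE
    let e' : Fin m → Fin N → ℕ := fun h i => E (h, i)
    have he' : e' ∈ bad := by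
      rw [hbad, Finset.mem_filter]
      exact ⟨(hmemΩ e').mpr hblk, hlt⟩
    have hEe : E = toE e' := (toE_curry E).symm
    rw [hexp]
    have h5 : ∀ x : Fin d, ∑ e : Ω, ((Polynomial.aeval A (cc e' e) x e0 : ℤ) : ℝ) * t e = 0 := by
      intro x
      have := congrFun htA (⟨e', he'⟩, x)
      simp only [Matrix.mulVec, dotProduct, Pi.zero_apply] at this
      exact_mod_cast this
    calc _ = ∑ e : Ω, (t e : ℝ) * ∑ x, v x * ((Polynomial.aeval A (cc e' e) x e0 : ℤ) : ℝ) := by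
            apply Finset.sum_congr rfl
            intro e _
            rw [vec_eval A θ v hv, hv0, mul_one, hEe]
      _ = ∑ x, v x * ∑ e : Ω, ((Polynomial.aeval A (cc e' e) x e0 : ℤ) : ℝ) * t e := by
            simp only [Finset.mul_sum]
            rw [Finset.sum_comm]
            apply Finset.sum_congr rfl
            intro x _
            apply Finset.sum_congr rfl
            intro e _
            ring
      _ = 0 := by simp only [h5, mul_zero, Finset.sum_const_zero]

end

section
open MvPolynomial

lemma seq_exists (Good : ℝ → Prop) (H : ∀ S0, ∃ S, S0 ≤ S ∧ Good S) (m : ℕ) (Smin t : ℝ) (hS : 0 ≤ Smin)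
    (ht : 1 ≤ t) : ∃ S : Fin m → ℝ, (∀ h, Good (S h)) ∧ (∀ h, Smin ≤ S h) ∧ ∀ i j, i < j → t * S j ≤ S i := by
  choose f hf1 hf2 using H
  let T : ℕ → ℝ := fun n => Nat.rec (f Smin) (fun _ x => f (max (t * x) Smin)) n
  have hT1 : ∀ n, Good (T n) := by
    intro n; cases n with
    | zero => exact hf2 _
    | succ n => exact hf2 _
  have hT2 : ∀ n, Smin ≤ T n := by
    intro n; cases n with
    | zero => exact hf1 _
    | succ n => exact (le_max_right _ _).trans (hf1 _)
  have hT3 : ∀ n, t * T n ≤ T (n + 1) := fun n => (le_max_left _ _).trans (hf1 _)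
  have hmono : Monotone T := by
    apply monotone_nat_of_le_succ
    intro n
    have := hT3 n
    have := hT2 n
    nlinarith
  refine ⟨fun h => T (m - 1 - h), fun h => hT1 _, fun h => hT2 _, ?_⟩
  intro i j hij
  show t * T (m - 1 - j) ≤ T (m - 1 - i)
  have h1 := i.2
  have h2 := j.2
  have h3 : (i:ℕ) < j := hij
  have h4 : m - 1 - (j:ℕ) + 1 ≤ m - 1 - (i:ℕ) := by omega
  have h5 := hmono h4
  exact (hT3 _).trans h5

lemma monW_blockhom {m N : ℕ} (r : Fin m → ℕ) (E : Fin m × Fin N →₀ ℕ) (hE : ∀ h, ∑ i, E (h, i) = r h) (B : ℝ) :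
    monW (fun _ => B) E = B ^ (∑ h, r h) := by
  rw [monW, Finsupp.prod_fintype _ _ (by simp), Fintype.prod_prod_type]
  simp only [Finset.prod_pow_eq_pow_sum, hE]

lemma monW_exp {m N : ℕ} (r : Fin m → ℕ) (E : Fin m × Fin N →₀ ℕ) (hE : ∀ h, ∑ i, E (h, i) = r h) (K : ℝ)
    (u : Fin m → Fin N → ℝ) :
    monW (fun x => K * Real.exp (u x.1 x.2)) E = K ^ (∑ h, r h) * Real.exp (∑ h, ∑ i, u h i * E (h, i)) := by
  rw [monW, Finsupp.prod_fintype _ _ (by simp), Fintype.prod_prod_type, Real.exp_sum,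
    ← Finset.prod_pow_eq_pow_sum, ← Finset.prod_mul_distrib]
  apply Finset.prod_congr rfl
  intro h _
  rw [Real.exp_sum, ← hE h, ← Finset.prod_pow_eq_pow_sum, ← Finset.prod_mul_distrib]
  apply Finset.prod_congr rfl
  intro i _
  rw [mul_pow, ← Real.exp_nat_mul, mul_comm (E (h, i) : ℝ)]

lemma subY_eq {m N : ℕ} (b Λ : Fin N → Fin N → ℝ) (D : ℝ) (hD : D ≠ 0)
    (hb : ∀ i k, ∑ j, b i j * Λ j k = if i = k then D else 0)
    (Y : Fin m → Matrix (Fin N) (Fin N) ℝ) (P : MvPolynomial (Fin m × Fin N) ℝ) :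
    subY Y P = bind₁ (fun x => C D⁻¹ * ∑ k, C (∑ i, Λ x.2 i * Y x.1 k i) * X (x.1, k)) (subL b P) := by
  have : subY Y = (bind₁ (fun x => C D⁻¹ * ∑ k, C (∑ i, Λ x.2 i * Y x.1 k i) * X (x.1, k))).comp (subL b) := by
    apply algHom_ext
    rintro ⟨h, i⟩
    rw [AlgHom.comp_apply, subL, bind₁_X_right, map_sum, subY, bind₁_X_right]
    simp only [map_mul, bind₁_C_right, bind₁_X_right]
    have e1 : ∀ j, (C (b i j) * (C D⁻¹ * ∑ k, C (∑ i, Λ j i * Y h k i) * X (h, k)) : MvPolynomial (Fin m × Fin N) ℝ) =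
       ∑ k, C (D⁻¹ * (b i j * ∑ i, Λ j i * Y h k i)) * X (h, k) := by
      intro j
      rw [Finset.mul_sum, Finset.mul_sum]
      apply Finset.sum_congr rfl
      intro k _
      simp only [map_mul]; ring
    simp only [e1]
    rw [Finset.sum_comm]
    apply Finset.sum_congr rfl
    intro k _
    rw [← Finset.sum_mul, ← map_sum]
    congr 2
    rw [← Finset.mul_sum]
    simp only [Finset.mul_sum, ← mul_assoc]
    rw [Finset.sum_comm]
    simp only [mul_assoc, ← Finset.mul_sum]
    simp only [← mul_assoc]
    simp only [← Finset.sum_mul, hb]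
    simp [hD]
  rw [this]; rfl

lemma intCoef_subY {m N : ℕ} (Y : Fin m → Matrix (Fin N) (Fin N) ℤ) (P : MvPolynomial (Fin m × Fin N) ℝ)
    (hP : IntCoef P) : IntCoef (subY (fun h => (Y h).map (fun z : ℤ => (z : ℝ))) P) := by
  rw [intCoef_iff] at hP ⊢
  obtain ⟨G, rfl⟩ := hP
  refine ⟨bind₁ (fun x => ∑ k, C (Y x.1 k x.2) * X (x.1, k)) G, ?_⟩
  rw [map_bind₁, subY]
  congr 2
  funext x
  simp

/-- weighted norm bound for the substituted polynomial -/
lemma wL1_subY {m N : ℕ} (b Λ : Fin N → Fin N → ℝ) (D : ℝ) (hD : 1 ≤ |D|)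
    (hb : ∀ i k, ∑ j, b i j * Λ j k = if i = k then D else 0)
    (Y : Fin m → Matrix (Fin N) (Fin N) ℝ) (P : MvPolynomial (Fin m × Fin N) ℝ)
    (k0 : Fin N) (i0 : Fin m → Fin N) (hYk : ∀ h i, Y h k0 i = if i = i0 h then 1 else 0)
    (K B1 W : ℝ) (hK : ∀ i j, |Λ i j| ≤ K) (hB1 : ∀ i, ∑ k, |b i k| ≤ B1)
    (S : Fin m → ℝ) (hS : ∀ h, 0 ≤ S h) (c : Fin m → Fin N → ℝ) (Cw : ℝ) (hc : ∀ h i, |c h i| ≤ Cw)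
    (hY : ∀ h k, k ≠ k0 → ∀ j, |∑ i, Λ j i * Y h k i| ≤ Real.exp (c h j * S h))
    (r : Fin m → ℕ) (hhom : BlockHom r P)
    (hG : ∀ E, coeff E (subL b P) ≠ 0 → (∀ h, ∑ i, E (h, i) = r h) ∧ ∑ h, ∑ i, c h i * S h * E (h, i) ≤ W) :
    wL1 absSN (fun x => if x.2 = k0 then Real.exp (- Cw * S x.1) else 1) (subY Y P) ≤
      (K + N) ^ (∑ h, r h) * Real.exp W * (B1 ^ (∑ h, r h) * L1 P) := by
  have hDne : D ≠ 0 := by intro h; rw [h, abs_zero] at hD; linarith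
  have hK0 : 0 ≤ K := (abs_nonneg _).trans (hK k0 k0)
  set ρ : Fin m × Fin N → ℝ := fun x => if x.2 = k0 then Real.exp (- Cw * S x.1) else 1 with hρ
  have hρ0 : ∀ x, 0 ≤ ρ x := by
    intro x; simp only [hρ]; split_ifs
    · exact (Real.exp_pos _).le
    · exact zero_le_one
  rw [subY_eq b Λ D hDne hb]
  refine (wL1_bind absSN hρ0 _ _).trans ?_
  have h1 : ∀ x : Fin m × Fin N, wL1 absSN ρ (C D⁻¹ * ∑ k, C (∑ i, Λ x.2 i * Y x.1 k i) * X (x.1, k)) ≤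
      (K + N) * Real.exp (c x.1 x.2 * S x.1) := by
    rintro ⟨h, j⟩
    refine (wL1_mul absSN hρ0 _ _).trans ?_
    rw [wL1_C]
    have hDi : absSN.ν D⁻¹ ≤ 1 := by
      show |D⁻¹| ≤ 1
      rw [abs_inv]; exact inv_le_one_of_one_le₀ hD
    refine (mul_le_of_le_one_left (wL1_nonneg absSN hρ0 _) hDi).trans ?_
    refine (wL1_sum absSN hρ0 _ _).trans ?_
    have h2 : ∀ k, wL1 absSN ρ (C (∑ i, Λ j i * Y h k i) * X (h, k)) ≤
        (if k = k0 then K else 0) * Real.exp (c h j * S h) + Real.exp (c h j * S h) := by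
      intro k
      refine (wL1_mul absSN hρ0 _ _).trans ?_
      rw [wL1_C]
      show |∑ i, Λ j i * Y h k i| * _ ≤ _
      have hX := wL1_X absSN hρ0 (h, k)
      have he := Real.exp_pos (c h j * S h)
      by_cases hk : k = k0
      · subst hk
        simp only [hρ, if_true] at hX ⊢
        have h3 : ∑ i, Λ j i * Y h k i = Λ j (i0 h) := by simp [hYk]
        have h4 : Real.exp (-Cw * S h) ≤ Real.exp (c h j * S h) := by
          apply Real.exp_le_exp.mpr
          have := neg_le_of_abs_le (hc h j)
          exact mul_le_mul_of_nonneg_right this (hS h)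
        rw [h3]
        have h5 : |Λ j (i0 h)| * wL1 absSN ρ (X (h, k)) ≤ K * Real.exp (c h j * S h) :=
          mul_le_mul (hK _ _) (hX.trans h4) (wL1_nonneg absSN hρ0 _) hK0
        simp only [hρ] at h5
        linarith
      · have h6 : ρ (h, k) = 1 := by simp [hρ, hk]
        rw [h6] at hX
        rw [if_neg hk, zero_mul, zero_add]
        have := hY h k hk j
        calc _ ≤ Real.exp (c h j * S h) * 1 :=
              mul_le_mul this hX (wL1_nonneg absSN hρ0 _) he.le
          _ = _ := mul_one _
    refine (Finset.sum_le_sum fun k _ => h2 k).trans (le_of_eq ?_)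
    rw [Finset.sum_add_distrib, ← Finset.sum_mul]
    simp; ring
  refine (wL1_mono absSN (fun x => wL1_nonneg absSN hρ0 _) h1 _).trans ?_
  have h7 : L1 (subL b P) ≤ B1 ^ (∑ h, r h) * L1 P := by
    refine (wL1_bind absSN (fun _ => zero_le_one) _ _).trans ?_
    have h8 : ∀ x : Fin m × Fin N, wL1 absSN (fun _ => (1:ℝ)) (∑ k, C (b x.2 k) * X (x.1, k)) ≤ B1 := by
      intro x
      refine (wL1_sum absSN (fun _ => zero_le_one) _ _).trans (le_trans ?_ (hB1 x.2))
      apply Finset.sum_le_sum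
      intro k _
      refine (wL1_mul absSN (fun _ => zero_le_one) _ _).trans ?_
      rw [wL1_C]
      exact mul_le_of_le_one_right (abs_nonneg _) (wL1_X absSN (fun _ => zero_le_one) _)
    refine (wL1_mono absSN (fun x => wL1_nonneg absSN (fun _ => zero_le_one) _) h8 _).trans ?_
    rw [L1, wL1, wL1, Finset.mul_sum]
    apply Finset.sum_le_sum
    intro E hE
    rw [monW_blockhom r E (hhom E hE), monW_one]
    apply le_of_eq; ring
  have hKN : 0 ≤ (K + N : ℝ) := by positivity
  refine le_trans ?_ (mul_le_mul_of_nonneg_left h7 (by positivity))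
  rw [L1, wL1, wL1, Finset.mul_sum]
  apply Finset.sum_le_sum
  intro E hE
  obtain ⟨hE1, hE2⟩ := hG E (mem_support_iff.mp hE)
  rw [monW_exp r E hE1 (K + N) (fun h i => c h i * S h), monW_one, mul_one, mul_comm]
  apply mul_le_mul_of_nonneg_right _ (absSN.nonneg _)
  gcongr

end

section
open MvPolynomial

/-- a system of small solutions at parameter `S` -/
def GoodAt {N : ℕ} (Λ : Fin N → Fin N → ℝ) (k0 : Fin N) (δ Cw κ S : ℝ) : Prop :=
  ∃ (c : Fin N → ℝ) (mm : Fin N → ℤ) (i0 i1 : Fin N) (Y : Matrix (Fin N) (Fin N) ℤ),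
    (∀ i, |c i| ≤ Cw) ∧ ∑ i, c i ≤ -δ ∧ i0 ≠ i1 ∧ mm i0 ≠ 0 ∧
    Real.exp (κ * S) * (Int.gcd (mm i0) (mm i1) : ℝ) ≤ |(mm i0 : ℝ)| ∧
    Y.det ≠ 0 ∧ (∀ i, Y k0 i = if i = i0 then 1 else 0) ∧
    (∀ k, k ≠ k0 → ∑ i, Y k i * mm i = 0) ∧
    ∀ k, k ≠ k0 → ∀ j, |∑ i, Λ j i * (Y k i : ℝ)| ≤ Real.exp (c j * S)

/-- reduced fraction -/
lemma red_frac (x y : ℤ) (hx : x ≠ 0) : ∃ (p : ℤ) (q : ℕ), 0 < q ∧ IsCoprime p (q : ℤ) ∧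
    (p : ℝ) / q = - (y : ℝ) / x ∧ (q : ℝ) * Int.gcd x y = |(x : ℝ)| := by
  have hg : 0 < Int.gcd x y := Int.gcd_pos_of_ne_zero_left _ hx
  obtain ⟨x', hx'⟩ := Int.gcd_dvd_left (a := x) (b := y)
  obtain ⟨y', hy'⟩ := Int.gcd_dvd_right (a := x) (b := y)
  set g := Int.gcd x y with hgd
  have hgz : (g : ℤ) ≠ 0 := by exact_mod_cast hg.ne'
  have hx'0 : x' ≠ 0 := by rintro rfl; simp at hx'; exact hx hx'
  have hcop : IsCoprime x' y' := by
    rw [Int.isCoprime_iff_gcd_eq_one]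
    have h1 : Int.gcd (g * x') (g * y') = g * Int.gcd x' y' := by
      rw [Int.gcd_mul_left]; simp
    rw [← hx', ← hy', ← hgd] at h1
    exact Nat.eq_of_mul_eq_mul_left hg (by linarith)
  have hxr : (x : ℝ) = g * x' := by exact_mod_cast hx'
  have hyr : (y : ℝ) = g * y' := by exact_mod_cast hy'
  have hgr : (g : ℝ) ≠ 0 := by exact_mod_cast hg.ne'
  have hx'r : (x' : ℝ) ≠ 0 := by exact_mod_cast hx'0
  have habs : ((x'.natAbs : ℕ) : ℝ) = |(x' : ℝ)| := by
    rw [← Int.cast_natCast, Int.natCast_natAbs, Int.cast_abs]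
  refine ⟨- y' * x'.sign, x'.natAbs, Int.natAbs_pos.mpr hx'0, ?_, ?_, ?_⟩
  · have h2 : (x'.natAbs : ℤ) = x'.sign * x' := by
      rw [Int.sign_mul_self_eq_abs]; exact Int.natCast_natAbs x'
    have hu : IsUnit x'.sign := by
      rcases lt_trichotomy x' 0 with h | h | h
      · rw [Int.sign_eq_neg_one_of_neg h]; exact isUnit_one.neg
      · exact absurd h hx'0
      · rw [Int.sign_eq_one_of_pos h]; exact isUnit_one
    rw [h2]
    rw [isCoprime_mul_unit_right_left hu, isCoprime_mul_unit_left_right hu]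
    exact hcop.symm.neg_left
  · rw [habs, hxr, hyr]
    push_cast
    rcases lt_or_gt_of_ne hx'0 with h | h
    · have : (x' : ℝ) < 0 := by exact_mod_cast h
      rw [Int.sign_eq_neg_one_of_neg h, abs_of_neg this]
      push_cast; field_simp
    · have : (0:ℝ) < x' := by exact_mod_cast h
      rw [Int.sign_eq_one_of_pos h, abs_of_pos this]
      push_cast; field_simp
  · rw [habs, hxr, abs_mul, Nat.abs_cast]; ring

set_option maxHeartbeats 2000000 in
theorem PT {N d : ℕ} (β : Fin N → Fin N → Polynomial ℤ) (A : Matrix (Fin d) (Fin d) ℤ)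
    (θ : ℝ) (v : Fin d → ℝ) (e0 : Fin d) (hv : ∀ j, ∑ i, v i * (A i j : ℝ) = θ * v j) (hv0 : v e0 = 1)
    (Λ : Fin N → Fin N → ℝ) (D : ℤ) (hD : D ≠ 0)
    (hβ : ∀ i k, ∑ j, Polynomial.aeval θ (β i j) * Λ j k = if i = k then (D : ℝ) else 0)
    (k0 : Fin N) (δ Cw κ : ℝ) (hδ : 0 < δ) (hCw : 0 < Cw) (hκ : 0 < κ) :
    ∃ S0, ∀ S, S0 ≤ S → ¬ GoodAt Λ k0 δ Cw κ S := by
  by_contra hcon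
  push Not at hcon
  have hN : 0 < N := k0.pos
  have hNr : (1:ℝ) ≤ N := by exact_mod_cast hN
  obtain ⟨B, hB, hB2⟩ := aux_poly hN β A θ v e0 hv hv0
  obtain ⟨m, hm, hP⟩ := hB2 δ Cw hδ
  have hmr : (1:ℝ) ≤ m := by exact_mod_cast hm
  set ε : ℝ := min 1 (δ / (32 * N * Cw)) with hε
  have hε0 : 0 < ε := by rw [hε]; positivity
  obtain ⟨ω, C0, hω, hω1, hC0, RL⟩ := roth_lemma m ε hε0 (min_le_left _ _)
  set K : ℝ := ∑ i, ∑ j, |Λ i j| with hKdef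
  have hK : ∀ i j, |Λ i j| ≤ K := by
    intro i j
    refine (Finset.single_le_sum (f := fun j => |Λ i j|) (fun _ _ => abs_nonneg _) (Finset.mem_univ j)).trans ?_
    exact Finset.single_le_sum (f := fun i => ∑ j, |Λ i j|)
      (fun _ _ => Finset.sum_nonneg fun _ _ => abs_nonneg _) (Finset.mem_univ i)
  have hK0 : 0 ≤ K := (abs_nonneg _).trans (hK k0 k0)
  set B1 : ℝ := 1 + ∑ i, ∑ j, |Polynomial.aeval θ (β i j)| with hB1def
  have hB1a : ∀ i, ∑ k, |Polynomial.aeval θ (β i k)| ≤ B1 := by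
    intro i
    have := Finset.single_le_sum (f := fun i => ∑ j, |Polynomial.aeval θ (β i j)|)
      (fun _ _ => Finset.sum_nonneg fun _ _ => abs_nonneg _) (Finset.mem_univ i)
    linarith
  have hB11 : 1 ≤ B1 := by
    have : 0 ≤ ∑ i, ∑ j, |Polynomial.aeval θ (β i j)| :=
      Finset.sum_nonneg fun _ _ => Finset.sum_nonneg fun _ _ => abs_nonneg _
    linarith
  set K3 : ℝ := (K + N) * B1 * B with hK3
  have hK31 : 1 ≤ K3 := by
    have h1 : 1 ≤ K + N := by linarith
    have h2 : 1 ≤ (K + N) * B1 := by nlinarith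
    rw [hK3]; nlinarith
  set Smin : ℝ := 1 + 8 * N * Real.log K3 / δ + 2 * m * Real.log C0 / κ + 2 * m * Real.log B / (κ * ω) with hSmin
  have l1 : 0 ≤ Real.log K3 := Real.log_nonneg hK31
  have l2 : 0 ≤ Real.log C0 := Real.log_nonneg (by linarith)
  have l3 : 0 ≤ Real.log B := Real.log_nonneg hB
  have hs1 : 0 ≤ 8 * N * Real.log K3 / δ := by positivity
  have hs2 : 0 ≤ 2 * m * Real.log C0 / κ := by positivity
  have hs3 : 0 ≤ 2 * m * Real.log B / (κ * ω) := by positivity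
  have hSm1 : 1 ≤ Smin := by linarith
  obtain ⟨S, hSg, hSge, hSS⟩ := seq_exists (GoodAt Λ k0 δ Cw κ) hcon m Smin (2 / ω) (by linarith)
    (by rw [le_div_iff₀ hω]; linarith)
  have hS1 : ∀ h, 1 ≤ S h := fun h => hSm1.trans (hSge h)
  choose c mm i0 i1 Y hc hcs hne hm0 hgcd hdet hYk hYm hYs using hSg
  -- the big parameter
  set Sx : ℝ := ∑ h, S h with hSx
  have hSxge : ∀ h, S h ≤ Sx := fun h =>
    Finset.single_le_sum (fun h _ => (by linarith [hS1 h] : 0 ≤ S h)) (Finset.mem_univ h)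
  have hSx1 : 1 ≤ Sx := (hS1 ⟨0, hm⟩).trans (hSxge _)
  set Lam : ℝ := Sx * (1 + 8 * N * Cw / δ) with hLam
  have hLS : Sx ≤ Lam := by
    have : 0 ≤ 8 * N * Cw / δ := by positivity
    rw [hLam]; nlinarith
  have hLη : Sx * Cw ≤ δ / (8 * N) * Lam := by
    rw [hLam]
    have h1 : δ / (8 * N) * (Sx * (1 + 8 * N * Cw / δ)) = δ / (8 * N) * Sx + Sx * Cw := by
      field_simp
    rw [h1]
    have : 0 ≤ δ / (8 * N) * Sx := by positivity
    linarith
  have hLpos : 0 < Lam := by linarith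
  let r : Fin m → ℕ := fun h => ⌈Lam / S h⌉₊
  have hr_lo : ∀ h, Lam ≤ r h * S h := by
    intro h
    have := Nat.le_ceil (Lam / S h)
    rwa [div_le_iff₀ (by linarith [hS1 h])] at this
  have hr_hi : ∀ h, r h * S h ≤ Lam + S h := by
    intro h
    have h0 : 0 < S h := by linarith [hS1 h]
    have := (Nat.ceil_lt_add_one (a := Lam / S h) (by positivity)).le
    calc (r h : ℝ) * S h ≤ (Lam / S h + 1) * S h := by gcongr
      _ = _ := by field_simp
  have hr1 : ∀ h, 1 ≤ r h := fun h => Nat.one_le_ceil_iff.mpr (div_pos hLpos (by linarith [hS1 h]))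
  have hr0 : ∀ h, (0:ℝ) < r h := fun h => by exact_mod_cast hr1 h
  have hR : ((∑ h, r h : ℕ) : ℝ) * Smin ≤ 2 * m * Lam := by
    push_cast
    rw [Finset.sum_mul]
    calc _ ≤ ∑ h : Fin m, 2 * Lam := by
          apply Finset.sum_le_sum
          intro h _
          have := hr_hi h
          have := hSxge h
          have : (r h : ℝ) * Smin ≤ r h * S h := mul_le_mul_of_nonneg_left (hSge h) (hr0 h).le
          linarith
      _ = _ := by simp; ring
  have hRb : ∀ x y : ℝ, 0 ≤ x → 0 < y → 2 * m * x / y ≤ Smin → ((∑ h, r h : ℕ) : ℝ) * x ≤ y * Lam := by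
    intro x y hx hy hxy
    rw [div_le_iff₀ hy] at hxy
    have h1 : ((∑ h, r h : ℕ) : ℝ) * (2 * m * x) ≤ ((∑ h, r h : ℕ) : ℝ) * (Smin * y) := by gcongr
    have h2 : (((∑ h, r h : ℕ) : ℝ) * Smin) * y ≤ (2 * m * Lam) * y := by gcongr
    have h3 : (2 * m : ℝ) * (((∑ h, r h : ℕ) : ℝ) * x) ≤ (2 * m) * (y * Lam) := by nlinarith
    exact le_of_mul_le_mul_left h3 (by positivity)
  have hpowexp : ∀ x : ℝ, 1 ≤ x → x ^ (∑ h, r h) = Real.exp (((∑ h, r h : ℕ) : ℝ) * Real.log x) := by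
    intro x hx
    rw [Real.exp_nat_mul, Real.exp_log (by linarith)]
  obtain ⟨P, hP0, hPint, hPhom, hPL, hPG⟩ := hP r c hr1 hc hcs
  choose p q hq hcop hpq hqg using fun h => red_frac (mm h (i0 h)) (mm h (i1 h)) (hm0 h)
  set Z : ℝ := Real.exp (κ * Lam) with hZ
  set Yr : Fin m → Matrix (Fin N) (Fin N) ℝ := fun h => (Y h).map (fun z : ℤ => (z : ℝ)) with hYr
  have hYkr : ∀ h i, Yr h k0 i = if i = i0 h then 1 else 0 := by
    intro h i
    simp only [hYr, Matrix.map_apply, hYk]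
    split_ifs <;> simp
  have hdetr : ∀ h, (Yr h).det ≠ 0 := by
    intro h
    have : (Yr h).det = ((Y h).det : ℝ) := ((Int.castRingHom ℝ).map_det (Y h)).symm
    rw [this]; exact_mod_cast hdet h
  obtain ⟨E, hE0, hEw⟩ := blocks i0 i1 k0 ε ω C0 Z RL r P hP0 hPint hPhom mm hne hm0 Yr hdetr hYkr
    (by intro h k hk
        have := hYm h k hk
        simp only [hYr, Matrix.map_apply]
        exact_mod_cast this)
    p q hpq hr1
    (by intro i j hij
        have h1 := hSS i j hij
        have h2 := hr_hi i
        have h3 := hr_lo j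
        have h4 := hSxge i
        have h5 : (r i : ℝ) * S i ≤ 2 * Lam := by linarith
        have h6 := hr0 i
        have h7 := hr0 j
        have h8 : (r i : ℝ) * (2 / ω * S j) ≤ r i * S i := by gcongr
        have h9 : 0 < S j := by linarith [hS1 j]
        have h10 : (r i : ℝ) * (2 / ω * S j) ≤ 2 * (r j * S j) := by linarith
        have h11 : (r i : ℝ) * (2 / ω * S j) = (2 / ω * S j) * r i := by ring
        have h12 : (2 : ℝ) * (r j * S j) = (2 / ω * S j) * (ω * r j) := by field_simp
        rw [h11, h12] at h10
        exact le_of_mul_le_mul_left h10 (by positivity))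
    hq hcop
    (by intro h
        have h1 : Real.exp (κ * S h) ≤ q h := by
          have := hgcd h
          rw [← hqg h] at this
          refine le_of_mul_le_mul_right this ?_
          exact_mod_cast Int.gcd_pos_of_ne_zero_left _ (hm0 h)
        calc Z ≤ Real.exp (r h * (κ * S h)) := by
              apply Real.exp_le_exp.mpr
              have := hr_lo h
              nlinarith
          _ = Real.exp (κ * S h) ^ (r h) := Real.exp_nat_mul _ _
          _ ≤ _ := by gcongr)
    (by rw [hpowexp C0 (by linarith)]
        exact Real.exp_le_exp.mpr (hRb _ _ l2 hκ (by linarith)))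
    (by refine hPL.trans ?_
        rw [hpowexp B hB, hZ, ← Real.exp_mul]
        apply Real.exp_le_exp.mpr
        have := hRb _ _ l3 (mul_pos hκ hω) (by linarith)
        linarith)
  have hDr : (1:ℝ) ≤ |(D:ℝ)| := by
    have := Int.one_le_abs hD
    exact_mod_cast this
  have key := wL1_subY (fun i j => Polynomial.aeval θ (β i j)) Λ D hDr hβ Yr P k0 i0 hYkr K B1
    (-(3 * δ / (8 * N)) * m * Lam) hK hB1a S (fun h => by linarith [hS1 h]) c Cw hc
    (fun h k hk j => hYs h k hk j) r hPhom
    (by intro E' hE'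
        obtain ⟨h1, h2⟩ := hPG E' hE'
        refine ⟨h1, ?_⟩
        have hx : ∀ h, |∑ i, c h i * (E' (h, i) : ℝ) / r h| ≤ Cw := by
          intro h
          calc _ ≤ ∑ i, |c h i * (E' (h, i) : ℝ) / r h| := Finset.abs_sum_le_sum_abs _ _
            _ ≤ ∑ i, Cw * (E' (h, i) : ℝ) / r h := by
                apply Finset.sum_le_sum
                intro i _
                rw [abs_div, abs_mul, abs_of_pos (hr0 h), Nat.abs_cast]
                have := hc h i
                have := hr0 h
                gcongr
            _ = Cw := by
                rw [← Finset.sum_div, ← Finset.mul_sum, div_eq_iff (hr0 h).ne', ← Nat.cast_sum, h1 h]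
        have hh : ∀ h, ∑ i, c h i * S h * (E' (h, i) : ℝ) ≤
            Lam * (∑ i, c h i * (E' (h, i) : ℝ) / r h) + Sx * Cw := by
          intro h
          have e1 : ∑ i, c h i * S h * (E' (h, i) : ℝ) = (r h * S h) * ∑ i, c h i * (E' (h, i) : ℝ) / r h := by
            rw [Finset.mul_sum]
            apply Finset.sum_congr rfl
            intro i _
            have := (hr0 h).ne'
            field_simp
          rw [e1]
          set x := ∑ i, c h i * (E' (h, i) : ℝ) / r h
          have h3 := hx h
          have h4 := hr_lo h
          have h5 := hr_hi h
          have h6 := hSxge h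
          have h7 : (r h * S h - Lam) * x ≤ Sx * Cw :=
            (mul_le_mul_of_nonneg_left ((le_abs_self _).trans h3) (by linarith)).trans
              (mul_le_mul_of_nonneg_right (by linarith) hCw.le)
          linarith
        calc _ ≤ ∑ h, (Lam * (∑ i, c h i * (E' (h, i) : ℝ) / r h) + Sx * Cw) := Finset.sum_le_sum fun h _ => hh h
          _ = Lam * (∑ h, ∑ i, c h i * (E' (h, i) : ℝ) / r h) + m * (Sx * Cw) := by
              rw [Finset.sum_add_distrib, ← Finset.mul_sum]; simp
          _ ≤ Lam * (-δ * m / (2 * N)) + m * (δ / (8 * N) * Lam) := by gcongr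
          _ = _ := by field_simp; ring)
  have hcoef := wL1_coeff absSN
    (ρ := fun x : Fin m × Fin N => if x.2 = k0 then Real.exp (- Cw * S x.1) else 1)
    (by intro x; split_ifs
        · exact (Real.exp_pos _).le
        · exact zero_le_one) (subY Yr P) E
  obtain ⟨z, hz⟩ := intCoef_subY Y P hPint E
  have hz1 : 1 ≤ absSN.ν (coeff E (subY Yr P)) := by
    show 1 ≤ |coeff E (subY Yr P)|
    rw [hz] at hE0 ⊢
    have : z ≠ 0 := by intro h; rw [h] at hE0; simp at hE0
    have := Int.one_le_abs this
    exact_mod_cast this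
  have hτ : Real.exp (-(δ / (16 * N)) * Lam) ≤
      monW (fun x : Fin m × Fin N => if x.2 = k0 then Real.exp (- Cw * S x.1) else 1) E := by
    have e1 : monW (fun x : Fin m × Fin N => if x.2 = k0 then Real.exp (- Cw * S x.1) else 1) E =
        Real.exp (∑ h, - Cw * S h * E (h, k0)) := by
      rw [monW, Finsupp.prod_fintype _ _ (by simp), Fintype.prod_prod_type, Real.exp_sum]
      apply Finset.prod_congr rfl
      intro h _
      rw [Finset.prod_eq_single k0]
      · simp only [if_true]
        rw [← Real.exp_nat_mul]; congr 1; ring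
      · intro k _ hk; simp [hk]
      · simp
    rw [e1]
    apply Real.exp_le_exp.mpr
    have h1 : ∑ h, S h * E (h, k0) ≤ 2 * Lam * ε := by
      calc _ ≤ ∑ h, 2 * Lam * ((E (h, k0) : ℝ) / r h) := by
            apply Finset.sum_le_sum
            intro h _
            have h2 : S h ≤ 2 * Lam / r h := by
              rw [le_div_iff₀ (hr0 h)]
              linarith [hr_hi h, hSxge h]
            calc _ ≤ 2 * Lam / r h * E (h, k0) := by gcongr
              _ = _ := by ring
        _ = 2 * Lam * ∑ h, (E (h, k0) : ℝ) / r h := by rw [Finset.mul_sum]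
        _ ≤ _ := by gcongr
    have h2 : ∑ h, - Cw * S h * (E (h, k0) : ℝ) = - Cw * ∑ h, S h * E (h, k0) := by
      rw [Finset.mul_sum]; apply Finset.sum_congr rfl; intros; ring
    rw [h2]
    have h3 : ε ≤ δ / (32 * N * Cw) := min_le_right _ _
    have h4 : Cw * (2 * Lam * ε) ≤ Cw * (2 * Lam * (δ / (32 * N * Cw))) := by gcongr
    have h5 : Cw * (2 * Lam * (δ / (32 * N * Cw))) = δ / (16 * N) * Lam := by field_simp; ring
    have h6 : Cw * ∑ h, S h * (E (h, k0) : ℝ) ≤ Cw * (2 * Lam * ε) := by gcongr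
    linarith
  have hfin : Real.exp (-(δ / (16 * N)) * Lam) ≤
      K3 ^ (∑ h, r h) * Real.exp (-(3 * δ / (8 * N)) * m * Lam) := by
    calc _ ≤ _ := hτ
      _ ≤ absSN.ν (coeff E (subY Yr P)) * monW (fun x : Fin m × Fin N => if x.2 = k0 then Real.exp (- Cw * S x.1) else 1) E :=
          le_mul_of_one_le_left ((Real.exp_pos _).le.trans hτ) hz1
      _ ≤ _ := hcoef
      _ ≤ _ := key
      _ ≤ (K + N) ^ (∑ h, r h) * Real.exp (-(3 * δ / (8 * N)) * m * Lam) * (B1 ^ (∑ h, r h) * B ^ (∑ h, r h)) := by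
          gcongr
      _ = _ := by rw [hK3, mul_pow, mul_pow]; ring
  rw [hpowexp K3 hK31, ← Real.exp_add] at hfin
  have hfin2 := Real.exp_le_exp.mp hfin
  have h1 := hRb _ (δ * m / (4 * N)) l1 (by positivity) (by
    have : 2 * m * Real.log K3 / (δ * m / (4 * N)) = 8 * N * Real.log K3 / δ := by field_simp; ring
    rw [this]; linarith)
  have h2 : 0 < δ / (8 * N) * Lam := by positivity
  have h3 : -(δ / (16 * N)) * Lam ≤ δ * m / (4 * N) * Lam + -(3 * δ / (8 * N)) * m * Lam := by linarith
  have h4 : δ * m / (4 * N) * Lam + -(3 * δ / (8 * N)) * m * Lam = - (δ / (8 * N) * Lam) * m := by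
    field_simp; ring
  rw [h4] at h3
  have h5 : δ / (16 * N) * Lam = (δ / (8 * N) * Lam) / 2 := by field_simp; ring
  nlinarith

end

section
open Polynomial

theorem nf_data (α : ℝ) (hα : IsAlgebraic ℚ α) : ∃ (a : ℤ) (d : ℕ) (A : Matrix (Fin d) (Fin d) ℤ)
    (v : Fin d → ℝ) (e0 : Fin d), a ≠ 0 ∧ (∀ j, ∑ i, v i * (A i j : ℝ) = (a * α) * v j) ∧ v e0 = 1 ∧
    ∃ (C : ℝ) (k : ℕ), 1 ≤ C ∧ ∀ (c0 c1 c2 : ℤ) (H : ℝ), 1 ≤ H → |(c0 : ℝ)| ≤ H → |(c1 : ℝ)| ≤ H →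
      |(c2 : ℝ)| ≤ H → (c0 : ℝ) + c1 * α + c2 * α ^ 2 ≠ 0 →
      1 ≤ C * H ^ k * |(c0 : ℝ) + c1 * α + c2 * α ^ 2| := by
  obtain ⟨a, ha, hintC⟩ := ((IsFractionRing.isAlgebraic_iff ℤ ℚ ℝ).mpr hα).exists_integral_multiple
  set θ : ℝ := a * α with hθ
  have hintC' : IsIntegral ℤ θ := by rwa [zsmul_eq_mul] at hintC
  set f := minpoly ℤ θ with hf
  have hfm : f.Monic := minpoly.monic hintC'
  have hf0 : aeval θ f = 0 := minpoly.aeval ℤ θ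
  set d := f.natDegree with hd
  have hd0 : 0 < d := minpoly.natDegree_pos hintC'
  have hlow : ∀ w : Fin d → ℤ, ∑ i, (w i : ℝ) * θ ^ (i : ℕ) = 0 → w = 0 := by
    intro w hw
    by_contra hne
    set g : ℤ[X] := ∑ i : Fin d, monomial (i : ℕ) (w i) with hg
    have hgc : ∀ i : Fin d, g.coeff i = w i := by
      intro i
      rw [hg, finsetSum_coeff, Finset.sum_eq_single i]
      · simp
      · intro j _ hj
        rw [coeff_monomial, if_neg]
        intro h; exact hj (Fin.ext h)
      · simp
    have hg0 : g ≠ 0 := by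
      intro h
      apply hne
      funext i
      rw [← hgc i, h]; simp
    have hgθ : aeval θ g = 0 := by
      rw [hg, map_sum, ← hw]
      apply Finset.sum_congr rfl
      intro i _
      rw [aeval_monomial]; simp
    have hgd : g.degree < d := by
      rw [hg]
      refine (degree_sum_le _ _).trans_lt ?_
      rw [Finset.sup_lt_iff (by exact_mod_cast (WithBot.bot_lt_coe d))]
      intro i _
      refine (degree_monomial_le _ _).trans_lt ?_
      exact_mod_cast i.2
    have h1 := minpoly.degree_le_of_ne_zero ℚ θ (p := g.map (algebraMap ℤ ℚ))
      ((Polynomial.map_ne_zero_iff (algebraMap ℤ ℚ).injective_int).mpr hg0) (by rw [aeval_map_algebraMap]; exact hgθ)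
    rw [minpoly.isIntegrallyClosed_eq_field_fractions' ℚ hintC', hfm.degree_map,
      degree_map_eq_of_injective (algebraMap ℤ ℚ).injective_int, degree_eq_natDegree hfm.ne_zero] at h1
    exact absurd (h1.trans_lt hgd) (lt_irrefl _)
  let A : Matrix (Fin d) (Fin d) ℤ := fun i j => ((X ^ ((j : ℕ) + 1) : ℤ[X]) %ₘ f).coeff i
  let v : Fin d → ℝ := fun i => θ ^ (i : ℕ)
  have hv : ∀ j, ∑ i, v i * (A i j : ℝ) = θ * v j := by
    intro j
    have h1 : aeval θ ((X ^ ((j : ℕ) + 1) : ℤ[X]) %ₘ f) = θ ^ ((j:ℕ) + 1) := by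
      rw [aeval_modByMonic_eq_self_of_root hf0]; simp
    have h2 : ((X ^ ((j : ℕ) + 1) : ℤ[X]) %ₘ f).natDegree < d := by
      apply natDegree_modByMonic_lt _ hfm
      intro h; rw [h] at hd; simp at hd; omega
    rw [aeval_eq_sum_range' h2] at h1
    rw [Finset.sum_range] at h1
    simp only [v, A]
    rw [← pow_succ', ← h1]
    apply Finset.sum_congr rfl
    intro i _
    rw [zsmul_eq_mul]; ring
  refine ⟨a, d, A, v, ⟨0, hd0⟩, ha, hv, by simp [v], ?_⟩
  have har : (1:ℝ) ≤ |(a:ℝ)| := by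
    have := Int.one_le_abs ha
    exact_mod_cast this
  set K : ℝ := 1 + |(a:ℝ)| ^ 2 + |(a:ℝ)| * (∑ i, ∑ j, |(A i j : ℝ)|) + ∑ i, ∑ j, |((A ^ 2) i j : ℝ)| with hK
  have hle : ∀ M : Matrix (Fin d) (Fin d) ℤ, ∀ i j, |(M i j : ℝ)| ≤ ∑ i, ∑ j, |(M i j : ℝ)| := by
    intro M i j
    refine (Finset.single_le_sum (f := fun j => |(M i j : ℝ)|) (fun _ _ => abs_nonneg _) (Finset.mem_univ j)).trans ?_
    exact Finset.single_le_sum (f := fun i => ∑ j, |(M i j : ℝ)|)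
      (fun _ _ => Finset.sum_nonneg fun _ _ => abs_nonneg _) (Finset.mem_univ i)
  have hs0 : ∀ M : Matrix (Fin d) (Fin d) ℤ, 0 ≤ ∑ i, ∑ j, |(M i j : ℝ)| := fun M =>
    Finset.sum_nonneg fun _ _ => Finset.sum_nonneg fun _ _ => abs_nonneg _
  have hK1 : 1 ≤ K := by
    have := hs0 A; have := hs0 (A ^ 2)
    have : 0 ≤ |(a:ℝ)| * (∑ i, ∑ j, |(A i j : ℝ)|) := by positivity
    have : 0 ≤ |(a:ℝ)| ^ 2 := by positivity
    linarith
  set T : ℝ := ∑ i, |v i| with hT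
  have hT1 : 1 ≤ T := by
    have hv0 : |v ⟨0, hd0⟩| = 1 := by simp [v]
    rw [hT, ← hv0]
    exact Finset.single_le_sum (f := fun i => |v i|) (fun _ _ => abs_nonneg _) (Finset.mem_univ _)
  set F : ℝ := (d.factorial : ℝ) with hF
  have hF1 : 1 ≤ F := by rw [hF]; exact_mod_cast Nat.factorial_pos d
  refine ⟨|(a:ℝ)| ^ 2 * (T * (F * K ^ d)), d, ?_, ?_⟩
  · have h1 : 1 ≤ K ^ d := one_le_pow₀ hK1
    have h2 : (1:ℝ) ≤ |(a:ℝ)| ^ 2 := one_le_pow₀ har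
    have h3 : 1 ≤ F * K ^ d := by nlinarith
    have h4 : 1 ≤ T * (F * K ^ d) := by nlinarith
    nlinarith
  intro c0 c1 c2 H hH h0 h1 h2 hne
  set P : ℤ[X] := C (a ^ 2 * c0) + C (a * c1) * X + C c2 * X ^ 2 with hP
  have hPθ : aeval θ P = a ^ 2 * ((c0 : ℝ) + c1 * α + c2 * α ^ 2) := by
    rw [hP, hθ]; simp; ring
  have hPne : aeval θ P ≠ 0 := by
    rw [hPθ]
    have : (a:ℝ) ≠ 0 := by exact_mod_cast ha
    positivity
  set M : Matrix (Fin d) (Fin d) ℤ := aeval A P with hM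
  have hvM : ∀ j, ∑ i, v i * (M i j : ℝ) = aeval θ P * v j := vec_eval A θ v hv P
  have hMb : ∀ i j, |(M i j : ℝ)| ≤ K * H := by
    intro i j
    have e1 : (M i j : ℝ) = a ^ 2 * c0 * (if i = j then 1 else 0) + a * c1 * A i j + c2 * (A ^ 2) i j := by
      rw [hM, hP]
      simp only [map_add, map_mul, aeval_C, aeval_X, map_pow, Matrix.add_apply]
      rw [← map_mul, ← map_pow, ← map_mul, ← Algebra.smul_def, ← Algebra.smul_def, Matrix.algebraMap_matrix_apply]
      simp only [Matrix.smul_apply, smul_eq_mul]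
      split_ifs <;> simp
    rw [e1]
    have t1 : |(a:ℝ) ^ 2 * c0 * (if i = j then 1 else 0)| ≤ |(a:ℝ)| ^ 2 * H := by
      rw [abs_mul, abs_mul, abs_pow]
      have : |(if i = j then (1:ℝ) else 0)| ≤ 1 := by split_ifs <;> simp
      calc _ ≤ |(a:ℝ)| ^ 2 * H * 1 := by gcongr
        _ = _ := mul_one _
    have t2 : |(a:ℝ) * c1 * A i j| ≤ |(a:ℝ)| * H * ∑ i, ∑ j, |(A i j : ℝ)| := by
      rw [abs_mul, abs_mul]
      have := hle A i j
      gcongr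
    have t3 : |(c2:ℝ) * (A ^ 2) i j| ≤ H * ∑ i, ∑ j, |((A ^ 2) i j : ℝ)| := by
      rw [abs_mul]
      have := hle (A ^ 2) i j
      gcongr
    calc _ ≤ |(a:ℝ) ^ 2 * c0 * (if i = j then 1 else 0)| + |(a:ℝ) * c1 * A i j| + |(c2:ℝ) * (A ^ 2) i j| :=
          abs_add_three _ _ _
      _ ≤ _ := by rw [hK]; nlinarith
  have hdet : M.det ≠ 0 := by
    intro h
    obtain ⟨w, hw0, hw⟩ := Matrix.exists_mulVec_eq_zero_iff.mpr h
    apply hw0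
    apply hlow
    have e1 : ∑ j, (∑ i, v i * (M i j : ℝ)) * w j = 0 := by
      simp only [Finset.sum_mul]
      rw [Finset.sum_comm]
      apply Finset.sum_eq_zero
      intro i _
      have := congrFun hw i
      simp only [Matrix.mulVec, dotProduct, Pi.zero_apply] at this
      have h' : ∑ j, (M i j : ℝ) * w j = 0 := by exact_mod_cast this
      simp only [mul_assoc, ← Finset.mul_sum, h', mul_zero]
    simp only [hvM, mul_assoc, ← Finset.mul_sum] at e1
    have e2 := (mul_eq_zero.mp e1).resolve_left hPne
    rw [← e2]
    apply Finset.sum_congr rfl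
    intro i _; simp only [v]; ring
  have hadj : ∀ i j, |((M.adjugate i j : ℤ) : ℝ)| ≤ F * (K * H) ^ d := by
    intro i j
    rw [Matrix.adjugate_apply]
    have hKH : 1 ≤ K * H := by nlinarith
    have e1 : (((M.updateRow j (Pi.single i 1)).det : ℤ) : ℝ) =
        ((M.updateRow j (Pi.single i 1)).map (Int.castRingHom ℝ)).det :=
      ((Int.castRingHom ℝ).map_det _)
    rw [e1]
    have := Matrix.det_le (A := (M.updateRow j (Pi.single i 1)).map (Int.castRingHom ℝ))
      (abv := (AbsoluteValue.abs : AbsoluteValue ℝ ℝ)) (x := K * H) (by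
        intro i' j'
        show |_| ≤ _
        simp only [Matrix.map_apply, Matrix.updateRow_apply]
        split_ifs with hh
        · by_cases hj : j' = i
          · subst hj; simpa using hKH
          · simp [hj]; linarith
        · exact hMb i' j')
    rw [Fintype.card_fin, nsmul_eq_mul] at this
    exact this
  have hid : aeval θ P * ∑ j, v j * ((M.adjugate j ⟨0, hd0⟩ : ℤ) : ℝ) = M.det := by
    rw [Finset.mul_sum]
    simp only [← mul_assoc, ← hvM, Finset.sum_mul]
    rw [Finset.sum_comm]
    have e1 : ∀ i, ∑ j, (M i j : ℝ) * ((M.adjugate j ⟨0, hd0⟩ : ℤ) : ℝ) = if i = ⟨0, hd0⟩ then (M.det : ℝ) else 0 := by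
      intro i
      have := congrFun (congrFun (Matrix.mul_adjugate M) i) ⟨0, hd0⟩
      rw [Matrix.mul_apply, Matrix.smul_apply, Matrix.one_apply] at this
      have h' : ((∑ j, M i j * M.adjugate j ⟨0, hd0⟩ : ℤ) : ℝ) = ((M.det • (if i = ⟨0, hd0⟩ then (1:ℤ) else 0) : ℤ) : ℝ) := by rw [this]
      push_cast at h'
      rw [h']
      split_ifs <;> simp
    simp only [mul_assoc, ← Finset.mul_sum, e1]
    simp [v]
  have hsum : |∑ j, v j * ((M.adjugate j ⟨0, hd0⟩ : ℤ) : ℝ)| ≤ T * (F * (K * H) ^ d) := by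
    calc _ ≤ ∑ j, |v j * ((M.adjugate j ⟨0, hd0⟩ : ℤ) : ℝ)| := Finset.abs_sum_le_sum_abs _ _
      _ ≤ ∑ j, |v j| * (F * (K * H) ^ d) := by
          apply Finset.sum_le_sum
          intro j _
          rw [abs_mul]
          have := hadj j ⟨0, hd0⟩
          gcongr
      _ = _ := by rw [← Finset.sum_mul]
  have hone : (1:ℝ) ≤ |(M.det : ℝ)| := by
    have := Int.one_le_abs hdet
    exact_mod_cast this
  rw [← hid, abs_mul, hPθ, abs_mul, abs_pow] at hone
  calc (1:ℝ) ≤ _ := hone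
    _ ≤ |(a:ℝ)| ^ 2 * |(c0 : ℝ) + c1 * α + c2 * α ^ 2| * (T * (F * (K * H) ^ d)) := by gcongr
    _ = _ := by rw [mul_pow]; ring

end

section

/-- cross product -/
def cr {R : Type*} [CommRing R] (x y : Fin 3 → R) : Fin 3 → R :=
  ![x 1 * y 2 - x 2 * y 1, x 2 * y 0 - x 0 * y 2, x 0 * y 1 - x 1 * y 0]
/-- dot product -/
def dt {R : Type*} [CommRing R] (x y : Fin 3 → R) : R := x 0 * y 0 + x 1 * y 1 + x 2 * y 2
/-- squared norm -/
def n2 (x : Fin 3 → ℝ) : ℝ := x 0 ^ 2 + x 1 ^ 2 + x 2 ^ 2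
noncomputable def Mv (α q : ℝ) (y : Fin 3 → ℤ) : Fin 3 → ℝ :=
  ![Real.exp (-q) * y 0, y 1 - α * y 0, y 2 - α ^ 2 * y 0]
noncomputable def Nv (α q : ℝ) (c : Fin 3 → ℤ) : Fin 3 → ℝ :=
  ![Real.exp q * (c 0 + c 1 * α + c 2 * α ^ 2), c 1, c 2]
def Prim (c : Fin 3 → ℤ) : Prop := ∃ u : Fin 3 → ℤ, dt u c = 1

theorem n2_nonneg (x : Fin 3 → ℝ) : 0 ≤ n2 x := by unfold n2; positivity

theorem n2_coord (x : Fin 3 → ℝ) (i : Fin 3) : x i ^ 2 ≤ n2 x := by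
  have h0 := sq_nonneg (x 0)
  have h1 := sq_nonneg (x 1)
  have h2 := sq_nonneg (x 2)
  unfold n2
  fin_cases i <;> simp <;> linarith

theorem n2_smul (t : ℝ) (x : Fin 3 → ℝ) : n2 (t • x) = t ^ 2 * n2 x := by
  simp [n2]; ring

theorem M_cr (α q : ℝ) (y z : Fin 3 → ℤ) :
    cr (Mv α q y) (Mv α q z) = Real.exp (-q) • Nv α q (cr y z) := by
  have h : Real.exp (-q) * Real.exp q = 1 := by rw [← Real.exp_add]; simp
  ext i
  fin_cases i
  · simp only [cr, Mv, Nv, Fin.zero_eta, Fin.isValue, Matrix.cons_val_zero, Matrix.cons_val_one,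
      Matrix.cons_val, Pi.smul_apply, smul_eq_mul, Int.cast_sub, Int.cast_mul]
    rw [← mul_assoc, h]; ring
  · simp [cr, Mv, Nv]; ring
  · simp [cr, Mv, Nv]; ring

theorem N_cr (α q : ℝ) (y z : Fin 3 → ℤ) :
    cr (Nv α q y) (Nv α q z) = Real.exp q • Mv α q (cr y z) := by
  have h : Real.exp q * Real.exp (-q) = 1 := by rw [← Real.exp_add]; simp
  ext i
  fin_cases i
  · simp only [cr, Mv, Nv, Fin.zero_eta, Fin.isValue, Matrix.cons_val_zero, Matrix.cons_val_one,
      Matrix.cons_val, Pi.smul_apply, smul_eq_mul, Int.cast_sub, Int.cast_mul]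
    rw [← mul_assoc, h]; ring
  · simp [cr, Mv, Nv]; ring
  · simp [cr, Mv, Nv]; ring

theorem Mv_add (α q : ℝ) (y z : Fin 3 → ℤ) (k : ℤ) :
    Mv α q (y + k • z) = Mv α q y + (k : ℝ) • Mv α q z := by
  ext i
  fin_cases i <;> simp [Mv] <;> ring
theorem Nv_add (α q : ℝ) (y z : Fin 3 → ℤ) (k : ℤ) :
    Nv α q (y + k • z) = Nv α q y + (k : ℝ) • Nv α q z := by
  ext i
  fin_cases i <;> simp [Nv] <;> ring
theorem Mv_smul (α q : ℝ) (z : Fin 3 → ℤ) (k : ℤ) :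
    Mv α q (k • z) = (k : ℝ) • Mv α q z := by
  ext i
  fin_cases i <;> simp [Mv] <;> ring
theorem Nv_smul (α q : ℝ) (z : Fin 3 → ℤ) (k : ℤ) :
    Nv α q (k • z) = (k : ℝ) • Nv α q z := by
  ext i
  fin_cases i <;> simp [Nv] <;> ring

theorem reduce1 (u x : Fin 3 → ℝ) (hx : 0 < n2 x) :
    ∃ k : ℤ, n2 (u + (k : ℝ) • x) ≤ n2 (cr u x) / n2 x + n2 x / 4 := by
  refine ⟨-round (dt u x / n2 x), ?_⟩
  set k : ℤ := round (dt u x / n2 x) with hk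
  have h1 : |dt u x / n2 x - k| ≤ 1 / 2 := abs_sub_round _
  have h2 : (dt u x / n2 x - k) ^ 2 ≤ 1 / 4 := by
    rw [← sq_abs]; nlinarith [abs_nonneg (dt u x / n2 x - k)]
  have h3 : n2 (u + ((-k : ℤ) : ℝ) • x) = n2 (cr u x) / n2 x + (dt u x / n2 x - k) ^ 2 * n2 x := by
    have : n2 (u + ((-k : ℤ) : ℝ) • x) * n2 x = n2 (cr u x) + (dt u x - k * n2 x) ^ 2 := by
      simp [n2, cr, dt]; ring
    field_simp
    linarith
  rw [h3]; nlinarith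

theorem int3_ne {c : Fin 3 → ℤ} (hc : c ≠ 0) : c 0 ≠ 0 ∨ c 1 ≠ 0 ∨ c 2 ≠ 0 := by
  by_contra h
  push Not at h
  apply hc
  ext i
  fin_cases i <;> simp [h]

theorem n2_Nv_ge (α q : ℝ) (hq : 0 ≤ q) (c : Fin 3 → ℤ) (hc : c ≠ 0) : 1 ≤ n2 (Nv α q c) := by
  have hone : ∀ z : ℤ, z ≠ 0 → (1:ℝ) ≤ (z:ℝ) ^ 2 := by
    intro z hz
    have : 1 ≤ z ^ 2 := by have := sq_pos_of_ne_zero hz; omega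
    exact_mod_cast this
  by_cases h1 : c 1 = 0
  · by_cases h2 : c 2 = 0
    · have h0 : c 0 ≠ 0 := by
        rcases int3_ne hc with h | h | h <;> tauto
      have := n2_coord (Nv α q c) 0
      refine le_trans ?_ this
      simp only [Nv, h1, h2, Matrix.cons_val_zero, Int.cast_zero, zero_mul, add_zero, mul_pow]
      have e1 : 1 ≤ Real.exp q ^ 2 := one_le_pow₀ (Real.one_le_exp hq)
      nlinarith [hone _ h0]
    · exact (hone _ h2).trans (by simpa [Nv] using n2_coord (Nv α q c) 2)
  · exact (hone _ h1).trans (by simpa [Nv] using n2_coord (Nv α q c) 1)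

theorem n2_Mv_ge (α q : ℝ) (hq : 0 ≤ q) (c : Fin 3 → ℤ) (hc : c ≠ 0) :
    Real.exp (-q) ^ 2 ≤ n2 (Mv α q c) := by
  have hone : ∀ z : ℤ, z ≠ 0 → (1:ℝ) ≤ (z:ℝ) ^ 2 := by
    intro z hz
    have : 1 ≤ z ^ 2 := by have := sq_pos_of_ne_zero hz; omega
    exact_mod_cast this
  have e1 : Real.exp (-q) ^ 2 ≤ 1 := pow_le_one₀ (Real.exp_pos _).le (Real.exp_le_one_iff.mpr (by linarith))
  by_cases h0 : c 0 = 0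
  · by_cases h1 : c 1 = 0
    · have h2 : c 2 ≠ 0 := by
        rcases int3_ne hc with h | h | h <;> tauto
      exact e1.trans ((hone _ h2).trans (by simpa [Mv, h0] using n2_coord (Mv α q c) 2))
    · exact e1.trans ((hone _ h1).trans (by simpa [Mv, h0] using n2_coord (Mv α q c) 1))
  · have := n2_coord (Mv α q c) 0
    refine le_trans ?_ this
    simp only [Mv, Matrix.cons_val_zero, mul_pow]
    nlinarith [hone _ h0, sq_nonneg (Real.exp (-q))]

theorem approx_min {X : Type*} (S : Set X) (hS : S.Nonempty) (f : X → ℝ) (m : ℝ) (hm : 0 < m)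
    (hf : ∀ x ∈ S, m ≤ f x) : ∃ x ∈ S, ∀ y ∈ S, f x ≤ 2 * f y := by
  by_contra h
  push Not at h
  obtain ⟨x0, hx0⟩ := hS
  have hb : BddBelow (Set.image f S) := ⟨m, by rintro _ ⟨x, hx, rfl⟩; exact hf x hx⟩
  have hne : (Set.image f S).Nonempty := ⟨_, x0, hx0, rfl⟩
  have hi : m ≤ sInf (Set.image f S) := le_csInf hne (by rintro _ ⟨x, hx, rfl⟩; exact hf x hx)
  obtain ⟨_, ⟨x, hx, rfl⟩, hlt⟩ := exists_lt_of_csInf_lt hne (show sInf (Set.image f S) < 2 * sInf (Set.image f S) by linarith)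
  obtain ⟨y, hy, hxy⟩ := h x hx
  have := csInf_le hb ⟨y, hy, rfl⟩
  linarith

theorem exists_prim (c : Fin 3 → ℤ) (hc : c ≠ 0) :
    ∃ (d : ℤ) (c' : Fin 3 → ℤ), 0 < d ∧ c = d • c' ∧ Prim c' := by
  obtain ⟨g, hg⟩ : ∃ g : ℤ, g = ((Int.gcd (c 0) (Int.gcd (c 1) (c 2)) : ℕ) : ℤ) := ⟨_, rfl⟩
  have hg0 : g ≠ 0 := by
    intro h
    have h' : Int.gcd (c 0) (Int.gcd (c 1) (c 2)) = 0 := by rw [hg] at h; exact_mod_cast h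
    rw [Int.gcd_eq_zero_iff] at h'
    have h2 : Int.gcd (c 1) (c 2) = 0 := by exact_mod_cast h'.2
    rw [Int.gcd_eq_zero_iff] at h2
    rcases int3_ne hc with h | h | h
    · exact h h'.1
    · exact h h2.1
    · exact h h2.2
  have hgp : 0 < g := lt_of_le_of_ne (by rw [hg]; positivity) (Ne.symm hg0)
  have d0 : g ∣ c 0 := by rw [hg]; exact Int.gcd_dvd_left ..
  have d12 : g ∣ (Int.gcd (c 1) (c 2) : ℤ) := by rw [hg]; exact Int.gcd_dvd_right ..
  have d1 : g ∣ c 1 := d12.trans (Int.gcd_dvd_left ..)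
  have d2 : g ∣ c 2 := d12.trans (Int.gcd_dvd_right ..)
  obtain ⟨e0, h0⟩ := d0
  obtain ⟨e1, h1⟩ := d1
  obtain ⟨e2, h2⟩ := d2
  refine ⟨g, ![e0, e1, e2], hgp, ?_, ?_⟩
  · ext i
    fin_cases i <;> simp [h0, h1, h2]
  · have b1 := Int.gcd_eq_gcd_ab (c 0) (Int.gcd (c 1) (c 2))
    have b2 := Int.gcd_eq_gcd_ab (c 1) (c 2)
    refine ⟨![Int.gcdA (c 0) (Int.gcd (c 1) (c 2)),
      Int.gcdB (c 0) (Int.gcd (c 1) (c 2)) * Int.gcdA (c 1) (c 2),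
      Int.gcdB (c 0) (Int.gcd (c 1) (c 2)) * Int.gcdB (c 1) (c 2)], ?_⟩
    simp only [dt, Matrix.cons_val_zero, Matrix.cons_val_one, Matrix.cons_val]
    apply mul_left_cancel₀ hg0
    generalize Int.gcdA (c 0) (Int.gcd (c 1) (c 2)) = A at *
    generalize Int.gcdB (c 0) (Int.gcd (c 1) (c 2)) = B at *
    generalize Int.gcdA (c 1) (c 2) = A' at *
    generalize Int.gcdB (c 1) (c 2) = B' at *
    rw [← hg, b2] at b1
    have : g * 1 = g := mul_one g
    rw [this]
    conv_rhs => rw [b1]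
    have t0 : c 0 = g * e0 := h0
    have t1 : c 1 = g * e1 := h1
    have t2 : c 2 = g * e2 := h2
    linear_combination (-A) * t0 - B * A' * t1 - B * B' * t2

theorem Prim.ne_zero {c : Fin 3 → ℤ} (h : Prim c) : c ≠ 0 := by
  rintro rfl
  obtain ⟨u, hu⟩ := h
  simp [dt] at hu

theorem exists_orth (c : Fin 3 → ℤ) : ∃ y : Fin 3 → ℤ, y ≠ 0 ∧ dt c y = 0 := by
  by_cases h : c 0 = 0
  · refine ⟨![1, 0, 0], fun h => by simpa using congrFun h 0, by simp [dt, h]⟩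
  · refine ⟨![-c 1, c 0, 0], fun h' => h (by simpa using congrFun h' 1), by simp [dt]; ring⟩

theorem height_pair (c : Fin 3 → ℤ) (hc : Prim c) : ∃ i0 i1 : Fin 3, i0 ≠ i1 ∧ (∀ i, |c i| ≤ |c i0|) ∧
    ((Int.gcd (c i0) (c i1) : ℤ)) ^ 2 ≤ |c i0| := by
  obtain ⟨i0, -, h0⟩ := Finset.exists_max_image Finset.univ (fun i => |c i|) ⟨0, Finset.mem_univ _⟩
  have h0' : ∀ i, |c i| ≤ |c i0| := fun i => h0 i (Finset.mem_univ i)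
  have hne : c i0 ≠ 0 := by
    intro h
    apply hc.ne_zero
    ext i
    have := h0' i
    rw [h] at this
    simpa using this
  obtain ⟨u, hu⟩ := hc
  have key : ∀ a b : Fin 3, i0 ≠ a → i0 ≠ b → (∃ x y z : ℤ, x * c i0 + y * c a + z * c b = 1) →
      ∃ i1, i0 ≠ i1 ∧ ((Int.gcd (c i0) (c i1) : ℤ)) ^ 2 ≤ |c i0| := by
    rintro a b ha hb ⟨x, y, z, hxyz⟩
    have d1 : (Int.gcd (c i0) (c a) : ℤ) ∣ c i0 := Int.gcd_dvd_left ..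
    have d2 : (Int.gcd (c i0) (c b) : ℤ) ∣ c i0 := Int.gcd_dvd_left ..
    have e1 : (Int.gcd (c i0) (c a) : ℤ) ∣ c a := Int.gcd_dvd_right ..
    have e2 : (Int.gcd (c i0) (c b) : ℤ) ∣ c b := Int.gcd_dvd_right ..
    have hco : IsCoprime (Int.gcd (c i0) (c a) : ℤ) (Int.gcd (c i0) (c b) : ℤ) := by
      obtain ⟨s, hs⟩ := d1
      obtain ⟨t, ht⟩ := e1
      obtain ⟨r, hr⟩ := e2
      refine ⟨x * s + y * t, z * r, ?_⟩
      linear_combination hxyz - x * hs - y * ht - z * hr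
    have hd := hco.mul_dvd d1 d2
    have hle := Int.le_of_dvd (abs_pos.mpr hne) ((dvd_abs _ _).mpr hd)
    rcases le_total (Int.gcd (c i0) (c a) : ℤ) (Int.gcd (c i0) (c b) : ℤ) with h | h
    · exact ⟨a, ha, by nlinarith [Int.natCast_nonneg (Int.gcd (c i0) (c a))]⟩
    · exact ⟨b, hb, by nlinarith [Int.natCast_nonneg (Int.gcd (c i0) (c b))]⟩
  have : ∃ i1, i0 ≠ i1 ∧ ((Int.gcd (c i0) (c i1) : ℤ)) ^ 2 ≤ |c i0| := by
    unfold dt at hu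
    fin_cases i0
    · exact key 1 2 (by decide) (by decide) ⟨u 0, u 1, u 2, by simpa using hu⟩
    · exact key 0 2 (by decide) (by decide) ⟨u 1, u 0, u 2, by simp; linarith⟩
    · exact key 0 1 (by decide) (by decide) ⟨u 2, u 0, u 1, by simp; linarith⟩
  obtain ⟨i1, h1, h2⟩ := this
  exact ⟨i0, i1, h1, h0', h2⟩

theorem good3 (Λ : Fin 3 → Fin 3 → ℝ) (δ Cw κ S : ℝ) (w : Fin 3 → ℝ) (y z : Fin 3 → ℤ)
    (hw : ∀ i, |w i| ≤ Cw) (hs : ∑ i, w i ≤ -δ) (hp : Prim (cr y z))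
    (hh : ∃ i, Real.exp (2 * κ * S) ≤ |((cr y z i : ℤ) : ℝ)|)
    (hy : ∀ j, |∑ i, Λ j i * (y i : ℝ)| ≤ Real.exp (w j * S))
    (hz : ∀ j, |∑ i, Λ j i * (z i : ℝ)| ≤ Real.exp (w j * S)) : GoodAt Λ 0 δ Cw κ S := by
  obtain ⟨i0, i1, h01, hmax, hg⟩ := height_pair _ hp
  have hne : cr y z i0 ≠ 0 := by
    intro h
    apply hp.ne_zero
    ext i
    have := hmax i
    rw [h] at this
    simpa using this
  refine ⟨w, cr y z, i0, i1, Matrix.of ![fun i => if i = i0 then 1 else 0, y, z], hw, hs, h01, hne, ?_, ?_, ?_, ?_, ?_⟩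
  · obtain ⟨i, hi⟩ := hh
    have hm : |((cr y z i : ℤ) : ℝ)| ≤ |((cr y z i0 : ℤ) : ℝ)| := by exact_mod_cast hmax i
    have hgr : ((Int.gcd (cr y z i0) (cr y z i1) : ℕ) : ℝ) ^ 2 ≤ |((cr y z i0 : ℤ) : ℝ)| := by
      exact_mod_cast hg
    have he : Real.exp (2 * κ * S) = Real.exp (κ * S) ^ 2 := by
      rw [← Real.exp_nat_mul]; congr 1; push_cast; ring
    rw [he] at hi
    have hi2 := hi.trans hm
    apply le_of_sq_le_sq _ (abs_nonneg _)
    rw [mul_pow, sq |((cr y z i0 : ℤ) : ℝ)|]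
    exact mul_le_mul hi2 hgr (by positivity) (abs_nonneg _)
  · have : Matrix.det (Matrix.of ![fun i => if i = i0 then 1 else 0, y, z]) = cr y z i0 := by
      rw [Matrix.det_fin_three]
      fin_cases i0 <;> simp [cr] <;> ring
    rw [this]; exact hne
  · intro i; rfl
  · intro k hk
    fin_cases k
    · exact absurd rfl hk
    · simp [Fin.sum_univ_three, cr]; ring
    · simp [Fin.sum_univ_three, cr]; ring
  · intro k hk j
    fin_cases k
    · exact absurd rfl hk
    · exact hy j
    · exact hz j

end

section
open Polynomial

theorem n2_abs (x : Fin 3 → ℝ) (t : ℝ) (h : n2 x ≤ Real.exp (2 * t)) (i : Fin 3) : |x i| ≤ Real.exp t := by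
  have h1 := (n2_coord x i).trans h
  have he : Real.exp (2 * t) = Real.exp t ^ 2 := by
    rw [← Real.exp_nat_mul]; norm_num
  rw [he, ← sq_abs] at h1
  exact le_of_sq_le_sq h1 (Real.exp_pos _).le

theorem PT3a (α : ℝ) (hα : IsAlgebraic ℚ α) (δ κ : ℝ) (hδ : 0 < δ) (hκ : 0 < κ) :
    ∃ Q : ℝ, ∀ q, Q ≤ q → ∀ y z : Fin 3 → ℤ, Prim (cr y z) →
      (∃ i, Real.exp (2 * κ * q) ≤ |((cr y z i : ℤ) : ℝ)|) →
      n2 (Mv α q y) ≤ Real.exp (2 * (-q / 3 - δ * q)) →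
      n2 (Mv α q z) ≤ Real.exp (2 * (-q / 3 - δ * q)) → False := by
  obtain ⟨a, d, A, v, e0, ha, hv, hv0, -⟩ := nf_data α hα
  set Λ : Fin 3 → Fin 3 → ℝ := ![![1, 0, 0], ![-α, 1, 0], ![-α ^ 2, 0, 1]] with hΛ
  set β : Fin 3 → Fin 3 → ℤ[X] := ![![C (a ^ 2), 0, 0], ![C a * X, C (a ^ 2), 0], ![X ^ 2, 0, C (a ^ 2)]] with hβ
  obtain ⟨S0, hS0⟩ := PT β A (a * α) v e0 hv hv0 Λ (a ^ 2) (pow_ne_zero _ ha) (by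
    intro i k
    fin_cases i <;> fin_cases k <;> simp [hβ, hΛ, Fin.sum_univ_three] <;> ring) 0 (3 * δ) (1 + δ) κ
    (by positivity) (by positivity) hκ
  refine ⟨S0, fun q hq y z hp hh hy hz => hS0 q hq ?_⟩
  have main : ∀ y : Fin 3 → ℤ, n2 (Mv α q y) ≤ Real.exp (2 * (-q / 3 - δ * q)) →
      ∀ j, |∑ i, Λ j i * (y i : ℝ)| ≤ Real.exp ((![2/3 - δ, -1/3 - δ, -1/3 - δ] : Fin 3 → ℝ) j * q) := by
    intro y hy j
    fin_cases j
    · have := n2_abs _ _ hy 0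
      simp only [Mv, Matrix.cons_val_zero, abs_mul, Real.abs_exp] at this
      simp only [hΛ, Fin.sum_univ_three]
      simp
      have h2 := mul_le_mul_of_nonneg_left this (Real.exp_pos q).le
      rw [← mul_assoc, ← Real.exp_add, ← Real.exp_add] at h2
      simp only [add_neg_cancel, Real.exp_zero, one_mul] at h2
      refine h2.trans (le_of_eq ?_)
      congr 1; ring
    · have := n2_abs _ _ hy 1
      simp only [Mv] at this
      simp only [hΛ, Fin.sum_univ_three]
      simp at this ⊢
      convert this using 2 <;> ring
    · have := n2_abs _ _ hy 2
      simp only [Mv] at this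
      simp only [hΛ, Fin.sum_univ_three]
      simp at this ⊢
      convert this using 2 <;> ring
  refine good3 Λ _ _ _ _ ![2/3 - δ, -1/3 - δ, -1/3 - δ] y z ?_ ?_ hp hh (main y hy) (main z hz)
  · intro i
    rw [abs_le]
    fin_cases i <;> simp <;> constructor <;> linarith
  · simp [Fin.sum_univ_three]; linarith

theorem PT3b (α : ℝ) (hα : IsAlgebraic ℚ α) (δ κ : ℝ) (hδ : 0 < δ) (hκ : 0 < κ) :
    ∃ Q : ℝ, ∀ q, Q ≤ q → ∀ y z : Fin 3 → ℤ, Prim (cr y z) →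
      (∃ i, Real.exp (2 * κ * q) ≤ |((cr y z i : ℤ) : ℝ)|) →
      n2 (Nv α q y) ≤ Real.exp (2 * (q / 3 - δ * q)) →
      n2 (Nv α q z) ≤ Real.exp (2 * (q / 3 - δ * q)) → False := by
  obtain ⟨a, d, A, v, e0, ha, hv, hv0, -⟩ := nf_data α hα
  set Λ : Fin 3 → Fin 3 → ℝ := ![![1, α, α ^ 2], ![0, 1, 0], ![0, 0, 1]] with hΛ
  set β : Fin 3 → Fin 3 → ℤ[X] := ![![C (a ^ 2), -C a * X, -X ^ 2], ![0, C (a ^ 2), 0], ![0, 0, C (a ^ 2)]] with hβ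
  obtain ⟨S0, hS0⟩ := PT β A (a * α) v e0 hv hv0 Λ (a ^ 2) (pow_ne_zero _ ha) (by
    intro i k
    fin_cases i <;> fin_cases k <;> simp [hβ, hΛ, Fin.sum_univ_three] <;> ring) 0 (3 * δ) (1 + δ) κ
    (by positivity) (by positivity) hκ
  refine ⟨S0, fun q hq y z hp hh hy hz => hS0 q hq ?_⟩
  have main : ∀ y : Fin 3 → ℤ, n2 (Nv α q y) ≤ Real.exp (2 * (q / 3 - δ * q)) →
      ∀ j, |∑ i, Λ j i * (y i : ℝ)| ≤ Real.exp ((![-2/3 - δ, 1/3 - δ, 1/3 - δ] : Fin 3 → ℝ) j * q) := by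
    intro y hy j
    fin_cases j
    · have := n2_abs _ _ hy 0
      simp only [Nv, Matrix.cons_val_zero, abs_mul, Real.abs_exp] at this
      simp only [hΛ, Fin.sum_univ_three]
      have h2 := mul_le_mul_of_nonneg_left this (Real.exp_pos (-q)).le
      rw [← mul_assoc, ← Real.exp_add, ← Real.exp_add] at h2
      simp only [neg_add_cancel, Real.exp_zero, one_mul] at h2
      refine le_trans (le_of_eq ?_) (h2.trans (le_of_eq ?_))
      · simp; congr 1; ring
      · congr 1; simp; ring
    · have := n2_abs _ _ hy 1
      simp only [Nv] at this
      simp only [hΛ, Fin.sum_univ_three]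
      simp at this ⊢
      convert this using 2; ring
    · have := n2_abs _ _ hy 2
      simp only [Nv] at this
      simp only [hΛ, Fin.sum_univ_three]
      simp at this ⊢
      convert this using 2; ring
  refine good3 Λ _ _ _ _ ![-2/3 - δ, 1/3 - δ, 1/3 - δ] y z ?_ ?_ hp hh (main y hy) (main z hz)
  · intro i
    rw [abs_le]
    fin_cases i <;> simp <;> constructor <;> linarith
  · simp [Fin.sum_univ_three]; linarith

/-- Moebius contradiction -/
theorem moebius_contra (P R E B x ρ : ℝ) (hP : 0 ≤ P) (hR : 0 ≤ R) (hE : 0 ≤ E) (hB : 0 ≤ B)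
    (hx : 0 < x) (hρ : 4 ≤ ρ) (hpos : ∀ t, 0 < t → 0 < P * t + R) (hpos' : ∀ t, 0 < t → 0 < E * t + B)
    (h0 : 4 * ((P * (ρ * x) + R) / (E * (ρ * x) + B)) ≤ (P * x + R) / (E * x + B))
    (h1 : 4 * ((P * (ρ * x) + R) / (E * (ρ * x) + B)) ≤
      ρ * ((P * (ρ ^ 2 * x) + R) / (E * (ρ ^ 2 * x) + B)))
    (h2 : 4 * ((P * (ρ ^ 3 * x) + R) / (E * (ρ ^ 3 * x) + B)) ≤
      (P * (ρ ^ 2 * x) + R) / (E * (ρ ^ 2 * x) + B)) : False := by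
  have hρ0 : 0 < ρ := by linarith
  have a0 := hpos x hx
  have a1 := hpos (ρ * x) (by positivity)
  have a2 := hpos (ρ ^ 2 * x) (by positivity)
  have a3 := hpos (ρ ^ 3 * x) (by positivity)
  have b0 := hpos' x hx
  have b1 := hpos' (ρ * x) (by positivity)
  have b2 := hpos' (ρ ^ 2 * x) (by positivity)
  have b3 := hpos' (ρ ^ 3 * x) (by positivity)
  rw [← mul_div_assoc, div_le_div_iff₀ b1 b0] at h0
  rw [← mul_div_assoc, ← mul_div_assoc, div_le_div_iff₀ b1 b2] at h1
  rw [← mul_div_assoc, div_le_div_iff₀ b3 b2] at h2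
  have hEx : 0 ≤ E * x := by positivity
  have hPx : 0 ≤ P * x := by positivity
  have m1 : P * x + R ≤ P * (ρ * x) + R := by nlinarith
  -- N grows by 4 on the first interval
  have s1 : 4 * (E * x + B) ≤ E * (ρ * x) + B := by
    by_contra hc
    push Not at hc
    have : (P * x + R) * (E * (ρ * x) + B) < (P * (ρ * x) + R) * (4 * (E * x + B)) := by
      apply mul_lt_mul' m1 hc b1.le a1
    linarith
  have s1' : B ≤ E * (ρ * x) := by nlinarith
  -- D grows by 2 on the second
  have s2 : 2 * (P * (ρ * x) + R) ≤ P * (ρ ^ 2 * x) + R := by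
    have g : ρ * (E * (ρ * x) + B) ≤ 2 * (E * (ρ ^ 2 * x) + B) := by nlinarith
    by_contra hc
    push Not at hc
    have h3 : ρ * (P * (ρ ^ 2 * x) + R) * (E * (ρ * x) + B) ≤ (P * (ρ ^ 2 * x) + R) * (2 * (E * (ρ ^ 2 * x) + B)) := by
      nlinarith
    have h4 : (P * (ρ ^ 2 * x) + R) * (2 * (E * (ρ ^ 2 * x) + B)) < 2 * (P * (ρ * x) + R) * (2 * (E * (ρ ^ 2 * x) + B)) := by
      apply mul_lt_mul_of_pos_right hc; linarith
    linarith
  have s2' : R ≤ P * (ρ ^ 2 * x) := by nlinarith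
  have s3 : ρ * (P * (ρ ^ 2 * x) + R) ≤ 2 * (P * (ρ ^ 3 * x) + R) := by nlinarith
  have s4 : E * (ρ ^ 3 * x) + B ≤ ρ * (E * (ρ ^ 2 * x) + B) := by nlinarith
  have h5 : (P * (ρ ^ 2 * x) + R) * (E * (ρ ^ 3 * x) + B) ≤ (P * (ρ ^ 2 * x) + R) * (ρ * (E * (ρ ^ 2 * x) + B)) :=
    mul_le_mul_of_nonneg_left s4 a2.le
  have h6 : ρ * (P * (ρ ^ 2 * x) + R) * (E * (ρ ^ 2 * x) + B) ≤ 2 * (P * (ρ ^ 3 * x) + R) * (E * (ρ ^ 2 * x) + B) :=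
    mul_le_mul_of_nonneg_right s3 b2.le
  have h7 : 0 < (P * (ρ ^ 3 * x) + R) * (E * (ρ ^ 2 * x) + B) := mul_pos a3 b2
  nlinarith

end

section

theorem exp_sq' (t : ℝ) : Real.exp t ^ 2 = Real.exp (2 * t) := by
  rw [← Real.exp_nat_mul]; norm_num

theorem cr_add_smul (y z : Fin 3 → ℤ) (k : ℤ) : cr y (z + k • y) = cr y z := by
  ext i
  fin_cases i <;> simp [cr] <;> ring

theorem n2_cr_swap (x y : Fin 3 → ℝ) : n2 (cr x y) = n2 (cr y x) := by
  simp [n2, cr]; ring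

theorem complM (α q : ℝ) (hq : 0 ≤ q) (c y : Fin 3 → ℤ) (hy : Prim y) (hcy : dt c y = 0) :
    ∃ z, cr y z = c ∧ n2 (Mv α q z) ≤
      Real.exp (-2 * q) * n2 (Nv α q c) / n2 (Mv α q y) + n2 (Mv α q y) / 4 := by
  obtain ⟨u, hu⟩ := id hy
  have hpos : 0 < n2 (Mv α q y) := lt_of_lt_of_le (by positivity) (n2_Mv_ge α q hq y hy.ne_zero)
  obtain ⟨k, hk⟩ := reduce1 (Mv α q (cr c u)) (Mv α q y) hpos
  have hc : cr y (cr c u) = c := by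
    simp only [dt] at hu hcy
    ext i
    fin_cases i
    · simp [cr]; linear_combination c 0 * hu - u 0 * hcy
    · simp [cr]; linear_combination c 1 * hu - u 1 * hcy
    · simp [cr]; linear_combination c 2 * hu - u 2 * hcy
  refine ⟨cr c u + k • y, by rw [cr_add_smul, hc], ?_⟩
  rw [Mv_add]
  rw [n2_cr_swap, M_cr, hc, n2_smul, exp_sq', show 2 * -q = -2 * q by ring] at hk
  exact hk

theorem complN (α q : ℝ) (hq : 0 ≤ q) (c y : Fin 3 → ℤ) (hc : Prim c) (hcy : dt c y = 0) :
    ∃ z, cr c z = y ∧ n2 (Nv α q z) ≤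
      Real.exp (2 * q) * n2 (Mv α q y) / n2 (Nv α q c) + n2 (Nv α q c) / 4 := by
  obtain ⟨u, hu⟩ := id hc
  have hpos : 0 < n2 (Nv α q c) := lt_of_lt_of_le (by positivity) (n2_Nv_ge α q hq c hc.ne_zero)
  obtain ⟨k, hk⟩ := reduce1 (Nv α q (cr y u)) (Nv α q c) hpos
  have hc : cr c (cr y u) = y := by
    simp only [dt] at hu hcy
    ext i
    fin_cases i
    · simp [cr]; linear_combination y 0 * hu - u 0 * hcy
    · simp [cr]; linear_combination y 1 * hu - u 1 * hcy
    · simp [cr]; linear_combination y 2 * hu - u 2 * hcy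
  refine ⟨cr y u + k • c, by rw [cr_add_smul, hc], ?_⟩
  rw [Nv_add]
  rw [n2_cr_swap, N_cr, hc, n2_smul, exp_sq'] at hk
  exact hk

noncomputable def mu (α q : ℝ) (c y : Fin 3 → ℤ) : ℝ :=
  Real.exp (-2 * q) * n2 (Nv α q c) / n2 (Mv α q y)

theorem dichot (α : ℝ) (hα : IsAlgebraic ℚ α) (δ κ : ℝ) (hδ : 0 < δ) (hκ : 0 < κ) :
    ∃ Q : ℝ, 0 ≤ Q ∧ ∀ q, Q ≤ q → ∀ c y : Fin 3 → ℤ, Prim c → Prim y → dt c y = 0 →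
      (∃ i, Real.exp (2 * κ * q) ≤ |(c i : ℝ)|) → (∃ i, Real.exp (2 * κ * q) ≤ |(y i : ℝ)|) →
      (n2 (Mv α q y) ≤ Real.exp (2 * (-q / 3 - δ * q)) → Real.exp (2 * (-q / 3 - δ * q)) < 2 * mu α q c y) ∧
      (n2 (Nv α q c) ≤ Real.exp (2 * (q / 3 - δ * q)) →
        mu α q c y < 2 * Real.exp (2 * (-q / 3 + δ * q))) := by
  obtain ⟨Qa, ha⟩ := PT3a α hα δ κ hδ hκ
  obtain ⟨Qb, hb⟩ := PT3b α hα δ κ hδ hκ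
  refine ⟨max 0 (max Qa Qb), le_max_left _ _, ?_⟩
  intro q hq c y hc hy hcy hch hyh
  have hq0 : 0 ≤ q := (le_max_left _ _).trans hq
  have hqa : Qa ≤ q := (le_max_left _ _).trans ((le_max_right _ _).trans hq)
  have hqb : Qb ≤ q := (le_max_right _ _).trans ((le_max_right _ _).trans hq)
  have pM : 0 < n2 (Mv α q y) := lt_of_lt_of_le (by positivity) (n2_Mv_ge α q hq0 y hy.ne_zero)
  have pN : 0 < n2 (Nv α q c) := lt_of_lt_of_le (by positivity) (n2_Nv_ge α q hq0 c hc.ne_zero)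
  constructor
  · intro h
    by_contra hlt
    push Not at hlt
    obtain ⟨z, hz, hz2⟩ := complM α q hq0 c y hy hcy
    unfold mu at hlt
    refine ha q hqa y z (by rw [hz]; exact hc) (by rw [hz]; exact hch) h ?_
    linarith [Real.exp_pos (2 * (-q / 3 - δ * q))]
  · intro h
    by_contra hlt
    push Not at hlt
    obtain ⟨z, hz, hz2⟩ := complN α q hq0 c y hc hcy
    refine hb q hqb c z (by rw [hz]; exact hy) (by rw [hz]; exact hyh) h ?_
    have e1 : Real.exp (2 * q) * n2 (Mv α q y) / n2 (Nv α q c) = (mu α q c y)⁻¹ := by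
      unfold mu
      rw [show -2 * q = -(2 * q) by ring, Real.exp_neg]
      field_simp
    have e2 : (mu α q c y)⁻¹ ≤ Real.exp (2 * (q / 3 - δ * q)) / 2 := by
      have h3 : (mu α q c y)⁻¹ ≤ (2 * Real.exp (2 * (-q / 3 + δ * q)))⁻¹ :=
        inv_anti₀ (by positivity) hlt
      refine h3.trans (le_of_eq ?_)
      rw [mul_inv, ← Real.exp_neg, show -(2 * (-q / 3 + δ * q)) = 2 * (q / 3 - δ * q) by ring]
      ring
    rw [e1] at hz2
    linarith [Real.exp_pos (2 * (q / 3 - δ * q))]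

theorem mu_eq (α q : ℝ) (c y : Fin 3 → ℤ) : mu α q c y =
    (((c 0 : ℝ) + c 1 * α + c 2 * α ^ 2) ^ 2 * Real.exp (2 * q) + ((c 1 : ℝ) ^ 2 + (c 2 : ℝ) ^ 2)) /
    ((((y 1 : ℝ) - α * y 0) ^ 2 + ((y 2 : ℝ) - α ^ 2 * y 0) ^ 2) * Real.exp (2 * q) + (y 0 : ℝ) ^ 2) := by
  have e1 : n2 (Nv α q c) = ((c 0 : ℝ) + c 1 * α + c 2 * α ^ 2) ^ 2 * Real.exp (2 * q) + ((c 1 : ℝ) ^ 2 + (c 2 : ℝ) ^ 2) := by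
    simp only [n2, Nv, Matrix.cons_val_zero, Matrix.cons_val_one, Matrix.cons_val, mul_pow, exp_sq']
    ring
  have e2 : n2 (Mv α q y) = Real.exp (-2 * q) * ((((y 1 : ℝ) - α * y 0) ^ 2 + ((y 2 : ℝ) - α ^ 2 * y 0) ^ 2) * Real.exp (2 * q) + (y 0 : ℝ) ^ 2) := by
    have h : Real.exp (-2 * q) * Real.exp (2 * q) = 1 := by rw [← Real.exp_add]; simp
    simp only [n2, Mv, Matrix.cons_val_zero, Matrix.cons_val_one, Matrix.cons_val, mul_pow, exp_sq']
    rw [show 2 * -q = -2 * q by ring]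
    linear_combination (-(((y 1 : ℝ) - α * y 0) ^ 2 + ((y 2 : ℝ) - α ^ 2 * y 0) ^ 2)) * h
  unfold mu
  rw [e1, e2, mul_div_mul_left _ _ (Real.exp_pos _).ne']

theorem heights (α : ℝ) (hα : IsAlgebraic ℚ α)
    (hind : ∀ c : Fin 3 → ℤ, c ≠ 0 → (c 0 : ℝ) + c 1 * α + c 2 * α ^ 2 ≠ 0) :
    ∃ κ > 0, ∃ Q : ℝ, 0 ≤ Q ∧ ∀ q, Q ≤ q → (∀ c : Fin 3 → ℤ, c ≠ 0 → n2 (Nv α q c) ≤ Real.exp q →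
      ∃ i, Real.exp (κ * q) ≤ |(c i : ℝ)|) ∧
      (∀ y : Fin 3 → ℤ, y ≠ 0 → n2 (Mv α q y) ≤ Real.exp (-q / 3) →
      ∃ i, Real.exp (κ * q) ≤ |(y i : ℝ)|) := by
  obtain ⟨-, -, -, -, -, -, -, -, C, k, hC, hL⟩ := nf_data α hα
  have hk : (0:ℝ) < k + 1 := by positivity
  refine ⟨1 / (12 * (k + 1)), by positivity, max 1 (12 * Real.log C + 1), by positivity, ?_⟩
  intro q hq
  have hq0 : 0 < q := lt_of_lt_of_le one_pos ((le_max_left _ _).trans hq)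
  have hqC : 12 * Real.log C + 1 ≤ q := (le_max_right _ _).trans hq
  have key : ∀ c0 c1 c2 : ℤ, |(c0:ℝ)| ≤ Real.exp (1 / (12 * (k + 1)) * q) →
      |(c1:ℝ)| ≤ Real.exp (1 / (12 * (k + 1)) * q) → |(c2:ℝ)| ≤ Real.exp (1 / (12 * (k + 1)) * q) →
      (c0 : ℝ) + c1 * α + c2 * α ^ 2 ≠ 0 → |(c0 : ℝ) + c1 * α + c2 * α ^ 2| ≤ Real.exp (- q / 6) → False := by
    intro c0 c1 c2 h0 h1 h2 hne hle
    have := hL c0 c1 c2 _ (Real.one_le_exp (by positivity)) h0 h1 h2 hne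
    have hpow : Real.exp (1 / (12 * (k + 1)) * q) ^ k ≤ Real.exp (q / 12) := by
      rw [← Real.exp_nat_mul]
      apply Real.exp_le_exp.mpr
      have : (k:ℝ) * (1 / (12 * (k + 1)) * q) = (k / (k + 1)) * (q / 12) := by field_simp
      rw [this]
      have : (k:ℝ) / (k + 1) ≤ 1 := by rw [div_le_one hk]; linarith
      nlinarith
    have h3 : C * Real.exp (1 / (12 * (k + 1)) * q) ^ k * |(c0 : ℝ) + c1 * α + c2 * α ^ 2| ≤
        C * Real.exp (q / 12) * Real.exp (-q / 6) := by gcongr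
    have h4 : C * Real.exp (q / 12) * Real.exp (-q / 6) < 1 := by
      rw [← Real.exp_log (by linarith : 0 < C), ← Real.exp_add, ← Real.exp_add, Real.exp_lt_one_iff]
      linarith
    linarith
  constructor
  · intro c hc hn
    by_contra hcon
    push Not at hcon
    refine key (c 0) (c 1) (c 2) (hcon 0).le (hcon 1).le (hcon 2).le (hind c hc) ?_
    have h := n2_abs (Nv α q c) (q / 2) (by rw [show 2 * (q / 2) = q by ring]; exact hn) 0
    simp only [Nv, Matrix.cons_val_zero, abs_mul, Real.abs_exp] at h
    have h2 := mul_le_mul_of_nonneg_left h (Real.exp_pos (-q)).le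
    rw [← mul_assoc, ← Real.exp_add, ← Real.exp_add] at h2
    simp only [neg_add_cancel, Real.exp_zero, one_mul] at h2
    exact h2.trans (Real.exp_le_exp.mpr (by linarith))
  · intro y hy hn
    by_contra hcon
    push Not at hcon
    have hab := n2_abs (Mv α q y) (-q / 6) (by rw [show 2 * (-q / 6) = -q / 3 by ring]; exact hn)
    have hne : (![y 1, -y 0, 0] : Fin 3 → ℤ) ≠ 0 := by
      intro h
      have z1 : y 1 = 0 := by simpa using congrFun h 0
      have z0 : y 0 = 0 := by simpa using congrFun h 1
      have z2 : y 2 ≠ 0 := by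
        rcases int3_ne hy with h | h | h <;> tauto
      have := hab 2
      simp [Mv, z0] at this
      have h1 : (1:ℝ) ≤ |(y 2 : ℝ)| := by exact_mod_cast Int.one_le_abs z2
      have h2 : Real.exp (-q / 6) < 1 := by rw [Real.exp_lt_one_iff]; linarith
      linarith
    have hf := hind _ hne
    have h1 := hab 1
    refine key (y 1) (-y 0) 0 (hcon 1).le (by simpa using (hcon 0).le) (by simpa using (Real.exp_pos _).le) (by simpa using hf) ?_
    simp [Mv] at h1
    refine le_trans (le_of_eq ?_) h1
    congr 1; push_cast; ring

end

section

theorem dt_cr_self (y z : Fin 3 → ℤ) : dt (cr y z) z = 0 := by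
  simp [dt, cr]; ring
theorem dt_cr_self' (y z : Fin 3 → ℤ) : dt (cr y z) y = 0 := by
  simp [dt, cr]; ring

theorem min_prim (f : (Fin 3 → ℤ) → ℝ) (S : Set (Fin 3 → ℤ)) (hS : S.Nonempty) (h0 : ∀ y ∈ S, y ≠ 0)
    (m : ℝ) (hm : 0 < m) (hf : ∀ y ∈ S, m ≤ f y) (hsc : ∀ (d : ℤ) y, f (d • y) = (d:ℝ) ^ 2 * f y)
    (hdiv : ∀ (d : ℤ) y, 0 < d → d • y ∈ S → y ∈ S) :
    ∃ y ∈ S, Prim y ∧ ∀ z ∈ S, f y ≤ 2 * f z := by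
  obtain ⟨y, hy, hmin⟩ := approx_min S hS f m hm hf
  obtain ⟨d, y', hd, rfl, hp⟩ := exists_prim y (h0 y hy)
  have hy' := hdiv d y' hd hy
  have h1 := hmin y' hy'
  rw [hsc] at h1
  have h2 := hf y' hy'
  have hd1 : d = 1 := by
    by_contra hne
    have : (2:ℝ) ≤ d := by exact_mod_cast (by omega : 2 ≤ d)
    have h3 : (4:ℝ) ≤ (d:ℝ) ^ 2 := by nlinarith
    nlinarith
  subst hd1
  refine ⟨_, hy, by simpa using hp, hmin⟩

theorem min_orth (α q : ℝ) (hq : 0 ≤ q) (c : Fin 3 → ℤ) (hc : c ≠ 0) :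
    ∃ y, Prim y ∧ dt c y = 0 ∧ n2 (Mv α q y) ≤ 4 * mu α q c y := by
  obtain ⟨y, ⟨hy0, hyc⟩, hp, hmin⟩ := min_prim (fun y => n2 (Mv α q y)) {y | y ≠ 0 ∧ dt c y = 0}
    (exists_orth c) (fun y hy => hy.1) (Real.exp (-q) ^ 2) (by positivity)
    (fun y hy => n2_Mv_ge α q hq y hy.1) (fun d y => by
      show n2 (Mv α q (d • y)) = _
      rw [Mv_smul, n2_smul]) (by
      rintro d y hd ⟨h1, h2⟩
      refine ⟨fun h => h1 (by simp [h]), ?_⟩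
      have : dt c (d • y) = d * dt c y := by simp [dt]; ring
      rw [this] at h2
      exact (mul_eq_zero.mp h2).resolve_left hd.ne')
  obtain ⟨z, hz, hz2⟩ := complM α q hq c y hp hyc
  refine ⟨y, hp, hyc, ?_⟩
  have hzS : z ≠ 0 ∧ dt c z = 0 := by
    refine ⟨?_, by rw [← hz]; exact dt_cr_self y z⟩
    rintro rfl
    apply hc
    rw [← hz]
    ext i; fin_cases i <;> simp [cr]
  have := hmin z hzS
  unfold mu
  linarith

theorem Mv_mono (α q q' : ℝ) (h : q' ≤ q) (y : Fin 3 → ℤ) :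
    n2 (Mv α q' y) ≤ Real.exp (2 * (q - q')) * n2 (Mv α q y) := by
  have he : Real.exp (2 * (q - q')) * Real.exp (-q) ^ 2 = Real.exp (-q') ^ 2 := by
    rw [exp_sq', exp_sq', ← Real.exp_add]; ring_nf
  have h1 : 1 ≤ Real.exp (2 * (q - q')) := Real.one_le_exp (by linarith)
  simp only [n2, Mv, Matrix.cons_val_zero, Matrix.cons_val_one, Matrix.cons_val, mul_pow]
  rw [← he]
  have g1 := mul_nonneg (sub_nonneg.mpr h1) (sq_nonneg ((y 1 : ℝ) - α * y 0))
  have g2 := mul_nonneg (sub_nonneg.mpr h1) (sq_nonneg ((y 2 : ℝ) - α ^ 2 * y 0))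
  linarith

theorem Nv_mono (α q q' : ℝ) (h : q' ≤ q) (c : Fin 3 → ℤ) : n2 (Nv α q' c) ≤ n2 (Nv α q c) := by
  have h1 : Real.exp q' ≤ Real.exp q := Real.exp_le_exp.mpr h
  have h2 : Real.exp q' ^ 2 ≤ Real.exp q ^ 2 := by gcongr
  simp only [n2, Nv, Matrix.cons_val_zero, Matrix.cons_val_one, Matrix.cons_val, mul_pow]
  have := mul_nonneg (sub_nonneg.mpr h2) (sq_nonneg ((c 0 : ℝ) + c 1 * α + c 2 * α ^ 2))
  linarith

set_option maxHeartbeats 2000000 in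
theorem S3 (α : ℝ) (hα : IsAlgebraic ℚ α)
    (hind : ∀ c : Fin 3 → ℤ, c ≠ 0 → (c 0 : ℝ) + c 1 * α + c 2 * α ^ 2 ≠ 0) (θ0 : ℝ) (hθ0 : 0 < θ0) :
    ∃ Q : ℝ, 0 ≤ Q ∧ ∀ q, Q ≤ q → ∀ c : Fin 3 → ℤ, c ≠ 0 →
      Real.exp (2 * (q / 3 - θ0 * q)) ≤ n2 (Nv α q c) := by
  obtain ⟨κ, hκ, Q1, hQ1, hH⟩ := heights α hα hind
  set θ := min θ0 (1 / 3) with hθ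
  have hθp : 0 < θ := by positivity
  have hθ1 : θ ≤ 1 / 3 := min_le_right _ _
  have hθ2 : θ ≤ θ0 := min_le_left _ _
  set s := θ / 40 with hs
  set δ := s / 12 with hδ
  have hsp : 0 < s := by positivity
  have hδp : 0 < δ := by positivity
  obtain ⟨Q2, hQ2, hD⟩ := dichot α hα δ (κ / 2) hδp (by positivity)
  have hl2 : Real.log 2 ≤ 1 := by have := Real.log_two_lt_d9; linarith
  refine ⟨max Q1 (max (2 * Q2) (100 / s)), by positivity, ?_⟩
  intro q hq c0 hc0
  have hq1 : Q1 ≤ q := (le_max_left _ _).trans hq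
  have hq2 : 2 * Q2 ≤ q := (le_max_left _ _).trans ((le_max_right _ _).trans hq)
  have hq3 : 100 / s ≤ q := (le_max_right _ _).trans ((le_max_right _ _).trans hq)
  have hq0 : 0 ≤ q := hQ1.trans hq1
  have hsq : 100 ≤ s * q := by rw [div_le_iff₀ hsp] at hq3; linarith
  by_contra hcon
  push Not at hcon
  obtain ⟨d, c, hd, rfl, hc⟩ := exists_prim c0 hc0
  have hD2 : n2 (Nv α q c) ≤ Real.exp (2 * (q / 3 - θ * q)) := by
    rw [Nv_smul, n2_smul] at hcon
    have h1 : (1:ℝ) ≤ d := by exact_mod_cast hd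
    have h2 : (1:ℝ) ≤ (d:ℝ) ^ 2 := one_le_pow₀ h1
    have h3 := n2_nonneg (Nv α q c)
    have h4 : Real.exp (2 * (q / 3 - θ0 * q)) ≤ Real.exp (2 * (q / 3 - θ * q)) :=
      Real.exp_le_exp.mpr (by nlinarith)
    nlinarith
  obtain ⟨y, hy, hcy, hmin⟩ := min_orth α q hq0 c hc.ne_zero
  have pM : 0 < n2 (Mv α q y) := lt_of_lt_of_le (by positivity) (n2_Mv_ge α q hq0 y hy.ne_zero)
  have hN2 : n2 (Mv α q y) ≤ 2 * Real.exp (-2 * q / 3 - θ * q) := by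
    unfold mu at hmin
    rw [← mul_div_assoc, le_div_iff₀ pM] at hmin
    have h1 : 4 * (Real.exp (-2 * q) * n2 (Nv α q c)) ≤ (2 * Real.exp (-2 * q / 3 - θ * q)) ^ 2 := by
      have : (2 * Real.exp (-2 * q / 3 - θ * q)) ^ 2 = 4 * (Real.exp (-2 * q) * Real.exp (2 * (q / 3 - θ * q))) := by
        rw [mul_pow, exp_sq', ← Real.exp_add]
        ring_nf
      rw [this]
      gcongr
    apply le_of_sq_le_sq _ (by positivity)
    rw [sq (n2 (Mv α q y))]; linarith
  have e2 : (2:ℝ) ≤ Real.exp 1 := by have := Real.add_one_le_exp (1:ℝ); linarith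
  have hN2' : n2 (Mv α q y) ≤ Real.exp (1 + (-2 * q / 3 - θ * q)) := by
    rw [Real.exp_add]
    refine hN2.trans (mul_le_mul_of_nonneg_right e2 (Real.exp_pos _).le)
  have hsθ : θ * q = 40 * (s * q) := by rw [hs]; ring
  have hδq : s * q = 12 * (δ * q) := by rw [hδ]; ring
  have hδq0 : 0 ≤ δ * q := by positivity
  have hsq' : s * q ≤ q / 120 := by
    have : s ≤ 1 / 120 := by rw [hs]; linarith
    nlinarith
  obtain ⟨ic, hic⟩ := (hH q hq1).1 c hc.ne_zero (hD2.trans (Real.exp_le_exp.mpr (by nlinarith)))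
  obtain ⟨iy, hiy⟩ := (hH q hq1).2 y hy.ne_zero (hN2'.trans (Real.exp_le_exp.mpr (by linarith)))
  -- bounds at the lower points
  have main : ∀ q', q - 3 * (s * q) ≤ q' → q' ≤ q →
      Real.exp (2 * (-q' / 3 - δ * q')) < 2 * mu α q' c y ∧ mu α q' c y < 2 * Real.exp (2 * (-q' / 3 + δ * q')) := by
    intro q' h1 h2
    have hQ' : Q2 ≤ q' := by linarith
    have hq'0 : 0 ≤ q' := hQ2.trans hQ'
    have hk : Real.exp (2 * (κ / 2) * q') ≤ Real.exp (κ * q) := Real.exp_le_exp.mpr (by nlinarith)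
    obtain ⟨ha, hb⟩ := hD q' hQ' c y hc hy hcy ⟨ic, hk.trans hic⟩ ⟨iy, hk.trans hiy⟩
    have hδ' : δ * q' ≤ δ * q := by nlinarith
    constructor
    · apply ha
      have hle := Mv_mono α q q' h2 y
      refine hle.trans ((mul_le_mul_of_nonneg_left hN2' (Real.exp_pos _).le).trans ?_)
      rw [← Real.exp_add]
      apply Real.exp_le_exp.mpr
      linarith
    · apply hb
      have hle := Nv_mono α q q' h2 c
      refine hle.trans (hD2.trans (Real.exp_le_exp.mpr ?_))
      linarith
  -- apply Moebius
  set L := s * q with hL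
  have e16 : (16:ℝ) ≤ Real.exp 15 := by have := Real.add_one_le_exp (15:ℝ); linarith
  have step : ∀ q1 q2, q - 3 * L ≤ q1 → q1 ≤ q → q - 3 * L ≤ q2 → q2 ≤ q → ∀ g : ℝ,
      15 + 2 * (-q2 / 3 + δ * q2) ≤ g + 2 * (-q1 / 3 - δ * q1) →
      4 * mu α q2 c y ≤ Real.exp g * mu α q1 c y := by
    intro q1 q2 h1 h2 h3 h4 g hg
    have t1 := (main q1 h1 h2).1
    have t2 := (main q2 h3 h4).2
    have t3 : 16 * Real.exp (2 * (-q2 / 3 + δ * q2)) ≤ Real.exp g * Real.exp (2 * (-q1 / 3 - δ * q1)) := by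
      rw [← Real.exp_add]
      refine le_trans ?_ (Real.exp_le_exp.mpr hg)
      rw [Real.exp_add]
      exact mul_le_mul_of_nonneg_right e16 (Real.exp_pos _).le
    have t4 := mul_lt_mul_of_pos_left t1 (Real.exp_pos g)
    linarith
  have hδb : ∀ q', q' ≤ q → δ * q' ≤ L / 12 := by
    intro q' h
    have : δ * q' ≤ δ * q := by nlinarith
    linarith
  have d0 := hδb (q - 3 * L) (by linarith)
  have d1 := hδb (q - 2 * L) (by linarith)
  have d2 := hδb (q - L) (by linarith)
  have d3 := hδb q le_rfl
  have k0 := step (q - 3 * L) (q - 2 * L) (by linarith) (by linarith) (by linarith) (by linarith) 0 (by linarith)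
  have k1 := step (q - L) (q - 2 * L) (by linarith) (by linarith) (by linarith) (by linarith) (2 * L) (by linarith)
  have k2 := step (q - L) q (by linarith) (by linarith) (by linarith) (by linarith) 0 (by linarith)
  rw [Real.exp_zero, one_mul] at k0 k2
  simp only [mu_eq] at k0 k1 k2
  have x1 : Real.exp (2 * (q - 2 * L)) = Real.exp (2 * L) * Real.exp (2 * (q - 3 * L)) := by
    rw [← Real.exp_add]; ring_nf
  have x2 : Real.exp (2 * (q - L)) = Real.exp (2 * L) ^ 2 * Real.exp (2 * (q - 3 * L)) := by
    rw [exp_sq', ← Real.exp_add]; ring_nf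
  have x3 : Real.exp (2 * q) = Real.exp (2 * L) ^ 3 * Real.exp (2 * (q - 3 * L)) := by
    rw [← Real.exp_nat_mul, ← Real.exp_add]; congr 1; push_cast; ring
  rw [x1] at k0
  rw [x1, x2] at k1
  rw [x2, x3] at k2
  have hphi := hind c hc.ne_zero
  have hpc : 0 < ((c 0 : ℝ) + c 1 * α + c 2 * α ^ 2) ^ 2 := by positivity
  refine moebius_contra _ _ _ _ (Real.exp (2 * (q - 3 * L))) (Real.exp (2 * L)) hpc.le (by positivity)
    (by positivity) (by positivity) (Real.exp_pos _) ?_ (fun t ht => by positivity) ?_ k0 k1 k2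
  · have := Real.add_one_le_exp (2 * L); linarith
  · intro t ht
    rcases int3_ne hy.ne_zero with h | h | h
    · have : (y 0 : ℝ) ≠ 0 := by exact_mod_cast h
      positivity
    · by_cases h0 : y 0 = 0
      · have : (y 1 : ℝ) ≠ 0 := by exact_mod_cast h
        simp [h0]; positivity
      · have : (y 0 : ℝ) ≠ 0 := by exact_mod_cast h0
        positivity
    · by_cases h0 : y 0 = 0
      · have : (y 2 : ℝ) ≠ 0 := by exact_mod_cast h
        simp [h0]; positivity
      · have : (y 0 : ℝ) ≠ 0 := by exact_mod_cast h0
        positivity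

theorem reduce2 (x y z : Fin 3 → ℝ) (hn : 0 < n2 (cr x y)) : ∃ k l : ℤ,
    n2 (z + (k : ℝ) • x + (l : ℝ) • y) ≤ (n2 x + n2 y) / 2 + (dt z (cr x y)) ^ 2 / n2 (cr x y) := by
  set n := n2 (cr x y) with hndef
  set A := dt (cr z y) (cr x y) / n with hA
  set B := dt (cr x z) (cr x y) / n with hB
  refine ⟨-round A, -round B, ?_⟩
  have h1 : |A - round A| ≤ 1 / 2 := abs_sub_round _
  have h2 : |B - round B| ≤ 1 / 2 := abs_sub_round _
  generalize ((round A : ℤ)) = k at *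
  generalize ((round B : ℤ)) = l at *
  have h1' : (A - k) ^ 2 ≤ 1 / 4 := by
    rw [← sq_abs]; nlinarith [abs_nonneg (A - k)]
  have h2' : (B - l) ^ 2 ≤ 1 / 4 := by
    rw [← sq_abs]; nlinarith [abs_nonneg (B - l)]
  have hz : ∀ i, z i = A * x i + B * y i + dt z (cr x y) / n * cr x y i := by
    intro i
    rw [hA, hB]
    field_simp
    rw [hndef]
    fin_cases i <;> simp [dt, cr, n2] <;> ring
  have heq : n2 (z + ((-k : ℤ) : ℝ) • x + ((-l : ℤ) : ℝ) • y) =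
      n2 ((A - k) • x + (B - l) • y) + (dt z (cr x y)) ^ 2 / n := by
    have e : z + ((-k : ℤ) : ℝ) • x + ((-l : ℤ) : ℝ) • y =
      ((A - k) • x + (B - l) • y) + (dt z (cr x y) / n) • cr x y := by
      ext i
      simp only [Pi.add_apply, Pi.smul_apply, smul_eq_mul]
      rw [hz i]; push_cast; ring
    rw [e]
    have e2 : ∀ (a b t : ℝ), n2 ((a • x + b • y) + t • cr x y) = n2 (a • x + b • y) + t ^ 2 * n2 (cr x y) := by
      intro a b t
      simp [n2, cr]; ring
    rw [e2, ← hndef]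
    field_simp
  rw [heq]
  have hb : ∀ a b : ℝ, n2 (a • x + b • y) ≤ 2 * (a ^ 2 * n2 x + b ^ 2 * n2 y) := by
    intro a b
    have : 2 * (a ^ 2 * n2 x + b ^ 2 * n2 y) - n2 (a • x + b • y) = n2 (a • x - b • y) := by
      simp [n2]; ring
    have := n2_nonneg (a • x - b • y)
    linarith
  have := hb (A - k) (B - l)
  have nx := n2_nonneg x
  have ny := n2_nonneg y
  nlinarith

theorem TR (α : ℝ) (hα : IsAlgebraic ℚ α)
    (hind : ∀ c : Fin 3 → ℤ, c ≠ 0 → (c 0 : ℝ) + c 1 * α + c 2 * α ^ 2 ≠ 0) (ε : ℝ) (hε : 0 < ε) :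
    ∃ Q : ℝ, 0 ≤ Q ∧ ∀ q, Q ≤ q → ∃ y : Fin 3 → Fin 3 → ℤ, dt (cr (y 0) (y 1)) (y 2) = 1 ∧
      ∀ k, n2 (Mv α q (y k)) ≤ Real.exp (2 * (-q / 3 + ε * q)) := by
  obtain ⟨Q1, hQ1, hS⟩ := S3 α hα hind (ε / 2) (by positivity)
  refine ⟨max Q1 (16 / ε), by positivity, ?_⟩
  intro q hq
  have hq1 : Q1 ≤ q := (le_max_left _ _).trans hq
  have hq2 : 16 / ε ≤ q := (le_max_right _ _).trans hq
  have hq0 : 0 ≤ q := hQ1.trans hq1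
  have hεq : 16 ≤ ε * q := by rw [div_le_iff₀ hε] at hq2; linarith
  obtain ⟨c, hc0, hc, hmin⟩ := min_prim (fun c => n2 (Nv α q c)) {c | c ≠ 0}
    ⟨![1, 0, 0], fun h => by simpa using congrFun h 0⟩ (fun y hy => hy) 1 one_pos
    (fun y hy => n2_Nv_ge α q hq0 y hy) (fun d y => by
      show n2 (Nv α q (d • y)) = _
      rw [Nv_smul, n2_smul]) (by
      rintro d y hd h1 h
      exact h1 (by simp [h]))
  obtain ⟨y1, hy1, hcy, hy1min⟩ := min_orth α q hq0 c hc0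
  obtain ⟨y2, hy2, hy2b⟩ := complM α q hq0 c y1 hy1 hcy
  obtain ⟨c2, hc2, hc2b⟩ := complN α q hq0 c y1 hc hcy
  have pM : 0 < n2 (Mv α q y1) := lt_of_lt_of_le (by positivity) (n2_Mv_ge α q hq0 y1 hy1.ne_zero)
  have pN : 0 < n2 (Nv α q c) := lt_of_lt_of_le (by positivity) (n2_Nv_ge α q hq0 c hc0)
  have hX := hS q hq1 c hc0
  set X := Real.exp (2 * (q / 3 - ε / 2 * q)) with hXd
  have hXp : 0 < X := Real.exp_pos _
  have hc2ne : c2 ≠ 0 := by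
    rintro rfl
    apply hy1.ne_zero
    rw [← hc2]
    ext i; fin_cases i <;> simp [cr]
  have e1 : Real.exp (2 * q) * n2 (Mv α q y1) / n2 (Nv α q c) = (mu α q c y1)⁻¹ := by
    unfold mu
    rw [show -2 * q = -(2 * q) by ring, Real.exp_neg]
    field_simp
  have hmup : 0 < mu α q c y1 := by unfold mu; positivity
  have hm := hmin c2 hc2ne
  rw [e1] at hc2b
  have hmu : mu α q c y1 ≤ 4 / X := by
    have h1 : n2 (Nv α q c) ≤ 4 * (mu α q c y1)⁻¹ := by linarith
    have h2 : X ≤ 4 / mu α q c y1 := by rw [div_eq_mul_inv]; linarith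
    rw [le_div_iff₀ hmup] at h2
    rw [le_div_iff₀ hXp]; linarith
  have hb1 : n2 (Mv α q y1) ≤ 16 / X := by
    have : 16 / X = 4 * (4 / X) := by ring
    linarith
  have hb2 : n2 (Mv α q y2) ≤ 8 / X := by
    have h8 : 8 / X = 4 / X + 4 / X := by ring
    have h16 : 16 / X = 4 * (4 / X) := by ring
    unfold mu at hmu
    linarith
  obtain ⟨u, hu⟩ := id hc
  have hcr : cr (Mv α q y1) (Mv α q y2) = Real.exp (-q) • Nv α q c := by rw [M_cr, hy2]
  have hncr : n2 (cr (Mv α q y1) (Mv α q y2)) = Real.exp (-2 * q) * n2 (Nv α q c) := by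
    rw [hcr, n2_smul, exp_sq', show 2 * -q = -2 * q by ring]
  obtain ⟨k, l, hkl⟩ := reduce2 (Mv α q y1) (Mv α q y2) (Mv α q u) (by rw [hncr]; positivity)
  have hdt : dt (Mv α q u) (cr (Mv α q y1) (Mv α q y2)) = Real.exp (-q) := by
    have h : Real.exp (-q) * Real.exp q = 1 := by rw [← Real.exp_add]; simp
    have hu' : (u 0 : ℝ) * c 0 + u 1 * c 1 + u 2 * c 2 = 1 := by
      unfold dt at hu; exact_mod_cast hu
    rw [hcr]
    simp only [dt, Mv, Nv, Pi.smul_apply, smul_eq_mul, Matrix.cons_val_zero, Matrix.cons_val_one, Matrix.cons_val]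
    linear_combination Real.exp (-q) * hu' + Real.exp (-q) * ((u 0:ℝ) * (c 0 + c 1 * α + c 2 * α ^ 2)) * h
  rw [hdt, hncr, exp_sq', show 2 * -q = -2 * q by ring] at hkl
  have e3 : Real.exp (-2 * q) / (Real.exp (-2 * q) * n2 (Nv α q c)) = 1 / n2 (Nv α q c) := by
    field_simp
  rw [e3, ← Mv_add, ← Mv_add] at hkl
  have hb3 : n2 (Mv α q (u + k • y1 + l • y2)) ≤ 16 / X := by
    have h1 : 1 / n2 (Nv α q c) ≤ 1 / X := one_div_le_one_div_of_le hXp hX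
    have h8 : 8 / X = 8 * (1 / X) := by ring
    have h16 : 16 / X = 16 * (1 / X) := by ring
    have hp : 0 < 1 / X := by positivity
    linarith
  have hfin : 16 / X ≤ Real.exp (2 * (-q / 3 + ε * q)) := by
    have e16 : (16:ℝ) ≤ Real.exp 16 := by have := Real.add_one_le_exp (16:ℝ); linarith
    have : 16 / X = 16 * Real.exp (-(2 * (q / 3 - ε / 2 * q))) := by
      rw [Real.exp_neg, hXd]; rfl
    rw [this]
    refine (mul_le_mul_of_nonneg_right e16 (Real.exp_pos _).le).trans ?_
    rw [← Real.exp_add]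
    apply Real.exp_le_exp.mpr
    linarith
  refine ⟨![y1, y2, u + k • y1 + l • y2], ?_, ?_⟩
  · have h1 : dt (cr y1 y2) (u + k • y1 + l • y2) = dt u (cr y1 y2) := by
      simp [dt, cr]; ring
    simp only [Matrix.cons_val_zero, Matrix.cons_val_one, Matrix.cons_val]
    rw [h1, hy2, hu]
  · intro i
    have h8 : 8 / X ≤ 16 / X := by gcongr; norm_num
    fin_cases i
    · exact hb1.trans hfin
    · exact (hb2.trans h8).trans hfin
    · exact hb3.trans hfin

end

section


theorem cf_det (a : ℕ → ℕ) (n : ℕ) : (cfNum a (n + 1) : ℤ) * cfDen a n - cfNum a n * cfDen a (n + 1) = (-1) ^ n := by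
  induction n with
  | zero => simp [cfNum, cfDen]
  | succ n ih =>
    have h1 : cfNum a (n + 1 + 1) = a (n + 2) * cfNum a (n + 1) + cfNum a n := rfl
    have h2 : cfDen a (n + 1 + 1) = a (n + 2) * cfDen a (n + 1) + cfDen a n := rfl
    rw [h1, h2, pow_succ]
    push_cast
    linear_combination -ih

theorem cfDen_pos (a : ℕ → ℕ) (ha : ∀ n, 1 ≤ n → 1 ≤ a n) (n : ℕ) : 1 ≤ cfDen a n ∧ 1 ≤ cfDen a (n + 1) := by
  induction n with
  | zero => exact ⟨le_rfl, by simpa [cfDen] using ha 1 le_rfl⟩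
  | succ n ih =>
    refine ⟨ih.2, ?_⟩
    show 1 ≤ a (n + 2) * cfDen a (n + 1) + cfDen a n
    linarith [ih.1, Nat.zero_le (a (n + 2) * cfDen a (n + 1))]

theorem cfDen_mono1 (a : ℕ → ℕ) (ha : ∀ n, 1 ≤ n → 1 ≤ a n) (n : ℕ) : cfDen a n ≤ cfDen a (n + 1) := by
  cases n with
  | zero => simpa [cfDen] using ha 1 le_rfl
  | succ n =>
    show _ ≤ a (n + 2) * cfDen a (n + 1) + cfDen a n
    have := ha (n + 2) (by omega)
    nlinarith [Nat.zero_le (cfDen a (n+1)), Nat.zero_le (cfDen a n)]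

theorem cfDen_mono (a : ℕ → ℕ) (ha : ∀ n, 1 ≤ n → 1 ≤ a n) : Monotone (cfDen a) := monotone_nat_of_le_succ (cfDen_mono1 a ha)

theorem cfDen_growth (a : ℕ → ℕ) (ha : ∀ n, 1 ≤ n → 1 ≤ a n) (n : ℕ) : 2 ^ n ≤ 2 * cfDen a n ^ 2 ∧ 2 ^ (n + 1) ≤ 2 * cfDen a (n + 1) ^ 2 := by
  induction n with
  | zero =>
    refine ⟨by simp [cfDen], ?_⟩
    have := ha 1 le_rfl
    simp [cfDen]; nlinarith
  | succ n ih =>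
    refine ⟨ih.2, ?_⟩
    have h : 2 * cfDen a n ≤ cfDen a (n + 1 + 1) := by
      show _ ≤ a (n + 2) * cfDen a (n + 1) + cfDen a n
      have := ha (n + 2) (by omega)
      have := cfDen_mono1 a ha n
      nlinarith
    have h2 : (2 * cfDen a n) ^ 2 ≤ cfDen a (n + 1 + 1) ^ 2 := Nat.pow_le_pow_left h 2
    rw [pow_succ, pow_succ]
    nlinarith [ih.1]

theorem cf_sign (a : ℕ → ℕ) (n k : ℕ) : 0 ≤ (-1 : ℤ) ^ n * (cfNum a (n + k) * cfDen a n - cfNum a n * cfDen a (n + k)) ∧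
    0 ≤ (-1 : ℤ) ^ n * (cfNum a (n + k + 1) * cfDen a n - cfNum a n * cfDen a (n + k + 1)) := by
  induction k with
  | zero =>
    refine ⟨by simp, ?_⟩
    rw [add_zero, cf_det, ← mul_pow]; simp
  | succ k ih =>
    refine ⟨ih.2, ?_⟩
    have h1 : cfNum a (n + (k + 1) + 1) = a (n + k + 2) * cfNum a (n + k + 1) + cfNum a (n + k) := rfl
    have h2 : cfDen a (n + (k + 1) + 1) = a (n + k + 2) * cfDen a (n + k + 1) + cfDen a (n + k) := rfl
    rw [h1, h2]
    push_cast
    have h3 : 0 ≤ (a (n + k + 2) : ℤ) := by positivity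
    have := mul_nonneg h3 ih.2
    linarith [ih.1]


noncomputable def cfE (a : ℕ → ℕ) (α : ℝ) (n : ℕ) : ℝ := (-1) ^ n * (α * cfDen a n - cfNum a n)

theorem cfE_nonneg (a : ℕ → ℕ) (ha : ∀ n, 1 ≤ n → 1 ≤ a n) (α : ℝ)
    (hα : Tendsto (fun n => (cfNum a n : ℝ) / cfDen a n) atTop (𝓝 α)) (n : ℕ) : 0 ≤ cfE a α n := by
  have h1 : Tendsto (fun m => (-1 : ℝ) ^ n * ((cfNum a m : ℝ) / cfDen a m * cfDen a n - cfNum a n)) atTop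
      (𝓝 (cfE a α n)) := by
    unfold cfE
    exact ((hα.mul_const _).sub_const _).const_mul _
  refine ge_of_tendsto h1 ?_
  filter_upwards [eventually_ge_atTop n] with m hm
  obtain ⟨k, rfl⟩ := Nat.exists_eq_add_of_le hm
  have h2 : (0:ℝ) ≤ (-1 : ℝ) ^ n * (cfNum a (n + k) * cfDen a n - cfNum a n * cfDen a (n + k)) := by
    exact_mod_cast (cf_sign a n k).1
  have h3 : (0:ℝ) < cfDen a (n + k) := by exact_mod_cast (cfDen_pos a ha (n + k)).1
  have : (-1 : ℝ) ^ n * ((cfNum a (n + k) : ℝ) / cfDen a (n + k) * cfDen a n - cfNum a n) =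
    ((-1 : ℝ) ^ n * (cfNum a (n + k) * cfDen a n - cfNum a n * cfDen a (n + k))) / cfDen a (n + k) := by
    field_simp
  rw [this]; positivity

theorem cf_detR (a : ℕ → ℕ) (n : ℕ) : (cfNum a (n + 1) : ℝ) * cfDen a n - cfNum a n * cfDen a (n + 1) = (-1) ^ n := by
  exact_mod_cast cf_det a n

theorem neg_one_sq_pow (n : ℕ) : ((-1 : ℝ) ^ n) * (-1) ^ n = 1 := by
  rw [← mul_pow]; simp

theorem cfE_den (a : ℕ → ℕ) (α : ℝ) (n : ℕ) : cfDen a (n + 1) * cfE a α n + cfDen a n * cfE a α (n + 1) = 1 := by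
  unfold cfE
  rw [pow_succ]
  linear_combination ((-1 : ℝ) ^ n) * cf_detR a n + neg_one_sq_pow n

theorem cfE_num (a : ℕ → ℕ) (α : ℝ) (n : ℕ) : cfNum a (n + 1) * cfE a α n + cfNum a n * cfE a α (n + 1) = α := by
  unfold cfE
  rw [pow_succ]
  linear_combination α * ((-1 : ℝ) ^ n) * cf_detR a n + α * neg_one_sq_pow n

theorem cfE_rec (a : ℕ → ℕ) (α : ℝ) (n : ℕ) : cfE a α n = a (n + 2) * cfE a α (n + 1) + cfE a α (n + 2) := by
  unfold cfE
  have h1 : cfNum a (n + 2) = a (n + 2) * cfNum a (n + 1) + cfNum a n := rfl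
  have h2 : cfDen a (n + 2) = a (n + 2) * cfDen a (n + 1) + cfDen a n := rfl
  rw [h1, h2, pow_succ, pow_succ]
  push_cast
  ring

theorem cfE_pos (a : ℕ → ℕ) (ha : ∀ n, 1 ≤ n → 1 ≤ a n) (α : ℝ)
    (hα : Tendsto (fun n => (cfNum a n : ℝ) / cfDen a n) atTop (𝓝 α)) (n : ℕ) : 0 < cfE a α n := by
  have key : ∀ n, cfE a α (n + 1) ≠ 0 → 0 < cfE a α n := by
    intro n h
    have h0 := cfE_nonneg a ha α hα
    have h1 : 0 < cfE a α (n + 1) := lt_of_le_of_ne (h0 _) (Ne.symm h)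
    have h2 := cfE_rec a α n
    have h3 : (1:ℝ) ≤ a (n + 2) := by exact_mod_cast ha (n + 2) (by omega)
    have := h0 (n + 2)
    nlinarith
  apply key
  intro h0
  have h1 := cfE_den a α (n + 1)
  have h2 := cfE_rec a α (n + 1)
  rw [h0] at h1 h2
  have hn := cfE_nonneg a ha α hα (n + 1 + 2)
  have hn2 := cfE_nonneg a ha α hα (n + 1 + 1)
  have h3 : (1:ℝ) ≤ a (n + 1 + 2) := by exact_mod_cast ha (n + 1 + 2) (by omega)
  have : cfE a α (n + 1 + 1) = 0 := by nlinarith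
  rw [this] at h1
  simp at h1

theorem cfE_le (a : ℕ → ℕ) (ha : ∀ n, 1 ≤ n → 1 ≤ a n) (α : ℝ)
    (hα : Tendsto (fun n => (cfNum a n : ℝ) / cfDen a n) atTop (𝓝 α)) (n : ℕ) : |α * cfDen a n - cfNum a n| * cfDen a (n + 1) ≤ 1 := by
  have h1 := cfE_den a α n
  have h2 := (cfE_pos a ha α hα n)
  have h3 := (cfE_pos a ha α hα (n + 1))
  have h4 : |α * cfDen a n - cfNum a n| = cfE a α n := by
    rw [← abs_of_pos h2, cfE, abs_mul]; simp
  rw [h4]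
  have : (0:ℝ) ≤ cfDen a n * cfE a α (n + 1) := by positivity
  linarith

theorem cf_floor (a : ℕ → ℕ) (ha : ∀ n, 1 ≤ n → 1 ≤ a n) (α : ℝ)
    (hα : Tendsto (fun n => (cfNum a n : ℝ) / cfDen a n) atTop (𝓝 α)) (n : ℕ) : a (n + 2) = ⌊cfE a α n / cfE a α (n + 1)⌋₊ := by
  symm
  have h0 := (cfE_pos a ha α hα (n + 1))
  have h2 := (cfE_pos a ha α hα (n + 2))
  have h3 := (cfE_pos a ha α hα (n + 3))
  have h1 := cfE_rec a α n
  have h4 : cfE a α (n + 2) < cfE a α (n + 1) := by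
    have := cfE_rec a α (n + 1)
    have h3' : (1:ℝ) ≤ a (n + 1 + 2) := by exact_mod_cast ha (n + 1 + 2) (by omega)
    have h5 : cfE a α (n + 1 + 1) = cfE a α (n + 2) := rfl
    have h6 : cfE a α (n + 1 + 2) = cfE a α (n + 3) := rfl
    rw [h5, h6] at this
    nlinarith
  rw [Nat.floor_eq_iff (by have := (cfE_pos a ha α hα n); positivity)]
  rw [le_div_iff₀ h0, div_lt_iff₀ h0]
  constructor <;> nlinarith

theorem cf_period (a : ℕ → ℕ) (ha : ∀ n, 1 ≤ n → 1 ≤ a n) (α : ℝ)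
    (hα : Tendsto (fun n => (cfNum a n : ℝ) / cfDen a n) atTop (𝓝 α)) (n m : ℕ) (hnm : cfE a α n / cfE a α (n + 1) = cfE a α m / cfE a α (m + 1)) (k : ℕ) :
    cfE a α (n + k) / cfE a α (n + k + 1) = cfE a α (m + k) / cfE a α (m + k + 1) := by
  induction k with
  | zero => exact hnm
  | succ k ih =>
    have step : ∀ n, cfE a α (n + 1) / cfE a α (n + 1 + 1) = (cfE a α n / cfE a α (n + 1) - ⌊cfE a α n / cfE a α (n + 1)⌋₊)⁻¹ := by
      intro n
      rw [← cf_floor a ha α hα n]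
      have h0 := (cfE_pos a ha α hα (n + 1))
      have h2 := (cfE_pos a ha α hα (n + 2))
      have h1 := cfE_rec a α n
      rw [h1]
      have : cfE a α (n + 1 + 1) = cfE a α (n + 2) := rfl
      rw [this, add_div, mul_div_cancel_right₀ _ h0.ne', add_sub_cancel_left, inv_div]
    have s1 := step (n + k)
    have s2 := step (m + k)
    rw [← add_assoc, ← add_assoc, s1, s2, ih]

theorem ep_of_eq (a : ℕ → ℕ) (ha : ∀ n, 1 ≤ n → 1 ≤ a n) (α : ℝ)
    (hα : Tendsto (fun n => (cfNum a n : ℝ) / cfDen a n) atTop (𝓝 α)) (n m : ℕ) (hlt : n < m) (hnm : cfE a α n / cfE a α (n + 1) = cfE a α m / cfE a α (m + 1)) :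
    EventuallyPeriodic a := by
  refine ⟨n + 2, m - n, by omega, ?_⟩
  intro j hj
  obtain ⟨k, rfl⟩ := Nat.exists_eq_add_of_le hj
  have := cf_period a ha α hα n m hnm k
  have e1 := cf_floor a ha α hα (n + k)
  have e2 := cf_floor a ha α hα (m + k)
  rw [show n + 2 + k + (m - n) = m + k + 2 by omega, show n + 2 + k = n + k + 2 by omega, e1, e2, this]

set_option maxHeartbeats 1000000 in
theorem lagrange (a : ℕ → ℕ) (ha : ∀ n, 1 ≤ n → 1 ≤ a n) (α : ℝ)
    (hα : Tendsto (fun n => (cfNum a n : ℝ) / cfDen a n) atTop (𝓝 α)) (c0 c1 c2 : ℤ) (hc : ¬ (c0 = 0 ∧ c1 = 0 ∧ c2 = 0)) (h : (c0 : ℝ) + c1 * α + c2 * α ^ 2 = 0) :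
    EventuallyPeriodic a := by
  obtain ⟨K, hK⟩ := exists_nat_ge (2 * |(c1:ℝ)| + 4 * |(c2:ℝ)| * |α| + 2 * |(c2:ℝ)|)
  -- finite set of triples
  set T : Finset (ℤ × ℤ × ℤ) := Finset.Icc (-(K:ℤ)) K ×ˢ Finset.Icc (-(K:ℤ)) K ×ˢ Finset.Icc (-(K:ℤ)) K with hT
  set poly : ℤ × ℤ × ℤ → Polynomial ℝ := fun t =>
    Polynomial.C (t.1:ℝ) * Polynomial.X ^ 2 + Polynomial.C (t.2.1:ℝ) * Polynomial.X + Polynomial.C (t.2.2:ℝ) with hpoly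
  have hfin : (⋃ t ∈ T, {x : ℝ | poly t ≠ 0 ∧ (poly t).IsRoot x}).Finite := by
    apply Set.Finite.biUnion T.finite_toSet
    intro t _
    by_cases h0 : poly t = 0
    · simp [h0]
    · refine (Polynomial.finite_setOfPred_isRoot h0).subset ?_
      rintro x ⟨_, hx⟩; exact hx
  have hmem : ∀ n, cfE a α n / cfE a α (n + 1) ∈ (⋃ t ∈ T, {x : ℝ | poly t ≠ 0 ∧ (poly t).IsRoot x}) := by
    intro n
    have hE0 := cfE_pos a ha α hα n
    have hE1 := cfE_pos a ha α hα (n + 1)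
    have b0 := cfE_le a ha α hα n
    have b1 := cfE_le a ha α hα (n + 1)
    have hd := cf_det a n
    have i1 := cfE_den a α n
    have i2 := cfE_num a α n
    have q0 : (1:ℝ) ≤ cfDen a n := by exact_mod_cast (cfDen_pos a ha n).1
    have q01 : (cfDen a n : ℝ) ≤ cfDen a (n + 1) := by exact_mod_cast cfDen_mono1 a ha n
    have q12 : (cfDen a (n + 1) : ℝ) ≤ cfDen a (n + 1 + 1) := by exact_mod_cast cfDen_mono1 a ha (n + 1)
    set A : ℤ := c0 * cfDen a (n + 1) ^ 2 + c1 * cfNum a (n + 1) * cfDen a (n + 1) + c2 * cfNum a (n + 1) ^ 2 with hA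
    set B : ℤ := 2 * c0 * cfDen a n * cfDen a (n + 1) + c1 * (cfNum a n * cfDen a (n + 1) + cfNum a (n + 1) * cfDen a n)
      + 2 * c2 * cfNum a n * cfNum a (n + 1) with hB
    set C : ℤ := c0 * cfDen a n ^ 2 + c1 * cfNum a n * cfDen a n + c2 * cfNum a n ^ 2 with hC
    have hquad : (A:ℝ) * cfE a α n ^ 2 + B * (cfE a α n * cfE a α (n + 1)) + C * cfE a α (n + 1) ^ 2 = 0 := by
      have e : (A:ℝ) * cfE a α n ^ 2 + B * (cfE a α n * cfE a α (n + 1)) + C * cfE a α (n + 1) ^ 2 =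
        c0 * (cfDen a (n + 1) * cfE a α n + cfDen a n * cfE a α (n + 1)) ^ 2 +
        c1 * (cfDen a (n + 1) * cfE a α n + cfDen a n * cfE a α (n + 1)) * (cfNum a (n + 1) * cfE a α n + cfNum a n * cfE a α (n + 1)) +
        c2 * (cfNum a (n + 1) * cfE a α n + cfNum a n * cfE a α (n + 1)) ^ 2 := by
        rw [hA, hB, hC]; push_cast; ring
      rw [e, i1, i2]; linarith
    have hroot : (poly (A, B, C)).IsRoot (cfE a α n / cfE a α (n + 1)) := by
      simp only [hpoly, Polynomial.IsRoot, Polynomial.eval_add, Polynomial.eval_mul, Polynomial.eval_C,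
        Polynomial.eval_pow, Polynomial.eval_X]
      field_simp
      linarith
    have hne : poly (A, B, C) ≠ 0 := by
      intro h0
      have v0 := congrArg (Polynomial.eval 0) h0
      have v1 := congrArg (Polynomial.eval 1) h0
      have v2 := congrArg (Polynomial.eval (-1)) h0
      simp [hpoly] at v0 v1 v2
      have w1 : A + B + C = 0 := by exact_mod_cast v1
      have w2 : A + -B + C = 0 := by exact_mod_cast v2
      have cC : C = 0 := by exact_mod_cast v0
      have cA : A = 0 := by omega
      have cB : B = 0 := by omega
      have sq1 : ((-1 : ℤ) ^ n) * (-1) ^ n = 1 := by rw [← mul_pow]; simp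
      rw [hA] at cA; rw [hB] at cB; rw [hC] at cC
      generalize (cfNum a n : ℤ) = p at *
      generalize (cfNum a (n + 1) : ℤ) = p' at *
      generalize (cfDen a n : ℤ) = q at *
      generalize (cfDen a (n + 1) : ℤ) = q' at *
      rw [← hd] at sq1
      apply hc
      refine ⟨?_, ?_, ?_⟩
      · linear_combination p ^ 2 * cA - p * p' * cB + p' ^ 2 * cC - c0 * sq1
      · linear_combination (-2 * p * q) * cA + (p * q' + p' * q) * cB - 2 * p' * q' * cC - c1 * sq1
      · linear_combination q ^ 2 * cA - q * q' * cB + q' ^ 2 * cC - c2 * sq1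
    -- bounds
    have bnd : ∀ (q q' e e' : ℝ), |q * e'| ≤ 1 → |q' * e| ≤ 1 → |e * e'| ≤ 1 →
        |2 * c0 * q * q' + c1 * ((α * q - e) * q' + (α * q' - e') * q) + 2 * c2 * (α * q - e) * (α * q' - e')| ≤ K := by
      intro q q' e e' h1 h2 h3
      refine le_trans ?_ hK
      have e1 : 2 * c0 * q * q' + c1 * ((α * q - e) * q' + (α * q' - e') * q) + 2 * c2 * (α * q - e) * (α * q' - e') =
        -(c1 * (q' * e)) - c1 * (q * e') - 2 * (c2 * α * (q' * e)) - 2 * (c2 * α * (q * e')) + 2 * (c2 * (e * e')) := by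
        linear_combination 2 * q * q' * h
      rw [e1]
      have m1 : |c1 * (q' * e)| ≤ |(c1:ℝ)| := by rw [abs_mul]; exact mul_le_of_le_one_right (abs_nonneg _) h2
      have m2 : |c1 * (q * e')| ≤ |(c1:ℝ)| := by rw [abs_mul]; exact mul_le_of_le_one_right (abs_nonneg _) h1
      have m3 : |c2 * α * (q' * e)| ≤ |(c2:ℝ)| * |α| := by rw [abs_mul, abs_mul]; exact mul_le_of_le_one_right (by positivity) h2
      have m4 : |c2 * α * (q * e')| ≤ |(c2:ℝ)| * |α| := by rw [abs_mul, abs_mul]; exact mul_le_of_le_one_right (by positivity) h1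
      have m5 : |c2 * (e * e')| ≤ |(c2:ℝ)| := by rw [abs_mul]; exact mul_le_of_le_one_right (abs_nonneg _) h3
      rw [abs_le] at *
      constructor <;> linarith [m1.1, m1.2, m2.1, m2.2, m3.1, m3.2, m4.1, m4.2, m5.1, m5.2]
    set e := α * cfDen a n - cfNum a n with he
    set e' := α * cfDen a (n + 1) - cfNum a (n + 1) with he'
    have p0 : (cfNum a n : ℝ) = α * cfDen a n - e := by rw [he]; ring
    have p1 : (cfNum a (n + 1) : ℝ) = α * cfDen a (n + 1) - e' := by rw [he']; ring
    have ne := abs_nonneg e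
    have ne' := abs_nonneg e'
    have f0 : |e| ≤ 1 := by nlinarith
    have f1 : |e'| ≤ 1 := by nlinarith
    have f2 : |e * e'| ≤ 1 := by rw [abs_mul]; exact mul_le_one₀ f0 ne' f1
    have f2a : |e * e| ≤ 1 := by rw [abs_mul]; exact mul_le_one₀ f0 ne f0
    have f2b : |e' * e'| ≤ 1 := by rw [abs_mul]; exact mul_le_one₀ f1 ne' f1
    have aq : |(cfDen a n : ℝ)| = cfDen a n := abs_of_nonneg (by positivity)
    have aq' : |(cfDen a (n + 1) : ℝ)| = cfDen a (n + 1) := abs_of_nonneg (by positivity)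
    have f3 : |(cfDen a n : ℝ) * e'| ≤ 1 := by rw [abs_mul, aq]; nlinarith
    have f4 : |(cfDen a (n + 1) : ℝ) * e| ≤ 1 := by rw [abs_mul, aq']; nlinarith
    have f5 : |(cfDen a n : ℝ) * e| ≤ 1 := by rw [abs_mul, aq]; nlinarith
    have f6 : |(cfDen a (n + 1) : ℝ) * e'| ≤ 1 := by rw [abs_mul, aq']; nlinarith
    have hBb : |(B:ℝ)| ≤ K := by
      have := bnd _ _ e e' f3 f4 f2
      rw [← p0, ← p1] at this
      convert this using 2
      rw [hB]; push_cast; ring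
    have hAb : |(A:ℝ)| ≤ K := by
      have := bnd _ _ e' e' f6 f6 f2b
      rw [← p1] at this
      have h2 : |2 * (A:ℝ)| ≤ K := by
        convert this using 2
        rw [hA]; push_cast; ring
      rw [abs_mul, abs_two] at h2
      linarith [abs_nonneg (A:ℝ)]
    have hCb : |(C:ℝ)| ≤ K := by
      have := bnd _ _ e e f5 f5 f2a
      rw [← p0] at this
      have h2 : |2 * (C:ℝ)| ≤ K := by
        convert this using 2
        rw [hC]; push_cast; ring
      rw [abs_mul, abs_two] at h2
      linarith [abs_nonneg (C:ℝ)]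
    have hAi : |A| ≤ K := by exact_mod_cast hAb
    have hBi : |B| ≤ K := by exact_mod_cast hBb
    have hCi : |C| ≤ K := by exact_mod_cast hCb
    rw [abs_le] at hAi hBi hCi
    simp only [Set.mem_iUnion]
    refine ⟨(A, B, C), ?_, hne, hroot⟩
    simp only [hT, Finset.mem_product, Finset.mem_Icc]
    exact ⟨hAi, hBi, hCi⟩
  have : ¬ Function.Injective (fun n => cfE a α n / cfE a α (n + 1)) := by
    intro hinj
    exact Set.infinite_of_injective_forall_mem hinj hmem hfin
  rw [Function.not_injective_iff] at this
  obtain ⟨n, m, h1, h2⟩ := this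
  rcases lt_or_gt_of_ne h2 with h3 | h3
  · exact ep_of_eq a ha α hα n m h3 h1
  · exact ep_of_eq a ha α hα m n h3 h1.symm

end

section

/-- product of elementary matrices attached to a word -/
def cm (L : List ℕ) : Matrix (Fin 2) (Fin 2) ℤ := (L.map (fun x : ℕ => (!![(x:ℤ), 1; 1, 0] : Matrix (Fin 2) (Fin 2) ℤ))).prod

theorem cm_append (L L' : List ℕ) : cm (L ++ L') = cm L * cm L' := by simp [cm]

theorem cm_reverse (L : List ℕ) : cm L.reverse = (cm L).transpose := by
  induction L with
  | nil => simp [cm]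
  | cons x L ih =>
    rw [List.reverse_cons, cm_append, ih]
    have : cm (x :: L) = cm [x] * cm L := by simp [cm]
    rw [this, Matrix.transpose_mul]
    congr 1
    ext i j
    fin_cases i <;> fin_cases j <;> simp [cm]

theorem cm_nonneg (L : List ℕ) : ∀ i j, 0 ≤ cm L i j := by
  induction L with
  | nil => intro i j; fin_cases i <;> fin_cases j <;> simp [cm]
  | cons x L ih =>
    intro i j
    have : cm (x :: L) = cm [x] * cm L := by simp [cm]
    rw [this, Matrix.mul_apply, Fin.sum_univ_two]
    have h0 := ih 0 j
    have h1 := ih 1 j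
    fin_cases i <;> simp [cm] at * <;> positivity

theorem cm_range (a : ℕ → ℕ) (n : ℕ) : cm ((List.range (n + 1)).map (fun i => a (i + 1))) =
    !![(cfDen a (n + 1) : ℤ), (cfDen a n : ℤ); (cfNum a (n + 1) : ℤ), (cfNum a n : ℤ)] := by
  induction n with
  | zero => simp [cm, cfDen, cfNum]
  | succ n ih =>
    rw [List.range_succ, List.map_append, cm_append, ih]
    have h1 : cfNum a (n + 1 + 1) = a (n + 2) * cfNum a (n + 1) + cfNum a n := rfl
    have h2 : cfDen a (n + 1 + 1) = a (n + 2) * cfDen a (n + 1) + cfDen a n := rfl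
    rw [h1, h2]
    ext i j
    fin_cases i <;> fin_cases j <;> simp [cm, Matrix.mul_apply, Fin.sum_univ_two] <;> ring

theorem prefix_eq (L : List ℕ) (a : ℕ → ℕ) (h : IsPrefixOfSeq L a) :
    L = (List.range L.length).map (fun i => a (i + 1)) := by
  apply List.ext_getElem
  · simp
  · intro i h1 h2
    have := h i h1
    rw [List.getD_eq_getElem _ _ h1] at this
    simp [this]

theorem prefix_left (L L' : List ℕ) (a : ℕ → ℕ) (h : IsPrefixOfSeq (L ++ L') a) : IsPrefixOfSeq L a := by
  intro i hi
  have := h i (by simp; omega)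
  rw [← this, List.getD_append _ _ _ _ hi]

theorem pal_entries (U V : List ℕ) (a : ℕ → ℕ) (h : IsPrefixOfSeq (U ++ V ++ U.reverse) a) (r s : ℕ)
    (hr : U.length = r + 1) (hs : 2 * U.length + V.length = s + 1) :
    ∃ w1 w2 : ℤ, 0 ≤ w1 ∧ 0 ≤ w2 ∧ (cfDen a (s + 1) : ℤ) = w1 * cfDen a (r + 1) + w2 * cfDen a r ∧
      (cfDen a s : ℤ) = w1 * cfNum a (r + 1) + w2 * cfNum a r := by
  have e1 := prefix_eq _ _ h
  have e2 := prefix_eq _ _ (prefix_left _ _ _ (prefix_left _ _ _ h))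
  have hl : (U ++ V ++ U.reverse).length = s + 1 := by simp; omega
  rw [hl] at e1
  rw [hr] at e2
  have m1 : cm (U ++ V ++ U.reverse) = _ := (congrArg cm e1).trans (cm_range a s)
  have m2 : cm U = _ := (congrArg cm e2).trans (cm_range a r)
  rw [cm_append, cm_append, cm_reverse] at m1
  have n00 := cm_nonneg (U ++ V) 0 0
  have n01 := cm_nonneg (U ++ V) 0 1
  rw [← cm_append] at m1
  have t0 := congrFun (congrFun m1 0) 0
  have t1 := congrFun (congrFun m1 0) 1
  rw [Matrix.mul_apply, Fin.sum_univ_two, Matrix.transpose_apply, Matrix.transpose_apply, m2] at t0 t1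
  simp at t0 t1
  exact ⟨_, _, n00, n01, t0.symm, t1.symm⟩

theorem pal_bound (U V : List ℕ) (a : ℕ → ℕ) (ha : ∀ n, 1 ≤ n → 1 ≤ a n) (α : ℝ)
    (hα : Tendsto (fun n => (cfNum a n : ℝ) / cfDen a n) atTop (𝓝 α))
    (h : IsPrefixOfSeq (U ++ V ++ U.reverse) a) (r s : ℕ)
    (hr : U.length = r + 1) (hs : 2 * U.length + V.length = s + 1) :
    |α * cfDen a (s + 1) - cfDen a s| * (cfDen a r : ℝ) ^ 2 ≤ cfDen a (s + 1) := by
  obtain ⟨w1, w2, h1, h2, e1, e2⟩ := pal_entries U V a h r s hr hs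
  have e1' : (cfDen a (s + 1) : ℝ) = w1 * cfDen a (r + 1) + w2 * cfDen a r := by exact_mod_cast e1
  have e2' : (cfDen a s : ℝ) = w1 * cfNum a (r + 1) + w2 * cfNum a r := by exact_mod_cast e2
  have h1' : (0:ℝ) ≤ w1 := by exact_mod_cast h1
  have h2' : (0:ℝ) ≤ w2 := by exact_mod_cast h2
  have b0 := cfE_le a ha α hα r
  have b1 := cfE_le a ha α hα (r + 1)
  have q0 : (1:ℝ) ≤ cfDen a r := by exact_mod_cast (cfDen_pos a ha r).1
  have q01 : (cfDen a r : ℝ) ≤ cfDen a (r + 1) := by exact_mod_cast cfDen_mono1 a ha r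
  have q12 : (cfDen a (r + 1) : ℝ) ≤ cfDen a (r + 1 + 1) := by exact_mod_cast cfDen_mono1 a ha (r + 1)
  have g0 : |α * cfDen a r - cfNum a r| * cfDen a r ≤ 1 :=
    (mul_le_mul_of_nonneg_left q01 (abs_nonneg _)).trans b0
  have g1 : |α * cfDen a (r + 1) - cfNum a (r + 1)| * cfDen a r ≤ 1 :=
    (mul_le_mul_of_nonneg_left (q01.trans q12) (abs_nonneg _)).trans b1
  have e3 : α * cfDen a (s + 1) - cfDen a s = w1 * (α * cfDen a (r + 1) - cfNum a (r + 1)) + w2 * (α * cfDen a r - cfNum a r) := by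
    rw [e1', e2']; ring
  have e4 : |α * cfDen a (s + 1) - cfDen a s| ≤ w1 * |α * cfDen a (r + 1) - cfNum a (r + 1)| + w2 * |α * cfDen a r - cfNum a r| := by
    rw [e3]
    refine (abs_add_le _ _).trans (le_of_eq ?_)
    rw [abs_mul, abs_mul, abs_of_nonneg h1', abs_of_nonneg h2']
  have e5 : |α * cfDen a (s + 1) - cfDen a s| * cfDen a r ≤ w1 + w2 := by
    refine (mul_le_mul_of_nonneg_right e4 (by positivity)).trans ?_
    have := mul_le_mul_of_nonneg_left g0 h2'
    have := mul_le_mul_of_nonneg_left g1 h1'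
    linarith
  calc _ = (|α * cfDen a (s + 1) - cfDen a s| * cfDen a r) * cfDen a r := by ring
    _ ≤ (w1 + w2) * cfDen a r := mul_le_mul_of_nonneg_right e5 (by positivity)
    _ ≤ _ := by rw [e1']; nlinarith

end

section

def row4 (q q' p p' : ℤ) (y : Fin 3 → ℤ) : Fin 4 → ℤ :=
  ![q' * y 0 - q * y 1, q' * y 1 - q * y 2, p' * y 0 - p * y 1, p' * y 1 - p * y 2]

noncomputable def Lam4 (α : ℝ) : Fin 4 → Fin 4 → ℝ :=
  ![![1, 0, 0, 0], ![0, 1, 0, 0], ![α, 0, -1, 0], ![α ^ 2, -α, -α, 1]]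

theorem det4 (q q' p p' : ℤ) (x y z : Fin 3 → ℤ) :
    Matrix.det (Matrix.of ![fun i : Fin 4 => if i = 3 then (1:ℤ) else 0, row4 q q' p p' x, row4 q q' p p' y, row4 q q' p p' z]) =
      -(q * (q * p' - q' * p)) * dt (cr x y) z := by
  rw [Matrix.det_succ_row_zero]
  simp [Fin.sum_univ_succ, Matrix.det_fin_three, row4, dt, cr, Fin.succAbove, Matrix.submatrix]
  ring

theorem rows4_bound (α : ℝ) (q q' p p' : ℤ) (Q η : ℝ) (hη : 0 ≤ η) (hQ : 0 ≤ Q) (hq : 0 < q) (hq' : |(q':ℝ)| ≤ q)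
    (h1 : |α * q - p| * q ≤ 1) (h2 : |α * q' - p'| * q ≤ 1) (h3 : |α * q - q'| * Real.exp Q ≤ q)
    (y : Fin 3 → ℤ) (hy : ∀ i, |Mv α Q y i| ≤ η) :
    |∑ i, Lam4 α 0 i * (row4 q q' p p' y i : ℝ)| ≤ (2 + |α|) * (q * η) ∧
    |∑ i, Lam4 α 1 i * (row4 q q' p p' y i : ℝ)| ≤ (2 + |α|) * (q * η) ∧
    |∑ i, Lam4 α 2 i * (row4 q q' p p' y i : ℝ)| ≤ (2 + |α|) * ((q:ℝ)⁻¹ * (Real.exp Q * η)) ∧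
    |∑ i, Lam4 α 3 i * (row4 q q' p p' y i : ℝ)| ≤ (2 + |α|) * ((q:ℝ)⁻¹ * η) := by
  have hqr : (0:ℝ) < q := by exact_mod_cast hq
  have b0 := hy 0
  have b1 := hy 1
  have b2 := hy 2
  simp only [Mv, Matrix.cons_val_zero, Matrix.cons_val_one, Matrix.cons_val] at b0 b1 b2
  rw [abs_mul, Real.abs_exp, Real.exp_neg, inv_mul_le_iff₀ (Real.exp_pos _)] at b0
  have eQ : 1 ≤ Real.exp Q := Real.one_le_exp hQ
  set X := Real.exp Q with hX
  have h1' : |α * q - p| ≤ (q:ℝ)⁻¹ := by rw [← one_div, le_div_iff₀ hqr]; exact h1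
  have h2' : |α * q' - p'| ≤ (q:ℝ)⁻¹ := by rw [← one_div, le_div_iff₀ hqr]; exact h2
  have h3' : |α * q - q'| ≤ q / X := by rw [le_div_iff₀ (by positivity)]; exact h3
  set e1 : ℝ := y 1 - α * y 0 with he1
  set e2 : ℝ := y 2 - α ^ 2 * y 0 with he2
  have hα0 := abs_nonneg α
  have hbt : |(y 0 : ℝ) * (α * q - q')| ≤ q * η := by
    rw [abs_mul]
    calc _ ≤ (X * η) * (q / X) := by gcongr
      _ = q * η := by field_simp
  have hαe : |α * e1| ≤ |α| * η := by rw [abs_mul]; gcongr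
  refine ⟨?_, ?_, ?_, ?_⟩
  · have : ∑ i, Lam4 α 0 i * (row4 q q' p p' y i : ℝ) = -(q * e1) - y 0 * (α * q - q') := by
      simp [Lam4, row4, Fin.sum_univ_four, he1]; ring
    rw [this]
    have k1 : |(q:ℝ) * e1| ≤ q * η := by rw [abs_mul, abs_of_pos hqr]; gcongr
    have k2 : 0 ≤ |α| * (q * η) := by positivity
    rw [abs_le] at *
    constructor <;> linarith [k1.1, k1.2, hbt.1, hbt.2]
  · have : ∑ i, Lam4 α 1 i * (row4 q q' p p' y i : ℝ) = -(q * e2) + q' * e1 - α * (y 0 * (α * q - q')) := by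
      simp [Lam4, row4, Fin.sum_univ_four, he1, he2]; ring
    rw [this]
    have k1 : |(q:ℝ) * e2| ≤ q * η := by rw [abs_mul, abs_of_pos hqr]; gcongr
    have k2 : |(q':ℝ) * e1| ≤ q * η := by rw [abs_mul]; gcongr
    have k3 : |α * (y 0 * (α * q - q'))| ≤ |α| * (q * η) := by
      rw [abs_mul]; gcongr
    have t := abs_sub (-(q * e2) + q' * e1) (α * (y 0 * (α * q - q')))
    have t2 := abs_add_le (-(q * e2)) (q' * e1)
    rw [abs_neg] at t2
    linarith
  · have : ∑ i, Lam4 α 2 i * (row4 q q' p p' y i : ℝ) = -((α * q - p) * (e1 + α * y 0)) + (α * q' - p') * y 0 := by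
      simp [Lam4, row4, Fin.sum_univ_four, he1]; ring
    rw [this]
    have hy1 : |e1 + α * y 0| ≤ X * η + |α| * (X * η) := by
      refine (abs_add_le _ _).trans ?_
      rw [abs_mul]
      have : η ≤ X * η := by nlinarith
      have : |α| * |(y 0 : ℝ)| ≤ |α| * (X * η) := by gcongr
      linarith
    have k1 : |(α * q - p) * (e1 + α * y 0)| ≤ (q:ℝ)⁻¹ * (X * η + |α| * (X * η)) := by
      rw [abs_mul]; gcongr
    have k2 : |(α * q' - p') * (y 0 : ℝ)| ≤ (q:ℝ)⁻¹ * (X * η) := by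
      rw [abs_mul]; gcongr
    have t2 := abs_add_le (-((α * q - p) * (e1 + α * y 0))) ((α * q' - p') * y 0)
    rw [abs_neg] at t2
    linarith
  · have : ∑ i, Lam4 α 3 i * (row4 q q' p p' y i : ℝ) = (α * q - p) * (e2 - α * e1) - (α * q' - p') * e1 := by
      simp [Lam4, row4, Fin.sum_univ_four, he1, he2]; ring
    rw [this]
    have hy1 : |e2 - α * e1| ≤ η + |α| * η := (abs_sub _ _).trans (by linarith)
    have k1 : |(α * q - p) * (e2 - α * e1)| ≤ (q:ℝ)⁻¹ * (η + |α| * η) := by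
      rw [abs_mul]; gcongr
    have k2 : |(α * q' - p') * e1| ≤ (q:ℝ)⁻¹ * η := by
      rw [abs_mul]; gcongr
    have t2 := abs_sub ((α * q - p) * (e2 - α * e1)) ((α * q' - p') * e1)
    linarith

open Polynomial in
theorem PT4 (α : ℝ) (hα : IsAlgebraic ℚ α) (δ Cw : ℝ) (hδ : 0 < δ) (hCw : 0 < Cw) :
    ∃ S0, ∀ S, S0 ≤ S → ¬ GoodAt (Lam4 α) 0 δ Cw 1 S := by
  obtain ⟨a, d, A, v, e0, ha, hv, hv0, -⟩ := nf_data α hα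
  set β : Fin 4 → Fin 4 → ℤ[X] := ![![C a, 0, 0, 0], ![0, C a, 0, 0], ![X, 0, -C a, 0], ![0, X, -X, C a]] with hβ
  exact PT β A (a * α) v e0 hv hv0 (Lam4 α) a ha (by
    intro i k
    fin_cases i <;> fin_cases k <;> simp [hβ, Lam4, Fin.sum_univ_four] <;> ring) 0 δ Cw 1
    hδ hCw one_pos

/-- No good approximations : the final contradiction, in numerical form. -/
theorem final_num (α : ℝ) (hα : IsAlgebraic ℚ α)
    (hind : ∀ c : Fin 3 → ℤ, c ≠ 0 → (c 0 : ℝ) + c 1 * α + c 2 * α ^ 2 ≠ 0) (κ : ℝ) (hκ : 0 < κ) :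
    ∃ Q0 : ℝ, ∀ (Q : ℝ) (q q' p p' : ℤ), Q0 ≤ Q → 0 < q → |(q':ℝ)| ≤ q → κ * Real.log q ≤ Q → Q ≤ 2 * Real.log q →
      |α * q - p| * q ≤ 1 → |α * q' - p'| * q ≤ 1 → |α * q - q'| * Real.exp Q ≤ q →
      |q * p' - q' * p| = 1 → False := by
  obtain ⟨S0, hS0⟩ := PT4 α hα (κ / 12) 10 (by positivity) (by norm_num)
  obtain ⟨Q1, hQ1, hT⟩ := TR α hα hind (1 / 24) (by norm_num)
  set c := Real.log (2 + |α|) with hc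
  have hα0 := abs_nonneg α
  have hc0 : 0 ≤ c := Real.log_nonneg (by linarith)
  have hec : Real.exp c = 2 + |α| := Real.exp_log (by linarith)
  refine ⟨max Q1 (max (2 * S0) (48 * c + 1)), ?_⟩
  intro Q q q' p p' hQ hq hq' hκQ hQ2 h1 h2 h3 hdet
  have g1 : Q1 ≤ Q := (le_max_left _ _).trans hQ
  have g2 : 2 * S0 ≤ Q := (le_max_left _ _).trans ((le_max_right _ _).trans hQ)
  have g3 : 48 * c + 1 ≤ Q := (le_max_right _ _).trans ((le_max_right _ _).trans hQ)
  have hqr : (0:ℝ) < q := by exact_mod_cast hq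
  have hQ0 : 0 ≤ Q := hQ1.trans g1
  obtain ⟨y, hy, hyb⟩ := hT Q g1
  set S := Real.log q with hS
  have heS : Real.exp S = q := Real.exp_log hqr
  have hSp : 0 < S := by linarith
  refine hS0 S (by linarith) ?_
  set η := Real.exp (-Q / 3 + 1 / 24 * Q) with hη
  have hb := fun k => rows4_bound α q q' p p' Q η (Real.exp_pos _).le hQ0 hq hq' h1 h2 h3 (y k) (n2_abs _ _ (hyb k))
  have hne : q * p' - q' * p ≠ 0 := by intro h; rw [h] at hdet; simp at hdet
  set w : Fin 4 → ℝ := ![(c + (S + (-Q / 3 + 1 / 24 * Q))) / S, (c + (S + (-Q / 3 + 1 / 24 * Q))) / S,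
    (c + (-S + (Q + (-Q / 3 + 1 / 24 * Q)))) / S, (c + (-S + (-Q / 3 + 1 / 24 * Q))) / S] with hw
  have E0 : Real.exp (w 0 * S) = (2 + |α|) * (q * η) := by
    simp only [hw, Matrix.cons_val_zero]
    rw [div_mul_cancel₀ _ hSp.ne', Real.exp_add, Real.exp_add, hec, heS]
  have E1 : Real.exp (w 1 * S) = (2 + |α|) * (q * η) := by
    simp only [hw, Matrix.cons_val_one, Matrix.cons_val_zero]
    rw [div_mul_cancel₀ _ hSp.ne', Real.exp_add, Real.exp_add, hec, heS]
  have E2 : Real.exp (w 2 * S) = (2 + |α|) * ((q:ℝ)⁻¹ * (Real.exp Q * η)) := by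
    simp only [hw, Matrix.cons_val]
    rw [div_mul_cancel₀ _ hSp.ne', Real.exp_add, Real.exp_add, Real.exp_add, Real.exp_neg, hec, heS]
  have E3 : Real.exp (w 3 * S) = (2 + |α|) * ((q:ℝ)⁻¹ * η) := by
    simp only [hw, Matrix.cons_val]
    rw [div_mul_cancel₀ _ hSp.ne', Real.exp_add, Real.exp_add, Real.exp_neg, hec, heS]
  have hforms : ∀ k j, |∑ i, Lam4 α j i * (row4 q q' p p' (y k) i : ℝ)| ≤ Real.exp (w j * S) := by
    intro k j
    obtain ⟨t0, t1, t2, t3⟩ := hb k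
    fin_cases j
    · exact t0.trans_eq E0.symm
    · exact t1.trans_eq E1.symm
    · exact t2.trans_eq E2.symm
    · exact t3.trans_eq E3.symm
  refine ⟨w, ![p', -p, -q', q], 3, 1,
    Matrix.of ![fun i : Fin 4 => if i = 3 then (1:ℤ) else 0, row4 q q' p p' (y 0), row4 q q' p p' (y 1), row4 q q' p p' (y 2)],
    ?_, ?_, by decide, ?_, ?_, ?_, ?_, ?_, ?_⟩
  · intro i
    have hcS : c ≤ S := by linarith
    fin_cases i <;> simp only [hw, Fin.zero_eta, Fin.mk_one, Fin.reduceFinMk, Matrix.cons_val_zero, Matrix.cons_val_one, Matrix.cons_val] <;>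
    · rw [abs_div, abs_of_pos hSp, div_le_iff₀ hSp, abs_le]
      constructor <;> linarith
  · have : ∑ i, w i = (4 * c - Q / 6) / S := by
      simp only [hw, Fin.sum_univ_four, Matrix.cons_val_zero, Matrix.cons_val_one, Matrix.cons_val]
      field_simp
      ring
    rw [this, div_le_iff₀ hSp]
    linarith
  · simpa using hq.ne'
  · simp only [Matrix.cons_val, Matrix.cons_val_one]
    have hg : Int.gcd q (-p) = 1 := by
      rw [Int.gcd_neg]
      rw [← Int.isCoprime_iff_gcd_eq_one]
      rcases (abs_eq one_pos.le).mp hdet with h | h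
      · exact ⟨p', -q', by linarith⟩
      · exact ⟨-p', q', by linarith⟩
    rw [hg, one_mul, heS, abs_of_pos hqr]; simp
  · rw [det4, hy, mul_one]
    simp only [ne_eq, neg_eq_zero, mul_eq_zero, not_or]
    exact ⟨hq.ne', hne⟩
  · intro i; rfl
  · intro k hk
    have : ∀ y : Fin 3 → ℤ, ∑ i, row4 q q' p p' y i * (![p', -p, -q', q] : Fin 4 → ℤ) i = 0 := by
      intro y; simp [row4, Fin.sum_univ_four]; ring
    fin_cases k
    · exact absurd rfl hk
    · exact this _
    · exact this _
    · exact this _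
  · intro k hk j
    fin_cases k
    · exact absurd rfl hk
    · exact hforms 0 j
    · exact hforms 1 j
    · exact hforms 2 j

end


theorem statement1 (a : ℕ → ℕ) (ha : ∀ n, 1 ≤ n → 1 ≤ a n)
    (α : ℝ)
    (hα : Tendsto (fun n => (cfNum a n : ℝ) / cfDen a n) atTop (𝓝 α))
    (hbdd : ∃ C : ℝ, ∀ ℓ : ℕ, 1 ≤ ℓ → (cfDen a ℓ : ℝ) ^ (1 / (ℓ : ℝ)) ≤ C)
    (w : ℚ) (hw : 0 < w) (hcond : ConditionStar w a) :
    Transcendental ℚ α := by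
  intro halg
  obtain ⟨hper, U, V, hpre, hlen, hmono⟩ := hcond
  obtain ⟨C, hC⟩ := hbdd
  have hind : ∀ c : Fin 3 → ℤ, c ≠ 0 → (c 0:ℝ)+c 1*α+c 2*α^2 ≠ 0 := by
    intro c hc h
    refine hper (lagrange a ha α hα (c 0) (c 1) (c 2) ?_ h)
    rintro ⟨h0, h1, h2⟩
    rcases int3_ne hc with h | h | h <;> contradiction
  set D : ℝ := max C 2 with hD
  have hD2 : 2 ≤ D := le_max_right _ _
  have hDlog : 0 < Real.log D := Real.log_pos (by linarith)
  have hl2 : 0 < Real.log 2 := Real.log_pos (by norm_num)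
  have hwR : (0:ℝ) < w := by exact_mod_cast hw
  have hden : 0 < (2 + (w:ℝ)) * Real.log D := by positivity
  set κ : ℝ := (Real.log 2 / 2) / ((2 + (w:ℝ)) * Real.log D) with hκd
  have hκ : 0 < κ := by positivity
  obtain ⟨Q0, hQ0⟩ := final_num α halg hind κ hκ
  obtain ⟨N, hN⟩ := exists_nat_ge (Q0 / Real.log 2)
  set n := N + 4 with hn
  have hUn : n ≤ (U n).length := hmono.le_apply (x := n)
  obtain ⟨r, hr⟩ : ∃ r, (U n).length = r + 1 := ⟨(U n).length - 1, by omega⟩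
  obtain ⟨s, hs⟩ : ∃ s, 2 * (U n).length + (V n).length = s + 1 :=
    ⟨2 * (U n).length + (V n).length - 1, by omega⟩
  have hrn : N + 3 ≤ r := by omega
  have hrN : (N:ℝ) + 3 ≤ r := by exact_mod_cast hrn
  have hN0 : (0:ℝ) ≤ N := Nat.cast_nonneg _
  have hV := hlen n (by omega)
  have hVR : ((V n).length : ℝ) ≤ w * (U n).length := by exact_mod_cast hV
  have hsR : (s:ℝ) + 1 ≤ (2 + w) * (r + 1) := by
    have h1 : (2:ℝ) * (U n).length + (V n).length = s + 1 := by exact_mod_cast hs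
    have h2 : ((U n).length : ℝ) = r + 1 := by exact_mod_cast hr
    rw [h2] at h1 hVR
    linarith
  have hpal := pal_bound (U n) (V n) a ha α hα (hpre n (by omega)) r s hr hs
  have hqr : (1:ℝ) ≤ cfDen a r := by exact_mod_cast (cfDen_pos a ha r).1
  have hqs : (1:ℝ) ≤ cfDen a (s+1) := by exact_mod_cast (cfDen_pos a ha s).2
  have hm1 : (cfDen a s : ℝ) ≤ cfDen a (s+1) := by
    exact_mod_cast cfDen_mono a ha (Nat.le_succ s)
  have hm2 : (cfDen a (s+1) : ℝ) ≤ cfDen a (s+1+1) := by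
    exact_mod_cast cfDen_mono a ha (Nat.le_succ (s+1))
  have hm3 : (cfDen a r : ℝ) ≤ cfDen a (s+1) := by
    exact_mod_cast cfDen_mono a ha (by omega : r ≤ s + 1)
  -- lower bound for the logarithm
  have hlow : ((r:ℝ) - 1) * Real.log 2 ≤ 2 * Real.log (cfDen a r) := by
    have h := (cfDen_growth a ha r).1
    have h' : (2:ℝ)^r ≤ 2 * (cfDen a r:ℝ)^2 := by exact_mod_cast h
    have h2 := Real.log_le_log (by positivity) h'
    rw [Real.log_pow, Real.log_mul (by norm_num) (by positivity), Real.log_pow] at h2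
    push_cast at h2
    linarith
  have hup : Real.log (cfDen a (s+1)) ≤ ((s:ℝ) + 1) * Real.log D := by
    have h := (hC (s+1) (by omega)).trans (le_max_left C 2)
    have h2 := Real.log_le_log (by positivity) h
    rw [Real.log_rpow (by linarith)] at h2
    push_cast at h2
    rw [one_div, inv_mul_le_iff₀ (by positivity)] at h2
    exact h2
  refine hQ0 (2 * Real.log (cfDen a r)) (cfDen a (s+1)) (cfDen a s) (cfNum a (s+1)) (cfNum a s)
    ?_ ?_ ?_ ?_ ?_ ?_ ?_ ?_ ?_
  · refine le_trans ?_ hlow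
    rw [div_le_iff₀ hl2] at hN
    nlinarith
  · exact_mod_cast (cfDen_pos a ha s).2
  · push_cast
    rw [abs_of_nonneg (by positivity)]
    exact hm1
  · push_cast
    refine le_trans ?_ hlow
    have h1 : κ * Real.log (cfDen a (s+1)) ≤ κ * (((2 + w) * Real.log D) * (r + 1)) := by
      refine mul_le_mul_of_nonneg_left (hup.trans ?_) hκ.le
      nlinarith
    refine h1.trans ?_
    rw [← mul_assoc, hκd, div_mul_cancel₀ _ hden.ne']
    nlinarith
  · push_cast
    have := Real.log_le_log (by linarith) hm3
    linarith
  · push_cast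
    refine le_trans ?_ (cfE_le a ha α hα (s+1))
    exact mul_le_mul_of_nonneg_left hm2 (abs_nonneg _)
  · push_cast
    exact cfE_le a ha α hα s
  · push_cast
    have : Real.exp (2 * Real.log (cfDen a r)) = (cfDen a r : ℝ)^2 := by
      rw [two_mul, Real.exp_add, Real.exp_log (by linarith), sq]
    rw [this]
    exact hpal
  · have h := cf_det a s
    have : (cfDen a (s+1) : ℤ) * cfNum a s - cfDen a s * cfNum a (s+1) = -(-1)^s := by
      rw [← h]; ring
    rw [this]
    simp
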